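/- Let S¹ = N(σ_0¹, …, σ_{m₁}¹) and S² = N(σ_0², …, σ_{m₂}²) be two Nikishin systems with σ_0¹ = σ_0², let n = (n_1; n_2) with |n_1| = |n_2| + 1, let A_n be a mixed type vector polynomial relative to (S¹, S², n), and let 𝒜_n = a_{n,0} + Σ_{k=1}^{m₁} a_{n,k}·ŝ¹_{1,k} be its linear form. Then: (i) ∫ (p_0(x) + Σ_{j=1}^{m₂} p_j(x)·ŝ²_{1,j}(x)) · 𝒜_n(x) dσ_0²(x) = 0 for all real polynomials p_0, …, p_{m₂} with deg p_j ≤ n_{2,j} − 1; and (ii) 𝒜_n has exactly |n_2| zeros in ℂ ∖ Co(supp σ_1¹), all of which are simple and lie in the interior of Co(supp σ_0¹). -/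

import Mathlib

open MeasureTheory Set Polynomial Filter

noncomputable section

/-- A signed Borel measure on `ℝ`, represented by a pair of (nonnegative) measures
(a "positive part" and a "negative part"). -/
structure SignedM where
  pos : MeasureTheory.Measure ℝ
  neg : MeasureTheory.Measure ℝ

namespace SignedM

/-- Integral of a complex-valued function against a signed measure. -/
def cintegral (s : SignedM) (f : ℝ → ℂ) : ℂ :=
  (∫ x, f x ∂s.pos) - ∫ x, f x ∂s.neg

/-- Integral of a real-valued function against a signed measure. -/
def rintegral (s : SignedM) (f : ℝ → ℝ) : ℝ :=
  (∫ x, f x ∂s.pos) - ∫ x, f x ∂s.neg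

/-- The Cauchy transform `ŝ(z) = ∫ ds(x)/(z - x)` at a complex point. -/
def cauchy (s : SignedM) (z : ℂ) : ℂ :=
  s.cintegral fun x => (z - (x : ℂ))⁻¹

/-- The Cauchy transform at a real point (real-valued). -/
def cauchyR (s : SignedM) (x : ℝ) : ℝ :=
  s.rintegral fun t => (x - t)⁻¹

/-- The total variation `|s|` (for the constant-sign representation used here). -/
def mass (s : SignedM) : ℝ :=
  (s.pos Set.univ).toReal + (s.neg Set.univ).toReal

/-- The (topological) support of a nonnegative measure. -/
def msupport (μ : MeasureTheory.Measure ℝ) : Set ℝ :=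
  {x | ∀ U : Set ℝ, IsOpen U → x ∈ U → μ U ≠ 0}

/-- The support of a signed measure. -/
def supp (s : SignedM) : Set ℝ := msupport s.pos ∪ msupport s.neg

/-- The signed measure `g·s` with (real, possibly sign-changing) density `g` w.r.t. `s`. -/
def withDensityR (s : SignedM) (g : ℝ → ℝ) : SignedM where
  pos := s.pos.withDensity (fun x => ENNReal.ofReal (g x)) +
    s.neg.withDensity (fun x => ENNReal.ofReal (-g x))
  neg := s.pos.withDensity (fun x => ENNReal.ofReal (-g x)) +
    s.neg.withDensity (fun x => ENNReal.ofReal (g x))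

/-- The product `⟨a, b⟩`: the measure with density `b̂` with respect to `a`. -/
def nik (a b : SignedM) : SignedM := a.withDensityR b.cauchyR

end SignedM

/-- `s ∈ M(Δ)`: a finite Borel measure with constant sign, whose support is compact and
consists of infinitely many points, `Δ` being the smallest closed interval containing it. -/
structure IsM (s : SignedM) (Δ : Set ℝ) : Prop where
  posFinite : MeasureTheory.IsFiniteMeasure s.pos
  negFinite : MeasureTheory.IsFiniteMeasure s.neg
  constSign : s.pos = 0 ∨ s.neg = 0
  compactSupp : IsCompact s.supp
  infiniteSupp : s.supp.Infinite
  hullEq : Δ = Set.Icc (sInf s.supp) (sSup s.supp)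

/-- A set of reals, viewed inside `ℂ`. -/
def cSet (Δ : Set ℝ) : Set ℂ := (fun x : ℝ => (x : ℂ)) '' Δ

/-- `τ` is the inverse measure of `s`: `1/ŝ(z) = z/|s| + b + τ̂(z)` on `ℂ ∖ Δ`. -/
def IsInverse (s τ : SignedM) (Δ : Set ℝ) : Prop :=
  ∃ b : ℝ, ∀ z : ℂ, z ∉ cSet Δ →
    (s.cauchy z)⁻¹ = z / (s.mass : ℂ) + (b : ℂ) + τ.cauchy z

/-- The iterated products `s_{j,k} = ⟨σ_j, σ_{j+1}, …, σ_k⟩` of a Nikishin system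
(`s_{j,k} = σ_j` when `j ≥ k`). -/
def nikSys (σ : ℕ → SignedM) : ℕ → ℕ → SignedM
  | j, k => if h : j < k then (σ j).nik (nikSys σ (j + 1) k) else σ j
  termination_by j k => k - j
  decreasing_by omega

/-- `ŝ_{1,k}` as a real function, with the convention `ŝ_{1,0} ≡ 1`. -/
def sh1R (σ : ℕ → SignedM) (k : ℕ) (x : ℝ) : ℝ :=
  if k = 0 then 1 else (nikSys σ 1 k).cauchyR x

/-- `ŝ_{1,k}` as a complex function, with the convention `ŝ_{1,0} ≡ 1`. -/
def sh1C (σ : ℕ → SignedM) (k : ℕ) (z : ℂ) : ℂ :=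
  if k = 0 then 1 else (nikSys σ 1 k).cauchy z

/-- `A = (a_0, …, a_{m₁})` is a mixed type vector polynomial relative to the pair of
Nikishin systems generated by `σ1 = (σ₀¹, …, σ_{m₁}¹)` and `σ2 = (σ₀², …, σ_{m₂}²)`
(with `σ₀¹ = σ₀²`) and the multi-index `n = (n1; n2)`: the `a_k` are real polynomials,
not all zero, `deg a_k ≤ n_{1,k} − 1`, and for each `i ≤ m₂` there is a polynomial `d_i`
with `Σ_k a_k(z) ∫ ŝ²_{1,i}(x) ŝ¹_{1,k}(x) dσ₀²(x)/(z−x) − d_i(z) = O(1/z^{n_{2,i}+1})`. -/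
def IsMixedVP (σ1 σ2 : ℕ → SignedM) (m1 m2 : ℕ) (n1 n2 : ℕ → ℕ)
    (a : ℕ → Polynomial ℝ) : Prop :=
  (¬ ∀ k ≤ m1, a k = 0) ∧
  (∀ k ≤ m1, (a k).degree < (n1 k : WithBot ℕ)) ∧
  (∀ i ≤ m2, ∃ d : Polynomial ℝ, ∃ C R : ℝ, ∀ z : ℂ, R ≤ ‖z‖ →
    ‖(∑ k ∈ Finset.range (m1 + 1), aeval z (a k) *
        (σ2 0).cintegral (fun x =>
          ((sh1R σ2 i x * sh1R σ1 k x : ℝ) : ℂ) * (z - (x : ℂ))⁻¹)) -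
      aeval z d‖ ≤ C / ‖z‖ ^ (n2 i + 1))

namespace NikAux

open Topology Bornology

/-- The complement in `ℂ` of the real segment `[a, b]`. -/
def Off (a b : ℝ) : Set ℂ := {z | z.im ≠ 0 ∨ z.re < a ∨ b < z.re}

/-- A finite positive measure carried by `[a, b]`. -/
structure Car (μ : Measure ℝ) (a b : ℝ) : Prop where
  fin : IsFiniteMeasure μ
  null : μ (Icc a b)ᶜ = 0

/-- A finite positive measure carried by `[a, b]` and by no finite set. -/
structure Gen (μ : Measure ℝ) (a b : ℝ) : Prop extends Car μ a b where
  inf : ∀ F : Finset ℝ, μ (F : Set ℝ)ᶜ ≠ 0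

/-- The Cauchy transform of the measure `g • μ`. -/
def cT (μ : Measure ℝ) (g : ℝ → ℂ) (z : ℂ) : ℂ := ∫ x, g x * (z - x)⁻¹ ∂μ

theorem isOpen_Off (a b : ℝ) : IsOpen (Off a b) := by
  have : Off a b = {z : ℂ | z.im ≠ 0} ∪ ({z | z.re < a} ∪ {z | b < z.re}) := by
    ext z; simp [Off]
  rw [this]
  refine (isOpen_ne_fun Complex.continuous_im continuous_const).union
    ((isOpen_lt Complex.continuous_re continuous_const).union
      (isOpen_lt continuous_const Complex.continuous_re))

theorem ofReal_mem_Off {a b x : ℝ} : (x : ℂ) ∈ Off a b ↔ x ∉ Icc a b := by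
  simp only [Off, mem_ofPred_eq, Complex.ofReal_im, ne_eq, not_true_eq_false, Complex.ofReal_re,
    false_or, mem_Icc, not_and_or, not_le]

theorem mem_Off_of_im {a b : ℝ} {z : ℂ} (h : z.im ≠ 0) : z ∈ Off a b := Or.inl h

theorem exists_real_of_im {z : ℂ} (h : z.im = 0) : ((z.re : ℝ) : ℂ) = z := by
  apply Complex.ext <;> simp [h]

theorem sub_ne_zero_of_Off {a b x : ℝ} {z : ℂ} (hz : z ∈ Off a b) (hx : x ∈ Icc a b) :
    z - x ≠ 0 := by
  intro h
  rw [sub_eq_zero] at h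
  subst h
  exact ofReal_mem_Off.1 hz hx

theorem conj_mem_Off {a b : ℝ} {z : ℂ} (hz : z ∈ Off a b) :
    (starRingEnd ℂ) z ∈ Off a b := by
  simpa [Off] using hz

theorem isPreconnected_Off (a b : ℝ) : IsPreconnected (Off a b) := by
  have hcup : ∀ {s : Set ℂ}, Convex ℝ s → IsPreconnected s := fun h => h.isPreconnected
  have c1 : Convex ℝ {z : ℂ | 0 < z.im} := convex_halfSpace_im_gt 0
  have c2 : Convex ℝ {z : ℂ | z.im < 0} := convex_halfSpace_im_lt 0
  have c3 : Convex ℝ {z : ℂ | z.re < a} := convex_halfSpace_re_lt a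
  have c4 : Convex ℝ {z : ℂ | b < z.re} := convex_halfSpace_re_gt b
  have e : Off a b = (({z : ℂ | 0 < z.im} ∪ {z : ℂ | z.re < a}) ∪ {z : ℂ | z.im < 0})
      ∪ {z : ℂ | b < z.re} := by
    ext z
    simp only [Off, mem_ofPred_eq, mem_union, ne_iff_lt_or_gt]
    tauto
  rw [e]
  refine IsPreconnected.union ⟨b + 1, 1⟩ (by simp) (by simp) ?_ (hcup c4)
  refine IsPreconnected.union ⟨a - 1, -1⟩ (by simp) (by simp) ?_ (hcup c2)
  exact IsPreconnected.union ⟨a - 1, 1⟩ (by simp) (by simp) (hcup c1) (hcup c3)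

theorem Car.ae {μ : Measure ℝ} {a b : ℝ} (h : Car μ a b) : ∀ᵐ x ∂μ, x ∈ Icc a b := by
  rw [ae_iff]; exact h.null

theorem Gen.lt {μ : Measure ℝ} {a b : ℝ} (h : Gen μ a b) : a < b := by
  by_contra hab
  apply h.inf {a}
  refine measure_mono_null ?_ h.null
  intro x hx hx'
  apply hx
  have := hx'.1; have := hx'.2
  simp; linarith

theorem Gen.ne_zero {μ : Measure ℝ} {a b : ℝ} (h : Gen μ a b) : μ ≠ 0 := by
  intro h0
  exact h.inf ∅ (by simp [h0])

theorem Gen.mass_pos {μ : Measure ℝ} {a b : ℝ} (h : Gen μ a b) : 0 < μ.real univ := by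
  have := h.fin
  rw [measureReal_def]
  refine ENNReal.toReal_pos ?_ (measure_ne_top _ _)
  simpa using h.ne_zero

theorem Car.integrable {E : Type*} [NormedAddCommGroup E] [SecondCountableTopology E]
    {μ : Measure ℝ} {a b : ℝ} (h : Car μ a b)
    {g : ℝ → E} (hg : ContinuousOn g (Icc a b)) : Integrable g μ := by
  have := h.fin
  have hr : μ.restrict (Icc a b) = μ := Measure.restrict_eq_self_of_ae_mem h.ae
  rw [← hr]
  exact hg.integrableOn_compact isCompact_Icc

theorem continuousOn_kernel {a b : ℝ} {z : ℂ} (hz : z ∈ Off a b) :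
    ContinuousOn (fun x : ℝ => (z - x)⁻¹) (Icc a b) :=
  ContinuousOn.inv₀ (by fun_prop) fun _ hx => sub_ne_zero_of_Off hz hx

theorem Car.integrable_kernel {μ : Measure ℝ} {a b : ℝ} (h : Car μ a b) {g : ℝ → ℂ}
    (hg : ContinuousOn g (Icc a b)) {z : ℂ} (hz : z ∈ Off a b) :
    Integrable (fun x : ℝ => g x * (z - x)⁻¹) μ :=
  h.integrable (hg.mul (continuousOn_kernel hz))

theorem Car.cT_congr {μ : Measure ℝ} {a b : ℝ} (h : Car μ a b) {g g' : ℝ → ℂ}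
    (hg : EqOn g g' (Icc a b)) (z : ℂ) : cT μ g z = cT μ g' z := by
  refine integral_congr_ae ?_
  filter_upwards [h.ae] with x hx
  rw [hg hx]

theorem Car.integral_congr {E : Type*} [NormedAddCommGroup E] [NormedSpace ℝ E]
    {μ : Measure ℝ} {a b : ℝ} (h : Car μ a b) {g g' : ℝ → E}
    (hg : EqOn g g' (Icc a b)) : ∫ x, g x ∂μ = ∫ x, g' x ∂μ := by
  refine integral_congr_ae ?_
  filter_upwards [h.ae] with x hx
  rw [hg hx]

theorem Car.cT_differentiableOn {μ : Measure ℝ} {a b : ℝ} (h : Car μ a b) {g : ℝ → ℂ}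
    (hg : ContinuousOn g (Icc a b)) : DifferentiableOn ℂ (cT μ g) (Off a b) := by
  intro z0 hz0
  refine DifferentiableAt.differentiableWithinAt ?_
  obtain ⟨ε, hε, hball⟩ := Metric.isOpen_iff.1 (isOpen_Off a b) z0 hz0
  have hsub : ∀ z ∈ Metric.ball z0 (ε / 2), z ∈ Off a b := fun z hz =>
    hball (Metric.ball_subset_ball (by linarith) hz)
  have hdist : ∀ z ∈ Metric.ball z0 (ε / 2), ∀ x ∈ Icc a b, ε / 2 ≤ ‖z - (x : ℂ)‖ := by
    intro z hz x hx
    by_contra hlt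
    push Not at hlt
    have : (x : ℂ) ∈ Metric.ball z0 ε := by
      rw [Metric.mem_ball] at hz ⊢
      calc dist (x : ℂ) z0 ≤ dist (x : ℂ) z + dist z z0 := dist_triangle _ _ _
        _ < ε / 2 + ε / 2 := by
          refine add_lt_add ?_ hz
          rw [dist_comm, dist_eq_norm]; exact hlt
        _ = ε := by ring
    exact ofReal_mem_Off.1 (hball this) hx
  have hgi := h.integrable hg
  have key := hasDerivAt_integral_of_dominated_loc_of_deriv_le
    (F := fun (z : ℂ) (x : ℝ) => g x * (z - x)⁻¹)
    (F' := fun (z : ℂ) (x : ℝ) => g x * (-1 / (z - x) ^ 2)) (μ := μ)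
    (bound := fun x => ‖g x‖ * (1 / (ε / 2) ^ 2)) (x₀ := z0)
    (Metric.ball_mem_nhds z0 (half_pos hε)) ?_ ?_ ?_ ?_ ?_ ?_
  · exact key.2.differentiableAt
  · filter_upwards [Metric.ball_mem_nhds z0 (half_pos hε)] with z hz
    exact (h.integrable_kernel hg (hsub z hz)).aestronglyMeasurable
  · exact h.integrable_kernel hg hz0
  · refine (h.integrable (hg.mul ?_)).aestronglyMeasurable
    refine ContinuousOn.div continuousOn_const (by fun_prop) fun x hx => ?_
    exact pow_ne_zero _ (sub_ne_zero_of_Off hz0 hx)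
  · filter_upwards [h.ae] with x hx z hz
    rw [norm_mul, norm_div, norm_neg, norm_one, norm_pow]
    have := hdist z hz x hx
    gcongr
  · exact hgi.norm.mul_const _
  · filter_upwards [h.ae] with x hx z hz
    have h1 := sub_ne_zero_of_Off (hsub z hz) hx
    have := ((hasDerivAt_id z).sub_const (x : ℂ)).inv h1
    exact this.const_mul (g x)

theorem Car.cT_continuousOn {μ : Measure ℝ} {a b : ℝ} (h : Car μ a b) {g : ℝ → ℂ}
    (hg : ContinuousOn g (Icc a b)) : ContinuousOn (cT μ g) (Off a b) :=
  (h.cT_differentiableOn hg).continuousOn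

theorem eventually_Off (a b : ℝ) : ∀ᶠ z in cobounded ℂ, z ∈ Off a b := by
  have := eventually_cobounded_le_norm (E := ℂ) (|a| + |b| + 1)
  filter_upwards [this] with z hz
  by_contra hn
  simp only [Off, mem_ofPred_eq, not_or, not_not, not_lt] at hn
  have e := exists_real_of_im hn.1
  rw [← e, Complex.norm_real, Real.norm_eq_abs] at hz
  have := abs_le_max_abs_abs hn.2.1 hn.2.2
  have := max_le_add_of_nonneg (abs_nonneg a) (abs_nonneg b)
  linarith

theorem Car.cT_bound {μ : Measure ℝ} {a b : ℝ} (h : Car μ a b) (g : ℝ → ℂ)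
    (hg : ContinuousOn g (Icc a b)) :
    ∃ K : ℝ, ∀ᶠ z in cobounded ℂ, ‖cT μ g z‖ ≤ K * ‖z‖⁻¹ := by
  refine ⟨(∫ x, ‖g x‖ ∂μ) * 2, ?_⟩
  filter_upwards [eventually_cobounded_le_norm (E := ℂ) (2 * (|a| + |b| + 1))] with z hz
  have hz0 : 0 < ‖z‖ := by
    have := abs_nonneg a; have := abs_nonneg b; linarith
  calc ‖cT μ g z‖ ≤ ∫ x, ‖g x‖ * (2 * ‖z‖⁻¹) ∂μ := by
        refine norm_integral_le_of_norm_le ((h.integrable hg).norm.mul_const _) ?_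
        filter_upwards [h.ae] with x hx
        rw [norm_mul, norm_inv]
        have h1 : ‖z‖ / 2 ≤ ‖z - x‖ := by
          have := norm_sub_norm_le z (x : ℂ)
          rw [Complex.norm_real, Real.norm_eq_abs] at this
          have := abs_le_max_abs_abs hx.1 hx.2
          have := max_le_add_of_nonneg (abs_nonneg a) (abs_nonneg b)
          linarith
        have h2 : ‖z - x‖⁻¹ ≤ (‖z‖ / 2)⁻¹ := by gcongr
        have h3 : (‖z‖ / 2)⁻¹ = 2 * ‖z‖⁻¹ := by rw [inv_div, div_eq_mul_inv]
        rw [← h3]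
        gcongr
    _ = (∫ x, ‖g x‖ ∂μ) * 2 * ‖z‖⁻¹ := by rw [integral_mul_const]; ring

theorem Car.cT_tendsto_zero {μ : Measure ℝ} {a b : ℝ} (h : Car μ a b) {g : ℝ → ℂ}
    (hg : ContinuousOn g (Icc a b)) : Tendsto (cT μ g) (cobounded ℂ) (𝓝 0) := by
  obtain ⟨K, hK⟩ := h.cT_bound g hg
  refine squeeze_zero_norm' hK ?_
  have : Tendsto (fun z : ℂ => ‖z‖⁻¹) (cobounded ℂ) (𝓝 0) :=
    tendsto_inv_atTop_zero.comp tendsto_norm_cobounded_atTop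
  simpa using this.const_mul K

theorem Car.mul_cT {μ : Measure ℝ} {a b : ℝ} (h : Car μ a b) {g : ℝ → ℂ}
    (hg : ContinuousOn g (Icc a b)) {z : ℂ} (hz : z ∈ Off a b) :
    z * cT μ g z = cT μ (fun x => x * g x) z + ∫ x, g x ∂μ := by
  unfold cT
  rw [← integral_const_mul, ← integral_add (h.integrable_kernel (by fun_prop) hz)
    (h.integrable hg)]
  refine h.integral_congr fun x hx => ?_
  have := sub_ne_zero_of_Off hz hx
  field_simp
  ring

theorem Car.cT_tendsto_mass {μ : Measure ℝ} {a b : ℝ} (h : Car μ a b) {g : ℝ → ℂ}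
    (hg : ContinuousOn g (Icc a b)) :
    Tendsto (fun z => z * cT μ g z) (cobounded ℂ) (𝓝 (∫ x, g x ∂μ)) := by
  have h1 := (h.cT_tendsto_zero (g := fun x => x * g x) (by fun_prop)).add_const (∫ x, g x ∂μ)
  rw [zero_add] at h1
  refine h1.congr' ?_
  filter_upwards [eventually_Off a b] with z hz
  rw [h.mul_cT hg hz]

theorem Car.cT_add {μ : Measure ℝ} {a b : ℝ} (h : Car μ a b) {g f : ℝ → ℂ}
    (hg : ContinuousOn g (Icc a b)) (hf : ContinuousOn f (Icc a b)) {z : ℂ} (hz : z ∈ Off a b) :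
    cT μ (fun x => g x + f x) z = cT μ g z + cT μ f z := by
  unfold cT
  rw [← integral_add (h.integrable_kernel hg hz) (h.integrable_kernel hf hz)]
  simp only [add_mul]

theorem cT_smul (μ : Measure ℝ) (c : ℂ) (g : ℝ → ℂ) (z : ℂ) :
    cT μ (fun x => c * g x) z = c * cT μ g z := by
  unfold cT
  rw [← integral_const_mul]
  simp only [mul_assoc]

theorem Car.cT_sum {μ : Measure ℝ} {a b : ℝ} (h : Car μ a b) {ι : Type*} (s : Finset ι)
    {g : ι → ℝ → ℂ} (hg : ∀ i ∈ s, ContinuousOn (g i) (Icc a b)) {z : ℂ} (hz : z ∈ Off a b) :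
    cT μ (fun x => ∑ i ∈ s, g i x) z = ∑ i ∈ s, cT μ (g i) z := by
  unfold cT
  rw [← integral_finsetSum _ fun i hi => h.integrable_kernel (hg i hi) hz]
  simp only [Finset.sum_mul]

theorem Car.poly_mul_cT {μ : Measure ℝ} {a b : ℝ} (h : Car μ a b) {g : ℝ → ℂ}
    (hg : ContinuousOn g (Icc a b)) (p : ℂ[X]) :
    ∃ D : ℂ[X], ∀ z ∈ Off a b,
      p.eval z * cT μ g z = cT μ (fun x => p.eval (x : ℂ) * g x) z + D.eval z := by
  induction p using Polynomial.induction_on with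
  | C c => exact ⟨0, fun z hz => by simp [cT_smul]⟩
  | add p q hp hq =>
    obtain ⟨D, hD⟩ := hp
    obtain ⟨E, hE⟩ := hq
    refine ⟨D + E, fun z hz => ?_⟩
    simp only [eval_add, add_mul]
    rw [hD z hz, hE z hz, h.cT_add (by fun_prop) (by fun_prop) hz]
    ring
  | monomial n c hp =>
    obtain ⟨D, hD⟩ := hp
    refine ⟨X * D + C (∫ x, (C c * X ^ n : ℂ[X]).eval (x : ℂ) * g x ∂μ), fun z hz => ?_⟩
    have h1 := hD z hz
    have h2 := h.mul_cT (g := fun x => (C c * X ^ n : ℂ[X]).eval (x : ℂ) * g x) (by fun_prop) hz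
    have h3 : cT μ (fun x => (C c * X ^ (n + 1) : ℂ[X]).eval (x : ℂ) * g x) z =
        cT μ (fun x => x * ((C c * X ^ n : ℂ[X]).eval (x : ℂ) * g x)) z := by
      congr 1; ext x; simp; ring
    rw [h3]
    simp only [eval_mul, eval_C, eval_pow, eval_X, eval_add] at h1 h2 ⊢
    linear_combination z * h1 + h2

theorem tendsto_pow_inv {k : ℕ} (hk : k ≠ 0) :
    Tendsto (fun z : ℂ => (z⁻¹) ^ k) (cobounded ℂ) (𝓝 0) := by
  have := (tendsto_inv₀_cobounded (α := ℂ)).pow k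
  simpa [hk] using this

theorem eventually_ne_zero_cob : ∀ᶠ z in cobounded ℂ, z ≠ 0 := by
  filter_upwards [eventually_cobounded_le_norm (E := ℂ) 1] with z hz h
  simp [h] at hz; linarith

theorem poly_tendsto_coeff (p : ℂ[X]) (n : ℕ) (hp : p.natDegree ≤ n) :
    Tendsto (fun z => p.eval z * (z⁻¹) ^ n) (cobounded ℂ) (𝓝 (p.coeff n)) := by
  have h1 : Tendsto (fun z : ℂ => ∑ i ∈ Finset.range (n + 1), p.coeff i * (z⁻¹) ^ (n - i))
      (cobounded ℂ) (𝓝 (∑ i ∈ Finset.range (n + 1), if i = n then p.coeff n else 0)) := by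
    refine tendsto_finsetSum _ fun i hi => ?_
    split_ifs with h
    · subst h; simp
    · have : n - i ≠ 0 := by have := Finset.mem_range.1 hi; omega
      simpa using (tendsto_pow_inv this).const_mul (p.coeff i)
  rw [Finset.sum_ite_eq' ] at h1
  simp only [Finset.mem_range, Nat.lt_succ_self, if_true] at h1
  refine h1.congr' ?_
  filter_upwards [eventually_ne_zero_cob] with z hz
  rw [Polynomial.eval_eq_sum_range' (Nat.lt_succ_of_le hp), Finset.sum_mul]
  refine Finset.sum_congr rfl fun i hi => ?_
  have hi' : i ≤ n := Nat.lt_succ_iff.1 (Finset.mem_range.1 hi)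
  obtain ⟨k, rfl⟩ := Nat.exists_eq_add_of_le hi'
  rw [Nat.add_sub_cancel_left, pow_add, mul_assoc, ← mul_assoc (z ^ i), ← mul_pow,
    mul_inv_cancel₀ hz, one_pow, one_mul]

theorem poly_tendsto_zero {p : ℂ[X]} (h : Tendsto (fun z => p.eval z) (cobounded ℂ) (𝓝 0)) :
    p = 0 := by
  have h2 := poly_tendsto_coeff p p.natDegree le_rfl
  by_contra hp
  have hl : p.coeff p.natDegree ≠ 0 := by simpa using hp
  by_cases hd : p.natDegree = 0
  · rw [hd] at h2
    simp only [pow_zero, mul_one] at h2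
    rw [hd] at hl
    exact hl (tendsto_nhds_unique h2 h)
  · have h3 := h.mul (tendsto_pow_inv hd)
    rw [mul_zero] at h3
    exact hl (tendsto_nhds_unique h2 h3)

theorem poly_div_tendsto_zero {p q : ℂ[X]} (h : p.degree < q.degree) :
    Tendsto (fun z => p.eval z / q.eval z) (cobounded ℂ) (𝓝 0) := by
  have hq0 : q ≠ 0 := by rintro rfl; simp at h
  have hpd : p.natDegree ≤ q.natDegree := natDegree_le_natDegree h.le
  have h1 := poly_tendsto_coeff p q.natDegree hpd
  have h2 := poly_tendsto_coeff q q.natDegree le_rfl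
  have h3 : p.coeff q.natDegree = 0 := by
    apply coeff_eq_zero_of_degree_lt; rwa [← degree_eq_natDegree hq0]
  have h4 := h1.div h2 (by simpa using hq0)
  rw [h3, zero_div] at h4
  refine h4.congr' ?_
  filter_upwards [eventually_ne_zero_cob] with z hz
  rw [Pi.div_apply, mul_div_mul_right _ _ (pow_ne_zero _ (inv_ne_zero hz))]

theorem Car.moments_zero {μ : Measure ℝ} {a b : ℝ} (h : Car μ a b) (N : ℕ) : ∀ {g : ℝ → ℂ},
    ContinuousOn g (Icc a b) →
    Tendsto (fun z => z ^ N * cT μ g z) (cobounded ℂ) (𝓝 0) →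
    ∀ k < N, ∫ x, (x : ℂ) ^ k * g x ∂μ = 0 := by
  induction N with
  | zero => intro g _ _ k hk; omega
  | succ N ih =>
    intro g hg ht k hk
    have h0 : ∫ x, g x ∂μ = 0 := by
      have h1 := h.cT_tendsto_mass hg
      by_cases hN : N = 0
      · subst hN
        simp only [zero_add, pow_one] at ht
        exact tendsto_nhds_unique h1 ht
      · have h2 := ht.mul (tendsto_pow_inv hN)
        rw [zero_mul] at h2
        refine tendsto_nhds_unique h1 (h2.congr' ?_)
        filter_upwards [eventually_ne_zero_cob] with z hz
        rw [inv_pow, pow_succ]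
        field_simp
    rcases k with _ | k
    · simpa using h0
    · have := ih (g := fun x => x * g x) (by fun_prop) ?_ k (by omega)
      · rw [← this]; congr 1; ext x; ring
      · refine ht.congr' ?_
        filter_upwards [eventually_Off a b] with z hz
        have := h.mul_cT hg hz
        rw [h0, add_zero] at this
        rw [← this]; ring

theorem Car.poly_part_zero {μ : Measure ℝ} {a b : ℝ} (h : Car μ a b) (N : ℕ) {g : ℝ → ℂ}
    (hg : ContinuousOn g (Icc a b)) (E : ℂ[X])
    (ht : Tendsto (fun z => z ^ N * (cT μ g z + E.eval z)) (cobounded ℂ) (𝓝 0)) :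
    E = 0 ∧ ∀ p : ℂ[X], p.degree < N → ∫ x, p.eval (x : ℂ) * g x ∂μ = 0 := by
  have hE : E = 0 := by
    apply poly_tendsto_zero
    have h1 : Tendsto (fun z => cT μ g z + E.eval z) (cobounded ℂ) (𝓝 0) := by
      by_cases hN : N = 0
      · subst hN; simpa using ht
      · have h2 := ht.mul (tendsto_pow_inv hN)
        rw [zero_mul] at h2
        refine h2.congr' ?_
        filter_upwards [eventually_ne_zero_cob] with z hz
        rw [inv_pow]
        field_simp
    have h2 := h1.sub (h.cT_tendsto_zero hg)
    simpa using h2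
  refine ⟨hE, fun p hp => ?_⟩
  subst hE
  have hm := h.moments_zero N hg (by simpa using ht)
  by_cases hp0 : p = 0
  · simp [hp0]
  have hd : p.natDegree < N := (natDegree_lt_iff_degree_lt hp0).2 hp
  simp only [Polynomial.eval_eq_sum_range' hd, Finset.sum_mul]
  rw [integral_finsetSum]
  · refine Finset.sum_eq_zero fun i hi => ?_
    simp only [mul_assoc]
    rw [integral_const_mul, hm i (Finset.mem_range.1 hi), mul_zero]
  · intro i _
    exact h.integrable (by fun_prop)

theorem cT_conj (μ : Measure ℝ) (g : ℝ → ℂ) (hg : ∀ᵐ x ∂μ, (g x).im = 0) (z : ℂ) :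
    cT μ g ((starRingEnd ℂ) z) = (starRingEnd ℂ) (cT μ g z) := by
  unfold cT
  rw [← integral_conj]
  refine integral_congr_ae ?_
  filter_upwards [hg] with x hx
  simp [Complex.conj_eq_iff_im.2 hx]

theorem exists_poly_quotient {U : Set ℂ} (hU : IsOpen U) (n : ℕ) : ∀ (W E : ℂ[X]) (H : ℂ → ℂ),
    W.natDegree = n → W ≠ 0 → (∀ z, W.eval z = 0 → z ∈ U) → ContinuousOn H U →
    (∀ z ∈ U, E.eval z = W.eval z * H z) →
    ∃ h : ℂ[X], ∀ z ∈ U, W.eval z ≠ 0 → H z = h.eval z := by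
  induction n with
  | zero =>
    intro W E H hn hW _ _ hE
    refine ⟨C (W.coeff 0)⁻¹ * E, fun z hz hw => ?_⟩
    rw [eval_mul, hE z hz, eval_C]
    rw [eq_C_of_natDegree_eq_zero hn] at hw ⊢
    simp only [eval_C, coeff_C_zero] at hw ⊢
    field_simp
  | succ n ih =>
    intro W E H hn hW hroots hH hE
    obtain ⟨r, hr⟩ := IsAlgClosed.exists_root W (by
      intro h0
      have : W.natDegree = 0 := natDegree_eq_of_degree_eq_some h0
      omega)
    obtain ⟨W1, rfl⟩ := dvd_iff_isRoot.2 hr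
    have hrU := hroots r hr
    have hEr : E.IsRoot r := by
      rw [IsRoot.def, hE r hrU]; simp
    obtain ⟨E1, rfl⟩ := dvd_iff_isRoot.2 hEr
    have hW1 : W1 ≠ 0 := right_ne_zero_of_mul hW
    have hn1 : W1.natDegree = n := by
      rw [natDegree_mul (X_sub_C_ne_zero r) hW1, natDegree_X_sub_C] at hn
      omega
    have hpt : ∀ z ∈ U, z ≠ r → E1.eval z = W1.eval z * H z := by
      intro z hz hzr
      have := hE z hz
      simp only [eval_mul, eval_sub, eval_X, eval_C] at this
      have h0 : z - r ≠ 0 := sub_ne_zero.2 hzr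
      apply mul_left_cancel₀ h0
      rw [this]; ring
    have hr1 : E1.eval r = W1.eval r * H r := by
      have hHr : ContinuousAt H r := hH.continuousAt (hU.mem_nhds hrU)
      have t1 : Tendsto (fun z => E1.eval z) (𝓝[≠] r) (𝓝 (E1.eval r)) :=
        (E1.continuous.tendsto r).mono_left nhdsWithin_le_nhds
      have t2 : Tendsto (fun z => W1.eval z * H z) (𝓝[≠] r) (𝓝 (W1.eval r * H r)) :=
        ((W1.continuous.tendsto r).mul hHr.tendsto).mono_left nhdsWithin_le_nhds
      refine tendsto_nhds_unique (t1.congr' ?_) t2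
      filter_upwards [self_mem_nhdsWithin, mem_nhdsWithin_of_mem_nhds (hU.mem_nhds hrU)]
        with z hz hz'
      exact hpt z hz' hz
    obtain ⟨h, hh⟩ := ih W1 E1 H hn1 hW1 (fun z hz => hroots z (by simp [hz])) hH
      (fun z hz => by
        by_cases hzr : z = r
        · subst hzr; exact hr1
        · exact hpt z hz hzr)
    exact ⟨h, fun z hz hw => hh z hz (by
      intro h0; apply hw; simp [h0])⟩

theorem exists_factor {U : Set ℂ} (hU : IsOpen U) (S : Finset ℂ) : ∀ {Q : ℂ → ℂ},
    DifferentiableOn ℂ Q U → (∀ x ∈ S, x ∈ U ∧ Q x = 0) →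
    ∃ G : ℂ → ℂ, DifferentiableOn ℂ G U ∧ ∀ z, Q z = (∏ x ∈ S, (z - x)) * G z := by
  classical
  induction S using Finset.induction_on with
  | empty => intro Q hQ _; exact ⟨Q, hQ, by simp⟩
  | insert x S hx ih =>
    intro Q hQ hz
    obtain ⟨G, hG, hGe⟩ := ih hQ fun y hy => hz y (Finset.mem_insert_of_mem hy)
    obtain ⟨hxU, hx0⟩ := hz x (Finset.mem_insert_self _ _)
    have hGx : G x = 0 := by
      rw [hGe] at hx0
      refine (mul_eq_zero.1 hx0).resolve_left (Finset.prod_ne_zero_iff.2 ?_)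
      intro y hy h0
      rw [sub_eq_zero] at h0
      subst h0
      exact hx hy
    refine ⟨dslope G x, (Complex.differentiableOn_dslope (hU.mem_nhds hxU)).2 hG, fun z => ?_⟩
    rw [Finset.prod_insert hx, hGe z]
    have := sub_smul_dslope G x z
    rw [hGx, sub_zero, smul_eq_mul] at this
    rw [← this]; ring

theorem exists_factor_double {U : Set ℂ} (hU : IsOpen U) (S : Finset ℂ) {Q : ℂ → ℂ}
    (hQ : DifferentiableOn ℂ Q U) (hS : ∀ x ∈ S, x ∈ U ∧ Q x = 0) {y : ℂ} (hy : y ∈ S)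
    (hd : deriv Q y = 0) :
    ∃ G : ℂ → ℂ, DifferentiableOn ℂ G U ∧ ∀ z, Q z = (z - y) * (∏ x ∈ S, (z - x)) * G z := by
  have hfac : ∀ z, (z - y) * dslope Q y z = Q z := by
    intro z
    have := sub_smul_dslope Q y z
    rwa [(hS y hy).2, sub_zero, smul_eq_mul] at this
  obtain ⟨G, hG, hGe⟩ := exists_factor hU S
    ((Complex.differentiableOn_dslope (hU.mem_nhds (hS y hy).1)).2 hQ) (fun x hx => by
      refine ⟨(hS x hx).1, ?_⟩
      by_cases hxy : x = y
      · subst hxy; rw [dslope_same, hd]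
      · have := hfac x
        rw [(hS x hx).2] at this
        exact (mul_eq_zero.1 this).resolve_left (sub_ne_zero.2 hxy))
  refine ⟨G, hG, fun z => ?_⟩
  rw [← hfac z, hGe z]; ring

theorem exists_sign {a b : ℝ} (hab : a < b) {q : ℝ → ℝ} (hq : ContinuousOn q (Icc a b))
    (h0 : ∀ x ∈ Ioo a b, q x ≠ 0) :
    ∃ ε : ℝ, (ε = 1 ∨ ε = -1) ∧ ∀ x ∈ Icc a b, 0 ≤ ε * q x := by
  have hm : (a + b) / 2 ∈ Ioo a b := ⟨by linarith, by linarith⟩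
  have hqo := hq.mono Ioo_subset_Icc_self
  have hcl : closure (Ioo a b) = Icc a b := closure_Ioo hab.ne
  have key : ∀ ε : ℝ, 0 < ε * q ((a + b) / 2) → ∀ x ∈ Icc a b, 0 ≤ ε * q x := by
    intro ε hε x hx
    have h1 : ∀ x ∈ Ioo a b, 0 ≤ ε * q x := by
      intro x hx
      by_contra hneg
      push Not at hneg
      obtain ⟨y, hy, hy0⟩ := isPreconnected_Ioo.intermediate_value hx hm
        (continuousOn_const.mul hqo : ContinuousOn (fun x => ε * q x) (Ioo a b))
        ⟨hneg.le, hε.le⟩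
      rcases mul_eq_zero.1 hy0 with h | h
      · change ε = 0 at h
        rw [h, zero_mul] at hε; exact lt_irrefl _ hε
      · exact h0 y hy h
    rw [← hcl] at hx
    exact le_on_closure (f := fun _ => (0 : ℝ)) h1 continuousOn_const
      (by rw [hcl]; exact continuousOn_const.mul hq) hx
  rcases lt_or_gt_of_ne (h0 _ hm) with h | h
  · exact ⟨-1, Or.inr rfl, key _ (by linarith)⟩
  · exact ⟨1, Or.inl rfl, key _ (by linarith)⟩

theorem exists_sign_prod {a : ℝ} (Z : Finset ℝ) : ∀ {b : ℝ} (_ : a < b) {q : ℝ → ℝ}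
    (_ : ContinuousOn q (Icc a b)) (_ : ∀ x ∈ Ioo a b, q x = 0 → x ∈ Z),
    ∃ S ⊆ Z, (S : Set ℝ) ⊆ Ioo a b ∧ ∃ ε : ℝ, (ε = 1 ∨ ε = -1) ∧
      ∀ x ∈ Icc a b, 0 ≤ ε * ((∏ s ∈ S, (x - s)) * q x) := by
  classical
  induction Z using Finset.induction_on_max with
  | empty =>
    intro b hab q hq h0
    obtain ⟨ε, hε, h⟩ := exists_sign hab hq fun x hx hx0 => by simpa using h0 x hx hx0
    exact ⟨∅, by simp, by simp, ε, hε, by simpa using h⟩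
  | insert z Z hz ih =>
    intro b hab q hq h0
    by_cases hzI : z ∈ Ioo a b
    · have hsub1 : Icc a z ⊆ Icc a b := Icc_subset_Icc_right hzI.2.le
      have hsub2 : Icc z b ⊆ Icc a b := Icc_subset_Icc_left hzI.1.le
      obtain ⟨S, hSZ, hSI, ε, hε, h⟩ := ih hzI.1 (hq.mono hsub1) fun x hx hx0 => by
        have := h0 x ⟨hx.1, hx.2.trans hzI.2⟩ hx0
        rcases Finset.mem_insert.1 this with rfl | h
        · exact absurd hx.2 (lt_irrefl _)
        · exact h
      obtain ⟨δ, hδ, h'⟩ := exists_sign hzI.2 (hq.mono hsub2) fun x hx hx0 => by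
        have := h0 x ⟨hzI.1.trans hx.1, hx.2⟩ hx0
        rcases Finset.mem_insert.1 this with rfl | h
        · exact absurd hx.1 (lt_irrefl _)
        · exact absurd hx.1 (hz x h).le.not_gt
      have hprod : ∀ x ∈ Icc z b, 0 ≤ ∏ s ∈ S, (x - s) := by
        intro x hx
        refine Finset.prod_nonneg fun s hs => ?_
        have := (hSI hs).2; linarith [hx.1]
      have hzS : z ∉ S := fun hzS => lt_irrefl _ (hz z (hSZ hzS))
      have hSI' : (S : Set ℝ) ⊆ Ioo a b := hSI.trans (Ioo_subset_Ioo_right hzI.2.le)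
      by_cases hεδ : δ = ε
      · subst hεδ
        refine ⟨S, hSZ.trans (Finset.subset_insert _ _), hSI', δ, hδ, fun x hx => ?_⟩
        rcases le_total x z with hxz | hxz
        · exact h x ⟨hx.1, hxz⟩
        · have := mul_nonneg (hprod x ⟨hxz, hx.2⟩) (h' x ⟨hxz, hx.2⟩)
          linarith
      · have hδε : δ = -ε := by
          rcases hδ with rfl | rfl <;> rcases hε with rfl | rfl <;> simp_all
        refine ⟨insert z S, Finset.insert_subset_insert _ hSZ, ?_, δ, hδ, fun x hx => ?_⟩
        · rw [Finset.coe_insert]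
          exact insert_subset hzI hSI'
        rw [Finset.prod_insert hzS]
        rcases le_total x z with hxz | hxz
        · have := mul_nonneg (sub_nonneg.2 hxz) (h x ⟨hx.1, hxz⟩)
          rw [hδε]; linarith
        · have := mul_nonneg (mul_nonneg (sub_nonneg.2 hxz) (hprod x ⟨hxz, hx.2⟩))
            (h' x ⟨hxz, hx.2⟩)
          linarith
    · obtain ⟨S, hSZ, hr⟩ := ih hab hq fun x hx hx0 => by
        rcases Finset.mem_insert.1 (h0 x hx hx0) with rfl | h
        · exact absurd hx hzI
        · exact h
      exact ⟨S, hSZ.trans (Finset.subset_insert _ _), hr⟩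

theorem exists_zeros {μ : Measure ℝ} {a b : ℝ} (h : Gen μ a b) {q : ℝ → ℝ}
    (hq : ContinuousOn q (Icc a b)) (N : ℕ)
    (hint : ∀ S : Finset ℝ, (S : Set ℝ) ⊆ Ioo a b → S.card < N →
      ∃ w : ℝ → ℝ, ContinuousOn w (Icc a b) ∧ (∀ x ∈ Icc a b, w x ≠ 0) ∧
        ∫ x, (∏ s ∈ S, (x - s)) * w x * q x ∂μ = 0) :
    ∃ Z : Finset ℝ, (Z : Set ℝ) ⊆ Ioo a b ∧ Z.card = N ∧ ∀ x ∈ Z, q x = 0 := by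
  classical
  set V : Set ℝ := {x | x ∈ Ioo a b ∧ q x = 0} with hV
  by_cases hinf : V.Infinite
  · obtain ⟨Z, hZ, hc⟩ := hinf.exists_subset_card_eq N
    exact ⟨Z, fun x hx => (hZ hx).1, hc, fun x hx => (hZ hx).2⟩
  rw [not_infinite] at hinf
  by_cases hcard : N ≤ hinf.toFinset.card
  · obtain ⟨Z, hZ, hc⟩ := Finset.exists_subset_card_eq hcard
    have hm : ∀ x ∈ Z, x ∈ V := fun x hx => hinf.mem_toFinset.1 (hZ hx)
    exact ⟨Z, fun x hx => (hm x hx).1, hc, fun x hx => (hm x hx).2⟩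
  push Not at hcard
  exfalso
  obtain ⟨S, hSZ, hSI, ε, hε, hs⟩ := exists_sign_prod hinf.toFinset h.lt hq
    fun x hx hx0 => hinf.mem_toFinset.2 ⟨hx, hx0⟩
  obtain ⟨w, hw, hw0, hwi⟩ := hint S hSI ((Finset.card_le_card hSZ).trans_lt hcard)
  obtain ⟨δ, hδ, hws⟩ := exists_sign h.lt hw fun x hx => hw0 x (Ioo_subset_Icc_self hx)
  have hεδ : ε * δ ≠ 0 := by
    rcases hδ with rfl | rfl <;> rcases hε with rfl | rfl <;> simp
  have hcont : ContinuousOn (fun x => (ε * δ) * ((∏ s ∈ S, (x - s)) * w x * q x)) (Icc a b) := by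
    fun_prop
  have hnn : 0 ≤ᵐ[μ] fun x => (ε * δ) * ((∏ s ∈ S, (x - s)) * w x * q x) := by
    filter_upwards [h.ae] with x hx
    have := mul_nonneg (hs x hx) (hws x hx)
    rw [Pi.zero_apply]; linarith
  have hz := (integral_eq_zero_iff_of_nonneg_ae hnn (h.integrable hcont)).1 (by
    rw [integral_const_mul, hwi, mul_zero])
  apply h.inf (S ∪ hinf.toFinset ∪ {a, b})
  refine measure_mono_null ?_ (measure_union_null (ae_iff.1 hz) h.null)
  intro x hx
  by_cases hxI : x ∈ Icc a b
  · left
    simp only [Finset.coe_union, mem_compl_iff, mem_union, Finset.mem_coe, not_or,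
      Finset.coe_insert, Finset.coe_singleton, mem_insert_iff, mem_singleton_iff,
      Set.Finite.mem_toFinset] at hx
    obtain ⟨⟨hxS, hxV⟩, hxa, hxb⟩ := hx
    have hxo : x ∈ Ioo a b := ⟨lt_of_le_of_ne hxI.1 (Ne.symm hxa), lt_of_le_of_ne hxI.2 hxb⟩
    have hq0 : q x ≠ 0 := fun h0 => hxV ⟨hxo, h0⟩
    have hp : ∏ s ∈ S, (x - s) ≠ 0 := by
      rw [Finset.prod_ne_zero_iff]
      intro s hs' h0
      rw [sub_eq_zero] at h0
      exact hxS (h0 ▸ hs')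
    simp only [mem_ofPred_eq, Pi.zero_apply]
    exact mul_ne_zero hεδ (mul_ne_zero (mul_ne_zero hp (hw0 x hxI)) hq0)
  · right; exact hxI

/-- The measure `g • μ` for a nonnegative density `g`. -/
def dens (μ : Measure ℝ) (g : ℝ → ℝ) : Measure ℝ :=
  μ.withDensity fun x => ENNReal.ofReal (g x)

theorem Gen.integral_dens {E : Type*} [NormedAddCommGroup E] [NormedSpace ℝ E]
    {μ : Measure ℝ} {a b : ℝ} (h : Gen μ a b) {g : ℝ → ℝ}
    (hg : ContinuousOn g (Icc a b)) (h0 : ∀ x ∈ Icc a b, 0 ≤ g x) (f : ℝ → E) :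
    ∫ x, f x ∂(dens μ g) = ∫ x, g x • f x ∂μ := by
  have hm : AEMeasurable (fun x => (g x).toNNReal) μ :=
    (h.integrable hg).aestronglyMeasurable.aemeasurable.real_toNNReal
  have := integral_withDensity_eq_integral_smul₀ hm f
  change ∫ x, f x ∂(μ.withDensity fun x => ((g x).toNNReal : ENNReal)) = _
  rw [this]
  refine h.integral_congr fun x hx => ?_
  change ((g x).toNNReal : ℝ) • f x = _
  rw [Real.coe_toNNReal _ (h0 x hx)]

theorem Gen.dens {μ : Measure ℝ} {a b : ℝ} (h : Gen μ a b) {g : ℝ → ℝ}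
    (hg : ContinuousOn g (Icc a b)) (h0 : ∀ x ∈ Icc a b, 0 ≤ g x)
    {F : Finset ℝ} (hF : ∀ x ∈ Icc a b, x ∉ F → g x ≠ 0) : Gen (dens μ g) a b where
  fin := by
    have := (h.integrable hg).hasFiniteIntegral
    refine ⟨?_⟩
    rw [NikAux.dens, withDensity_apply _ MeasurableSet.univ, Measure.restrict_univ]
    refine lt_of_le_of_lt (lintegral_mono fun x => ?_) this
    rw [← ofReal_norm]
    exact ENNReal.ofReal_le_ofReal (le_abs_self _)
  null := withDensity_absolutelyContinuous _ _ h.null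
  inf G hG := by
    classical
    have hm : AEMeasurable (fun x => ENNReal.ofReal (g x)) μ :=
      (h.integrable hg).aestronglyMeasurable.aemeasurable.ennreal_ofReal
    rw [NikAux.dens, withDensity_apply_eq_zero' hm] at hG
    apply h.inf (F ∪ G)
    refine measure_mono_null ?_ (measure_union_null hG h.null)
    intro x hx
    by_cases hxI : x ∈ Icc a b
    · left
      simp only [Finset.coe_union, mem_compl_iff, mem_union, Finset.mem_coe, not_or] at hx
      refine ⟨?_, hx.2⟩
      have := lt_of_le_of_ne (h0 x hxI) (Ne.symm (hF x hxI hx.1))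
      simpa using this
    · right; exact hxI

theorem Gen.cT_dens {μ : Measure ℝ} {a b : ℝ} (h : Gen μ a b) {g : ℝ → ℝ}
    (hg : ContinuousOn g (Icc a b)) (h0 : ∀ x ∈ Icc a b, 0 ≤ g x) (f : ℝ → ℂ) (z : ℂ) :
    cT (NikAux.dens μ g) f z = cT μ (fun x => g x * f x) z := by
  unfold cT
  rw [h.integral_dens hg h0]
  simp only [Complex.real_smul, mul_assoc]

theorem Gen.integral_pos {μ : Measure ℝ} {a b : ℝ} (h : Gen μ a b) {f : ℝ → ℝ}
    (hf : ContinuousOn f (Icc a b)) (h0 : ∀ x ∈ Icc a b, 0 < f x) : 0 < ∫ x, f x ∂μ := by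
  rw [integral_pos_iff_support_of_nonneg_ae _ (h.integrable hf)]
  · refine pos_iff_ne_zero.2 fun hz => h.inf ∅ ?_
    refine measure_mono_null ?_ (measure_union_null hz h.null)
    intro x _
    by_cases hx : x ∈ Icc a b
    · left; exact (h0 x hx).ne'
    · right; exact hx
  · filter_upwards [h.ae] with x hx
    exact (h0 x hx).le

theorem exists_re_pos {a b : ℝ} {z : ℂ} (hz : z ∈ Off a b) :
    ∃ w : ℂ, ∀ x ∈ Icc a b, 0 < (w * (z - x)⁻¹).re := by
  by_cases him : z.im = 0
  · have hz' := hz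
    rw [← exists_real_of_im him] at hz' ⊢
    rcases hz.resolve_left (fun h => h him) with h | h
    · refine ⟨-1, fun x hx => ?_⟩
      rw [← Complex.ofReal_sub, ← Complex.ofReal_inv]
      simp only [neg_mul, one_mul, Complex.neg_re, Complex.ofReal_re]
      have : (z.re - x)⁻¹ < 0 := inv_lt_zero.2 (by linarith [hx.1])
      linarith
    · refine ⟨1, fun x hx => ?_⟩
      rw [← Complex.ofReal_sub, ← Complex.ofReal_inv]
      simp only [one_mul, Complex.ofReal_re]
      exact inv_pos.2 (by linarith [hx.2])
  · refine ⟨Complex.I * z.im, fun x _ => ?_⟩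
    have hne : z - x ≠ 0 := by
      intro h
      apply him
      have := congrArg Complex.im h
      simpa using this
    have hp := Complex.normSq_pos.2 hne
    rw [Complex.inv_def]
    have : (Complex.I * ↑z.im * ((starRingEnd ℂ) (z - ↑x) * ↑(Complex.normSq (z - ↑x))⁻¹)).re
        = z.im ^ 2 * (Complex.normSq (z - x))⁻¹ := by
      simp [Complex.mul_re, Complex.mul_im]; ring
    rw [this]
    positivity

theorem Gen.cT_one_ne_zero {μ : Measure ℝ} {a b : ℝ} (h : Gen μ a b) {z : ℂ}
    (hz : z ∈ Off a b) : cT μ (fun _ => 1) z ≠ 0 := by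
  obtain ⟨w, hw⟩ := exists_re_pos hz
  have hc : ContinuousOn (fun x : ℝ => w * (z - x)⁻¹) (Icc a b) :=
    continuousOn_const.mul (continuousOn_kernel hz)
  have hp := h.integral_pos (f := fun x => (w * (z - x)⁻¹).re)
    (Complex.continuous_re.comp_continuousOn hc) hw
  intro h0
  have : ∫ x, w * (z - x)⁻¹ ∂μ = 0 := by
    rw [integral_const_mul]
    unfold cT at h0
    simp only [one_mul] at h0
    rw [h0, mul_zero]
  have h2 := integral_re (h.integrable hc)
  simp only [RCLike.re_to_complex] at h2
  rw [h2, this] at hp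
  simp at hp

/-- The sign of a real-valued nonvanishing continuous function on `[a, b]`. -/
theorem exists_sign_of_ne {a b : ℝ} (hab : a ≤ b) {f : ℝ → ℝ} (hf : ContinuousOn f (Icc a b))
    (h0 : ∀ x ∈ Icc a b, f x ≠ 0) :
    ∃ ε : ℝ, (ε = 1 ∨ ε = -1) ∧ ∀ x ∈ Icc a b, 0 < ε * f x := by
  rcases hab.eq_or_lt with rfl | hlt
  · rcases lt_or_gt_of_ne (h0 a (by simp)) with h | h
    · refine ⟨-1, Or.inr rfl, fun x hx => ?_⟩
      obtain rfl : x = a := by simpa using hx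
      linarith
    · refine ⟨1, Or.inl rfl, fun x hx => ?_⟩
      obtain rfl : x = a := by simpa using hx
      linarith
  · obtain ⟨ε, hε, h⟩ := exists_sign hlt hf fun x hx => h0 x (Ioo_subset_Icc_self hx)
    refine ⟨ε, hε, fun x hx => lt_of_le_of_ne (h x hx) (Ne.symm ?_)⟩
    rcases hε with rfl | rfl <;> simpa using h0 x hx

theorem bijective_rankOne_perturbation {H : Type*} [NormedAddCommGroup H] [InnerProductSpace ℂ H]
    (B R : H →L[ℂ] H) (hBR : ∀ f, B (R f) = f) (hRB : ∀ f, R (B f) = f) (v : H) (κ : ℂ)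
    (hne : 1 + κ * inner ℂ v (R v) ≠ 0) :
    Function.Bijective (fun f => B f + κ • (inner ℂ v f) • v) := by
  constructor
  · have hlin : ∀ f, B f + κ • (inner ℂ v f) • v = 0 → f = 0 := by
      intro f hf
      have h1 := congrArg R hf
      rw [map_add, hRB, map_smul, map_smul, map_zero] at h1
      have h2 := congrArg (inner ℂ v) h1
      rw [inner_add_right, inner_smul_right, inner_smul_right, inner_zero_right] at h2
      have h3 : inner ℂ v f = 0 := by
        have : inner ℂ v f * (1 + κ * inner ℂ v (R v)) = 0 := by linear_combination h2
        exact (mul_eq_zero.1 this).resolve_right hne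
      rw [h3] at h1
      simpa using h1
    intro f g hfg
    rw [← sub_eq_zero]
    apply hlin
    simp only at hfg
    rw [map_sub, inner_sub_right, sub_smul, smul_sub, ← sub_eq_zero.2 hfg]
    abel
  · intro h
    set s : ℂ := κ * inner ℂ v (R h) / (1 + κ * inner ℂ v (R v)) with hs
    refine ⟨R (h - s • v), ?_⟩
    simp only
    rw [hBR, map_sub, map_smul, inner_sub_right, inner_smul_right, smul_smul]
    have : κ * (inner ℂ v (R h) - s * inner ℂ v (R v)) = s := by
      rw [hs]; field_simp; ring
    rw [this]; abel

theorem Gen.memLp {μ : Measure ℝ} {a b : ℝ} (h : Gen μ a b) {p : ENNReal} {f : ℝ → ℂ}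
    (hf : ContinuousOn f (Icc a b)) : MemLp f p μ := by
  have := h.fin
  obtain ⟨K, hK⟩ := isCompact_Icc.exists_bound_of_continuousOn hf
  refine MemLp.of_bound (h.integrable hf).aestronglyMeasurable K ?_
  filter_upwards [h.ae] with x hx using hK x hx

theorem Gen.exists_mult {μ : Measure ℝ} {a b : ℝ} (h : Gen μ a b) {f : ℝ → ℂ}
    (hf : ContinuousOn f (Icc a b)) :
    ∃ M : Lp ℂ 2 μ →L[ℂ] Lp ℂ 2 μ, ∀ g : Lp ℂ 2 μ, M g =ᵐ[μ] fun x => f x * g x := by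
  have hm : MemLp f ⊤ μ := h.memLp hf
  refine ⟨(ContinuousLinearMap.mul ℂ ℂ).holderL μ ⊤ 2 2 (hm.toLp f), fun g => ?_⟩
  have h1 := (ContinuousLinearMap.mul ℂ ℂ).coeFn_holder (r := 2) (hm.toLp f) g
  have h2 := hm.coeFn_toLp
  change ((ContinuousLinearMap.mul ℂ ℂ).holder 2 (hm.toLp f) g : ℝ → ℂ) =ᵐ[μ] _
  filter_upwards [h1, h2] with x hx1 hx2
  rw [hx1, hx2]
  rfl

theorem Gen.exists_model {μ : Measure ℝ} {a b : ℝ} (h : Gen μ a b) {c : ℝ} (hc : c ≠ 0)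
    (hφ : ∀ x : ℝ, x ∉ Icc a b → (c : ℂ) + cT μ (fun _ => 1) x ≠ 0) :
    ∃ (T : Lp ℂ 2 μ →L[ℂ] Lp ℂ 2 μ) (v : Lp ℂ 2 μ), IsSelfAdjoint T ∧
      spectrum ℝ T ⊆ Icc a b ∧
      ∀ (x : ℝ) (w : Lp ℂ 2 μ), x ∉ Icc a b → x • w - T w = v →
        inner ℂ v w = c * cT μ (fun _ => 1) x / (c + cT μ (fun _ => 1) x) := by
  have := h.fin
  obtain ⟨M, hM⟩ := h.exists_mult (f := fun x => (x : ℂ)) (by fun_prop)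
  have hv : MemLp (fun _ : ℝ => (1 : ℂ)) 2 μ := h.memLp continuousOn_const
  set v : Lp ℂ 2 μ := hv.toLp _ with hvdef
  have hvae : (v : ℝ → ℂ) =ᵐ[μ] fun _ => 1 := hv.coeFn_toLp
  set κ : ℂ := (c : ℂ)⁻¹ with hκ
  have hcc : (c : ℂ) ≠ 0 := by exact_mod_cast hc
  set T : Lp ℂ 2 μ →L[ℂ] Lp ℂ 2 μ := M - κ • InnerProductSpace.rankOne ℂ v v with hT
  have hTapp : ∀ f, T f = M f - κ • (inner ℂ v f) • v := by
    intro f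
    simp [hT, InnerProductSpace.rankOne_apply]
  have hres : ∀ x : ℝ, x ∉ Icc a b → ∃ R : Lp ℂ 2 μ →L[ℂ] Lp ℂ 2 μ,
      (∀ f, x • R f - M (R f) = f) ∧ (∀ f, R (x • f - M f) = f) ∧
        inner ℂ v (R v) = cT μ (fun _ => 1) x := by
    intro x hx
    have hz := (ofReal_mem_Off (a := a) (b := b)).2 hx
    obtain ⟨R, hR⟩ := h.exists_mult (f := fun t => ((x : ℂ) - t)⁻¹) (continuousOn_kernel hz)
    refine ⟨R, fun f => ?_, fun f => ?_, ?_⟩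
    · apply Lp.ext
      filter_upwards [Lp.coeFn_sub (x • R f) (M (R f)), Lp.coeFn_smul x (R f), hM (R f), hR f,
        h.ae] with t h1 h2 h3 h4 h5
      rw [h1, Pi.sub_apply, h2, Pi.smul_apply, h3, h4]
      have := sub_ne_zero_of_Off hz h5
      simp only [Complex.real_smul]
      field_simp
    · apply Lp.ext
      filter_upwards [hR (x • f - M f), Lp.coeFn_sub (x • f) (M f), Lp.coeFn_smul x f, hM f,
        h.ae] with t h1 h2 h3 h4 h5
      rw [h1, h2, Pi.sub_apply, h3, Pi.smul_apply, h4]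
      have := sub_ne_zero_of_Off hz h5
      simp only [Complex.real_smul]
      field_simp
    · rw [L2.inner_def]
      unfold cT
      refine integral_congr_ae ?_
      filter_upwards [hR v, hvae] with t h1 h2
      rw [h1, h2]
      simp
  refine ⟨T, v, ?_, ?_, ?_⟩
  · rw [hT]
    refine IsSelfAdjoint.sub ?_ ?_
    · rw [ContinuousLinearMap.isSelfAdjoint_iff_isSymmetric]
      intro f g
      simp only [ContinuousLinearMap.coe_coe]
      rw [L2.inner_def, L2.inner_def]
      refine integral_congr_ae ?_
      filter_upwards [hM f, hM g] with t h1 h2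
      rw [h1, h2]
      simp
      ring
    · refine IsSelfAdjoint.smul ?_ ?_
      · rw [hκ, IsSelfAdjoint]; simp
      · rw [ContinuousLinearMap.isSelfAdjoint_iff_isSymmetric]
        exact InnerProductSpace.isSymmetric_rankOne_self v
  · intro x hx
    by_contra hxI
    apply hx
    obtain ⟨R, h1, h2, h3⟩ := hres x hxI
    rw [spectrum.mem_resolventSet_iff, ContinuousLinearMap.isUnit_iff_bijective]
    have key := bijective_rankOne_perturbation (x • (1 : Lp ℂ 2 μ →L[ℂ] Lp ℂ 2 μ) - M) R
      (fun f => by simpa using h1 f) (fun f => by simpa using h2 f) v κ (by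
        rw [h3, hκ]
        have := hφ x hxI
        intro h0
        apply this
        field_simp at h0
        linear_combination h0)
    convert key using 2 with f
    rw [Algebra.algebraMap_eq_smul_one]
    simp [hTapp]
    abel
  · intro x w hxI hw
    obtain ⟨R, h1, h2, h3⟩ := hres x hxI
    rw [hTapp] at hw
    have h4 : x • w - M w = v - κ • (inner ℂ v w) • v := by
      rw [eq_sub_iff_add_eq]
      refine Eq.trans ?_ hw
      abel
    have h5 := congrArg R h4
    rw [h2, map_sub, map_smul, map_smul] at h5
    have h6 := congrArg (inner ℂ v) h5
    rw [inner_sub_right, inner_smul_right, inner_smul_right, h3] at h6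
    have := hφ x hxI
    rw [eq_div_iff this]
    rw [hκ] at h6
    field_simp at h6
    linear_combination h6

open CompactlySupported in
theorem exists_spectral_measure {H : Type*} [NormedAddCommGroup H] [InnerProductSpace ℂ H]
    [CompleteSpace H] {a b : ℝ} (hab : a ≤ b) (T : H →L[ℂ] H)
    (hsp : spectrum ℝ T ⊆ Icc a b) (v : H) :
    ∃ τ : Measure ℝ, IsFiniteMeasure τ ∧ τ (Icc a b)ᶜ = 0 ∧
      ∀ f : ℝ → ℝ, ContinuousOn f (Icc a b) →
        ∫ x, f x ∂τ = (inner ℂ v (cfc f T v)).re := by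
  have hcont : ∀ g : C_c(Icc a b, ℝ), ContinuousOn (IccExtend hab g) (spectrum ℝ T) :=
    fun g => (g.continuous.Icc_extend' ).continuousOn
  let Λl : C_c(Icc a b, ℝ) →ₗ[ℝ] ℝ :=
    { toFun := fun g => (inner ℂ v (cfc (IccExtend hab g) T v)).re
      map_add' := fun g g' => by
        have : IccExtend hab (g + g' : C_c(Icc a b, ℝ)) =
            fun x => IccExtend hab g x + IccExtend hab g' x := rfl
        rw [this, cfc_add _ _ _ (hcont g) (hcont g')]
        simp
      map_smul' := fun r g => by
        have : IccExtend hab (r • g : C_c(Icc a b, ℝ)) =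
            fun x => r * IccExtend hab g x := rfl
        rw [this, cfc_const_mul _ _ _ (hcont g)]
        simp [inner_smul_right_eq_smul] }
  let Λ : C_c(Icc a b, ℝ) →ₚ[ℝ] ℝ := PositiveLinearMap.mk₀ Λl (by
    intro g hg
    have h1 : 0 ≤ cfc (IccExtend hab g) T := cfc_nonneg fun x hx => by
      exact hg _
    rw [ContinuousLinearMap.nonneg_iff_isPositive] at h1
    exact h1.re_inner_nonneg_right v)
  let τ0 : Measure (Icc a b) := RealRMK.rieszMeasure Λ
  have hτ0 : ∀ g : C_c(Icc a b, ℝ), ∫ x, g x ∂τ0 = Λ g := RealRMK.integral_rieszMeasure Λ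
  have : IsFiniteMeasure τ0 := inferInstance
  refine ⟨τ0.map Subtype.val, inferInstance, ?_, ?_⟩
  · rw [Measure.map_apply measurable_subtype_coe measurableSet_Icc.compl]
    simp
  · intro f hf
    let g : C_c(Icc a b, ℝ) := ⟨⟨(Icc a b).domRestrict f, hf.domRestrict⟩,
      HasCompactSupport.of_compactSpace _⟩
    have h1 := hτ0 g
    rw [(MeasurableEmbedding.subtype_coe measurableSet_Icc).integral_map]
    change ∫ x, f x ∂τ0 = _ at h1
    rw [h1]
    change (inner ℂ v (cfc (IccExtend hab g) T v)).re = _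
    rw [cfc_congr (g := f)]
    intro x hx
    change IccExtend hab ((Icc a b).domRestrict f) x = f x
    rw [IccExtend_of_mem _ _ (hsp hx)]
    rfl

theorem cfc_resolvent {H : Type*} [NormedAddCommGroup H] [InnerProductSpace ℂ H]
    [CompleteSpace H] (T : H →L[ℂ] H) (hT : IsSelfAdjoint T) (x : ℝ)
    (hx : x ∉ spectrum ℝ T) (v : H) :
    x • cfc (fun t => (x - t)⁻¹) T v - T (cfc (fun t => (x - t)⁻¹) T v) = v := by
  have hne : ∀ t ∈ spectrum ℝ T, x - t ≠ 0 := fun t ht h0 => by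
    rw [sub_eq_zero] at h0; exact hx (h0 ▸ ht)
  have h1 : cfc (fun t => (x - t) * (x - t)⁻¹) T = 1 := by
    rw [cfc_congr (g := fun _ => (1 : ℝ))]
    · exact cfc_const_one ℝ T
    · intro t ht
      exact mul_inv_cancel₀ (hne t ht)
  have hcinv : ContinuousOn (fun t => (x - t)⁻¹) (spectrum ℝ T) :=
    ContinuousOn.inv₀ (by fun_prop) hne
  rw [cfc_mul _ _ _ (by fun_prop) hcinv, cfc_sub _ _ _ (by fun_prop) (by fun_prop),
    cfc_const x T, cfc_id' ℝ T] at h1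
  have := DFunLike.congr_fun h1 v
  simpa [Algebra.algebraMap_eq_smul_one] using this

theorem finite_roots_null {μ : Measure ℝ} {a b : ℝ} (h : Gen μ a b) (P : ℂ[X])
    (hP : ∀ p : ℂ[X], ∫ x, p.eval (x : ℂ) * P.eval (x : ℂ) ∂μ = 0) : P = 0 := by
  by_contra hP0
  have h1 := hP (P.map (starRingEnd ℂ))
  have h2 : ∀ x : ℝ, (P.map (starRingEnd ℂ)).eval (x : ℂ) * P.eval (x : ℂ)
      = ((‖P.eval (x : ℂ)‖ ^ 2 : ℝ) : ℂ) := by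
    intro x
    have : (P.map (starRingEnd ℂ)).eval (x : ℂ) = (starRingEnd ℂ) (P.eval (x : ℂ)) := by
      have := Polynomial.eval_map_apply (p := P) (starRingEnd ℂ) (x : ℂ)
      simpa using this
    rw [this, mul_comm, Complex.mul_conj']
    push_cast; rfl
  simp only [h2] at h1
  rw [integral_complex_ofReal] at h1
  norm_cast at h1
  have hc : ContinuousOn (fun x : ℝ => ‖P.eval (x : ℂ)‖ ^ 2) (Icc a b) := by fun_prop
  have h3 := (integral_eq_zero_iff_of_nonneg (fun x => by positivity) (h.integrable hc)).1 h1
  have hfin : Set.Finite {x : ℝ | P.eval (x : ℂ) = 0} := by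
    have hf := P.roots.toFinset.finite_toSet
    refine Set.Finite.of_finite_image (f := fun x : ℝ => (x : ℂ)) (hf.subset ?_)
      (Complex.ofReal_injective.injOn)
    rintro _ ⟨x, hx, rfl⟩
    simp only [Finset.mem_coe, Multiset.mem_toFinset]
    exact (mem_roots hP0).2 hx
  apply h.inf hfin.toFinset
  refine measure_mono_null ?_ (ae_iff.1 h3)
  intro x hx
  simp only [Finite.coe_toFinset, mem_compl_iff, mem_ofPred_eq] at hx
  simp only [mem_ofPred_eq, Pi.zero_apply]
  have := norm_pos_iff.2 hx
  positivity

theorem eqOn_Off_of_real {a b : ℝ} {f g : ℂ → ℂ} (hf : DifferentiableOn ℂ f (Off a b))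
    (hg : DifferentiableOn ℂ g (Off a b)) (h : ∀ x : ℝ, b < x → f x = g x) :
    EqOn f g (Off a b) := by
  have hz : ((b + 1 : ℝ) : ℂ) ∈ Off a b := ofReal_mem_Off.2 fun h => by linarith [h.2]
  refine (hf.analyticOnNhd (isOpen_Off a b)).eqOn_of_preconnected_of_frequently_eq
    (hg.analyticOnNhd (isOpen_Off a b)) (isPreconnected_Off a b) hz ?_
  have ht : Tendsto (fun x : ℝ => (x : ℂ)) (𝓝[>] (b + 1)) (𝓝[≠] ((b + 1 : ℝ) : ℂ)) := by
    refine tendsto_nhdsWithin_iff.2 ⟨?_, ?_⟩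
    · exact (Complex.continuous_ofReal.tendsto _).mono_left nhdsWithin_le_nhds
    · filter_upwards [self_mem_nhdsWithin] with x hx
      intro h0
      exact (ne_of_gt hx) (Complex.ofReal_injective h0)
  refine ht.frequently (Eventually.frequently ?_)
  filter_upwards [self_mem_nhdsWithin] with x hx
  exact h x (by have : b + 1 < x := hx; linarith)

theorem cT_eq_zero_of_finite {μ : Measure ℝ} {F : Finset ℝ} (hF : μ (F : Set ℝ)ᶜ = 0)
    (g : ℝ → ℂ) (hg : ∀ x ∈ F, g x = 0) (z : ℂ) : cT μ g z = 0 := by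
  unfold cT
  apply integral_eq_zero_of_ae
  filter_upwards [(ae_iff.2 hF : ∀ᵐ x ∂μ, x ∈ (F : Set ℝ))] with x hx
  rw [hg x hx, zero_mul]; rfl

theorem exists_inverse_of_ne_zero {μ : Measure ℝ} {a b : ℝ} (h : Gen μ a b) {c : ℝ} (hc : c ≠ 0)
    (hφ : ∀ x : ℝ, x ∉ Icc a b → (c : ℂ) + cT μ (fun _ => 1) x ≠ 0) :
    ∃ (τ : Measure ℝ) (e : ℝ), Gen τ a b ∧ ∀ z ∈ Off a b,
      (c + cT μ (fun _ => 1) z) * (e - cT τ (fun _ => 1) z) = 1 := by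
  obtain ⟨T, v, hT, hsp, hw⟩ := h.exists_model hc hφ
  obtain ⟨τ0, hfin, hnull, hint⟩ := exists_spectral_measure h.lt.le T hsp v
  have hcc : (c : ℂ) ≠ 0 := by exact_mod_cast hc
  have hτ0 : Car τ0 a b := ⟨hfin, hnull⟩
  have hone : ContinuousOn (fun _ : ℝ => (1 : ℂ)) (Icc a b) := continuousOn_const
  set r : NNReal := ⟨(c ^ 2)⁻¹, by positivity⟩ with hr
  set τ : Measure ℝ := r • τ0 with hτdef
  have hτ : Car τ a b := ⟨inferInstance, by simp [hτdef, hnull]⟩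
  have hreal : ∀ x : ℝ, x ∉ Icc a b → cT τ (fun _ => 1) x =
      (c ^ 2 : ℂ)⁻¹ * (c * cT μ (fun _ => 1) x / (c + cT μ (fun _ => 1) x)) := by
    intro x hx
    have hz := (ofReal_mem_Off (a := a) (b := b)).2 hx
    have hxs : x ∉ spectrum ℝ T := fun hs => hx (hsp hs)
    have h1 := hw x _ hx (cfc_resolvent T hT x hxs v)
    have hcont : ContinuousOn (fun t : ℝ => (x - t)⁻¹) (Icc a b) :=
      ContinuousOn.inv₀ (by fun_prop) fun t ht h0 => hx (by rw [sub_eq_zero] at h0; rwa [h0])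
    have h2 := hint _ hcont
    have hre : ∀ ν : Measure ℝ, cT ν (fun _ => 1) x = ((∫ t, (x - t)⁻¹ ∂ν : ℝ) : ℂ) := by
      intro ν
      unfold cT
      rw [← integral_complex_ofReal]
      push_cast
      simp
    rw [h1] at h2
    have h3 : cT τ0 (fun _ => 1) x = c * cT μ (fun _ => 1) x / (c + cT μ (fun _ => 1) x) := by
      rw [hre τ0, h2]
      apply exists_real_of_im
      rw [hre μ]
      norm_cast
    have hrc : ((r : ℝ) : ℂ) = (c ^ 2 : ℂ)⁻¹ := by
      rw [show (r : ℝ) = (c ^ 2)⁻¹ from rfl]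
      push_cast; rfl
    have h4 : cT τ (fun _ => 1) x = (c ^ 2 : ℂ)⁻¹ * cT τ0 (fun _ => 1) x := by
      unfold cT
      rw [hτdef, integral_smul_nnreal_measure]
      rw [NNReal.smul_def, Complex.real_smul, hrc]
    rw [h4, h3]
  have hid : ∀ z ∈ Off a b,
      (c + cT μ (fun _ => 1) z) * ((c⁻¹ : ℝ) - cT τ (fun _ => 1) z) = 1 := by
    refine eqOn_Off_of_real (f := fun z => (c + cT μ (fun _ => 1) z) *
      ((c⁻¹ : ℝ) - cT τ (fun _ => 1) z)) (g := fun _ => 1) ?_ (differentiableOn_const _) ?_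
    · exact ((h.cT_differentiableOn hone).const_add _).mul
        ((hτ.cT_differentiableOn hone).const_sub _)
    · intro x hx
      have hxI : x ∉ Icc a b := fun h => by linarith [h.2]
      have h0 := hφ x hxI
      rw [hreal x hxI]
      push_cast
      field_simp
      ring
  refine ⟨τ, c⁻¹, ⟨hτ, fun F hF => ?_⟩, hid⟩
  set D : ℂ[X] := ∏ y ∈ F, (X - C (y : ℂ)) with hD
  have hD0 : D ≠ 0 := (monic_prod_X_sub_C _ _).ne_zero
  obtain ⟨N, hN⟩ := hτ.poly_mul_cT hone D
  have hDF : ∀ z, cT τ (fun x => D.eval (x : ℂ) * 1) z = 0 := by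
    refine cT_eq_zero_of_finite hF _ fun x hx => ?_
    rw [mul_one, hD, eval_prod]
    exact Finset.prod_eq_zero hx (by simp)
  set P : ℂ[X] := C ((c⁻¹ : ℝ) : ℂ) * D - N with hP
  have hDP : ∀ z ∈ Off a b, D.eval z = (c + cT μ (fun _ => 1) z) * P.eval z := by
    intro z hz
    have h1 := hN z hz
    rw [hDF, zero_add] at h1
    have h2 := hid z hz
    rw [hP, eval_sub, ← h1, eval_mul, eval_C]
    linear_combination (-D.eval z) * h2
  obtain ⟨E, hE⟩ := h.poly_mul_cT hone P
  have hPz : P = 0 := by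
    refine finite_roots_null h P fun p => ?_
    have hPc : ContinuousOn (fun x : ℝ => P.eval (x : ℂ) * 1) (Icc a b) := by fun_prop
    have := (h.poly_part_zero (p.natDegree + 1) hPc (E + C (c : ℂ) * P - D) ?_).2 p ?_
    · simpa using this
    · refine tendsto_const_nhds.congr' ?_
      filter_upwards [eventually_Off a b] with z hz
      have h1 := hE z hz
      have h2 := hDP z hz
      simp only [eval_sub, eval_add, eval_mul, eval_C]
      rw [h2]
      linear_combination z ^ (p.natDegree + 1) * h1
    · exact lt_of_le_of_lt degree_le_natDegree (by exact_mod_cast Nat.lt_succ_self _)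
  apply hD0
  apply poly_tendsto_zero
  refine tendsto_const_nhds.congr' ?_
  filter_upwards [eventually_Off a b] with z hz
  rw [hDP z hz, hPz]; simp

theorem exists_inverse_of_zero {μ : Measure ℝ} {a b : ℝ} (h : Gen μ a b) :
    ∃ (τ : Measure ℝ) (e : ℝ), Gen τ a b ∧ ∀ z ∈ Off a b,
      cT μ (fun _ => 1) z * (((μ.real univ)⁻¹ : ℝ) * z + e - cT τ (fun _ => 1) z) = 1 := by
  have hone : ContinuousOn (fun _ : ℝ => (1 : ℂ)) (Icc a b) := continuousOn_const
  have hg : ContinuousOn (fun x : ℝ => x - a) (Icc a b) := by fun_prop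
  have hg0 : ∀ x ∈ Icc a b, 0 ≤ x - a := fun x hx => by linarith [hx.1]
  have hgF : ∀ x ∈ Icc a b, x ∉ ({a} : Finset ℝ) → x - a ≠ 0 := fun x _ hxa h0 =>
    hxa (by simpa [sub_eq_zero] using h0)
  have hω := h.dens hg hg0 hgF
  have hm := h.mass_pos
  have key : ∀ {ν : Measure ℝ}, Gen ν a b → ∀ z ∈ Off a b,
      (z - a) * cT ν (fun _ => 1) z =
        (ν.real univ : ℝ) + cT (dens ν fun x => x - a) (fun _ => 1) z := by
    intro ν hν z hz
    rw [hν.cT_dens hg hg0]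
    have h1 := hν.mul_cT hone hz
    have h2 : cT ν (fun x => ((x - a : ℝ) : ℂ) * 1) z =
        cT ν (fun x => (x : ℂ) * 1) z + cT ν (fun x => (-a : ℂ) * 1) z := by
      rw [← hν.cT_add (by fun_prop) (by fun_prop) hz]
      congr 1; ext x; push_cast; ring
    rw [h2, cT_smul, sub_mul, h1]
    simp
    ring
  obtain ⟨τ, e, hτ, hid⟩ := exists_inverse_of_ne_zero hω hm.ne' (by
    intro x hx
    have hz := (ofReal_mem_Off (a := a) (b := b)).2 hx
    rw [← key h _ hz]
    refine mul_ne_zero ?_ (h.cT_one_ne_zero hz)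
    exact sub_ne_zero_of_Off hz (left_mem_Icc.2 h.lt.le))
  have hτm := key hτ
  have he : (e : ℂ) = ((μ.real univ)⁻¹ : ℝ) := by
    have t1 := ((hω.cT_tendsto_zero hone).const_add ((μ.real univ : ℝ) : ℂ)).mul
      ((hτ.cT_tendsto_zero hone).const_sub (e : ℂ))
    have t2 := tendsto_nhds_unique (t1.congr' (f₂ := fun _ => (1 : ℂ)) (by
      filter_upwards [eventually_Off a b] with z hz
      exact hid z hz)) tendsto_const_nhds
    have hmc : ((μ.real univ : ℝ) : ℂ) ≠ 0 := by exact_mod_cast hm.ne'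
    push_cast
    rw [add_zero, sub_zero] at t2
    exact eq_inv_of_mul_eq_one_right t2
  refine ⟨dens τ fun x => x - a, -e * a - τ.real univ, hτ.dens hg hg0 hgF, fun z hz => ?_⟩
  have h1 := hid z hz
  have h2 := hτm z hz
  have h3 := key h z hz
  rw [← h3] at h1
  rw [← he]
  push_cast
  linear_combination h1 + (cT μ (fun _ => 1) z) * h2

theorem Car.restrict_eq {μ : Measure ℝ} {a b : ℝ} (h : Car μ a b) : μ.restrict (Icc a b) = μ :=
  Measure.restrict_eq_self_of_ae_mem h.ae

theorem ofReal_mem_Off_of_disjoint {a b c d t : ℝ} (hd : Disjoint (Icc a b) (Icc c d))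
    (ht : t ∈ Icc c d) : (t : ℂ) ∈ Off a b :=
  ofReal_mem_Off.2 fun h => (disjoint_left.1 hd h ht).elim

theorem continuousOn_ofReal_comp {a b c d : ℝ} (hd : Disjoint (Icc a b) (Icc c d)) {f : ℂ → ℂ}
    (hf : ContinuousOn f (Off a b)) : ContinuousOn (fun t : ℝ => f t) (Icc c d) :=
  hf.comp Complex.continuous_ofReal.continuousOn fun _ ht => ofReal_mem_Off_of_disjoint hd ht

theorem eqOn_Off_of_im {a b : ℝ} {f g : ℂ → ℂ} (hf : ContinuousOn f (Off a b))
    (hg : ContinuousOn g (Off a b)) (h : ∀ z : ℂ, z.im ≠ 0 → f z = g z) : EqOn f g (Off a b) := by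
  intro z hz
  by_cases hi : z.im = 0
  · have hu : Tendsto (fun t : ℝ => z + t * Complex.I) (𝓝[≠] 0) (𝓝[Off a b] z) := by
      refine tendsto_nhdsWithin_iff.2 ⟨?_, ?_⟩
      · refine Tendsto.mono_left ?_ nhdsWithin_le_nhds
        have : Continuous fun t : ℝ => z + t * Complex.I := by fun_prop
        simpa using this.tendsto 0
      · filter_upwards [self_mem_nhdsWithin] with t ht
        exact mem_Off_of_im (by simpa [hi] using ht)
    refine tendsto_nhds_unique_of_eventuallyEq ((hf z hz).tendsto.comp hu)
      ((hg z hz).tendsto.comp hu) ?_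
    filter_upwards [self_mem_nhdsWithin] with t ht
    exact h _ (by simpa [hi] using ht)
  · exact h z hi

/-- Partial fractions and Fubini: the Cauchy transform of a product of two measures. -/
theorem cT_cT {μ σ : Measure ℝ} {a b c d : ℝ} (hμ : Car μ a b) (hσ : Car σ c d)
    (hd : Disjoint (Icc a b) (Icc c d)) {W : ℝ → ℂ} (hW : ContinuousOn W (Icc c d))
    {z : ℂ} (hz : z.im ≠ 0) :
    cT μ (fun x => cT σ W x) z =
      cT μ (fun _ => 1) z * cT σ W z - cT σ (fun t => cT μ (fun _ => 1) t * W t) z := by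
  have := hμ.fin
  have := hσ.fin
  have hone : ContinuousOn (fun _ : ℝ => (1 : ℂ)) (Icc a b) := continuousOn_const
  have hzab : z ∈ Off a b := mem_Off_of_im hz
  have hzcd : z ∈ Off c d := mem_Off_of_im hz
  have hne : ∀ x ∈ Icc a b, ∀ t ∈ Icc c d, ((x : ℂ) - t) ≠ 0 := fun x hx t ht =>
    sub_ne_zero_of_Off (ofReal_mem_Off_of_disjoint hd.symm hx) ht
  have hint : Integrable (Function.uncurry fun (x t : ℝ) => (W t * ((x : ℂ) - t)⁻¹) * (z - x)⁻¹)
      (μ.prod σ) := by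
    have h1 : ContinuousOn (Function.uncurry fun (x t : ℝ) =>
        (W t * ((x : ℂ) - t)⁻¹) * (z - x)⁻¹) (Icc a b ×ˢ Icc c d) := by
      have hW2 : ContinuousOn (fun p : ℝ × ℝ => W p.2) (Icc a b ×ˢ Icc c d) :=
        hW.comp continuous_snd.continuousOn fun p hp => hp.2
      refine ContinuousOn.mul (hW2.mul (ContinuousOn.inv₀ (by fun_prop) ?_))
        (ContinuousOn.inv₀ (by fun_prop) ?_)
      · exact fun p hp => hne _ hp.1 _ hp.2
      · exact fun p hp => sub_ne_zero_of_Off hzab hp.1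
    have h2 := h1.integrableOn_compact (μ := μ.prod σ) (isCompact_Icc.prod isCompact_Icc)
    rwa [IntegrableOn, ← Measure.prod_restrict, hμ.restrict_eq, hσ.restrict_eq] at h2
  have hμc : ContinuousOn (fun t : ℝ => cT μ (fun _ => 1) (t : ℂ)) (Icc c d) :=
    continuousOn_ofReal_comp hd (hμ.cT_continuousOn hone)
  have h1 : cT μ (fun x => cT σ W x) z =
      ∫ x, ∫ t, (W t * ((x : ℂ) - t)⁻¹) * (z - x)⁻¹ ∂σ ∂μ := by
    unfold cT
    congr 1; ext x
    rw [integral_mul_const]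
  rw [h1, integral_integral_swap hint]
  have h2 : cT μ (fun _ => 1) z * cT σ W z - cT σ (fun t => cT μ (fun _ => 1) t * W t) z =
      ∫ t, (cT μ (fun _ => 1) z * (W t * (z - t)⁻¹) -
        (cT μ (fun _ => 1) t * W t) * (z - t)⁻¹) ∂σ := by
    have hμW : ContinuousOn (fun t : ℝ => cT μ (fun _ => 1) (t : ℂ) * W t) (Icc c d) := hμc.mul hW
    rw [integral_sub ((hσ.integrable_kernel hW hzcd).const_mul _)
      (hσ.integrable_kernel hμW hzcd), integral_const_mul]
    rfl
  rw [h2]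
  refine hσ.integral_congr fun t ht => ?_
  have htO := ofReal_mem_Off_of_disjoint hd ht
  have h3 : ∫ x, (W t * ((x : ℂ) - t)⁻¹) * (z - x)⁻¹ ∂μ =
      ∫ x, (W t * (z - t)⁻¹) * (1 * (z - x)⁻¹ - 1 * ((t : ℂ) - x)⁻¹) ∂μ := by
    refine hμ.integral_congr fun x hx => ?_
    have e1 := sub_ne_zero_of_Off hzab hx
    have e2 := hne x hx t ht
    have e3 := sub_ne_zero_of_Off hzcd ht
    have e4 : (t : ℂ) - x ≠ 0 := sub_ne_zero_of_Off htO hx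
    have e5 : (t : ℂ) - x = -(x - t) := by ring
    simp only [e5]
    field_simp
    ring
  rw [h3, integral_const_mul, integral_sub (hμ.integrable_kernel hone hzab)
    (hμ.integrable_kernel hone htO)]
  unfold cT
  ring

/-- A nonvanishing conjugation-symmetric holomorphic function off an interval. -/
structure Nice (f : ℂ → ℂ) (a b : ℝ) : Prop where
  diff : DifferentiableOn ℂ f (Off a b)
  conj : ∀ z ∈ Off a b, f ((starRingEnd ℂ) z) = (starRingEnd ℂ) (f z)
  ne : ∀ z ∈ Off a b, f z ≠ 0

theorem Nice.im_eq {f : ℂ → ℂ} {a b : ℝ} (h : Nice f a b) {x : ℝ} (hx : (x : ℂ) ∈ Off a b) :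
    (f x).im = 0 := by
  have h1 := h.conj x hx
  rw [Complex.conj_ofReal] at h1
  exact Complex.conj_eq_iff_im.1 h1.symm

theorem Nice.re_eq {f : ℂ → ℂ} {a b : ℝ} (h : Nice f a b) {x : ℝ} (hx : (x : ℂ) ∈ Off a b) :
    (((f x).re : ℝ) : ℂ) = f x := exists_real_of_im (h.im_eq hx)

theorem Nice.continuousOn_Icc {f : ℂ → ℂ} {a b c d : ℝ} (h : Nice f a b)
    (hd : Disjoint (Icc a b) (Icc c d)) : ContinuousOn (fun t : ℝ => f t) (Icc c d) :=
  continuousOn_ofReal_comp hd h.diff.continuousOn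

/-- Absorb a density of constant sign into the measure. -/
theorem Gen.exists_signed_dens {μ : Measure ℝ} {a b c d : ℝ} (h : Gen μ c d) {f : ℂ → ℂ}
    (hf : Nice f a b) (hd : Disjoint (Icc a b) (Icc c d)) :
    ∃ (ρ : Measure ℝ) (ε : ℝ), (ε = 1 ∨ ε = -1) ∧ Gen ρ c d ∧
      (∀ g z, cT ρ g z = ε * cT μ (fun x => f x * g x) z) ∧
      ∀ g : ℝ → ℂ, ∫ x, g x ∂ρ = ε * ∫ x, f x * g x ∂μ := by
  have hre : ∀ x ∈ Icc c d, (((f x).re : ℝ) : ℂ) = f x := fun x hx =>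
    hf.re_eq (ofReal_mem_Off_of_disjoint hd hx)
  have hc : ContinuousOn (fun t : ℝ => (f t).re) (Icc c d) :=
    Complex.continuous_re.comp_continuousOn (hf.continuousOn_Icc hd)
  obtain ⟨ε, hε, hpos⟩ := exists_sign_of_ne h.lt.le hc fun x hx h0 => by
    refine hf.ne x (ofReal_mem_Off_of_disjoint hd hx) ?_
    rw [← hre x hx, h0]; simp
  have hc2 : ContinuousOn (fun t : ℝ => ε * (f t).re) (Icc c d) := hc.const_mul _
  have h0 : ∀ x ∈ Icc c d, 0 ≤ ε * (f x).re := fun x hx => (hpos x hx).le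
  refine ⟨NikAux.dens μ fun t => ε * (f t).re, ε, hε,
    h.dens (F := ∅) hc2 h0 fun x hx _ => (hpos x hx).ne', fun g z => ?_, fun g => ?_⟩
  · rw [h.cT_dens hc2 h0, ← cT_smul]
    refine h.cT_congr (fun x hx => ?_) z
    rw [← hre x hx]; push_cast; simp; ring
  · rw [h.integral_dens hc2 h0, ← integral_const_mul]
    refine h.integral_congr fun x hx => ?_
    rw [Complex.real_smul, ← hre x hx]; push_cast; simp; ring

theorem sq_eq_one_of_sign {ε : ℝ} (h : ε = 1 ∨ ε = -1) : (ε : ℂ) * ε = 1 := by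
  rcases h with rfl | rfl <;> norm_num

theorem Gen.cT_nice {μ : Measure ℝ} {a b c d : ℝ} (h : Gen μ c d) {f : ℂ → ℂ}
    (hf : Nice f a b) (hd : Disjoint (Icc a b) (Icc c d)) :
    Nice (cT μ fun x => f x) c d where
  diff := h.cT_differentiableOn (hf.continuousOn_Icc hd)
  conj z _ := cT_conj μ _ (by
    filter_upwards [h.ae] with x hx
    exact hf.im_eq (ofReal_mem_Off_of_disjoint hd hx)) z
  ne z hz h0 := by
    obtain ⟨ρ, ε, -, hρ, hρC, -⟩ := h.exists_signed_dens hf hd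
    apply hρ.cT_one_ne_zero hz
    rw [hρC]
    simp [h0]

theorem nice_one (a b : ℝ) : Nice (fun _ => 1) a b :=
  ⟨differentiableOn_const _, fun _ _ => by simp, fun _ _ => one_ne_zero⟩

/-- `u 0 = 1`, and `u 1, …, u m` are the Cauchy transforms of a Nikishin system of positive
measures whose first generator is carried by `[a, b]`. -/
def NS : ℕ → ℝ → ℝ → (ℕ → ℂ → ℂ) → Prop
  | 0, _, _, u => u 0 = fun _ => 1
  | m + 1, a, b, u => u 0 = (fun _ => 1) ∧ ∃ (μ : Measure ℝ) (c d : ℝ) (v : ℕ → ℂ → ℂ),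
      Gen μ a b ∧ Disjoint (Icc a b) (Icc c d) ∧ NS m c d v ∧
        ∀ k ≤ m, u (k + 1) = cT μ fun x => v k x

theorem NS.zero_eq : ∀ {m : ℕ} {a b : ℝ} {u : ℕ → ℂ → ℂ}, NS m a b u → u 0 = fun _ => 1
  | 0, _, _, _, h => h
  | _ + 1, _, _, _, h => h.1

theorem NS.nice {m : ℕ} : ∀ {a b : ℝ} {u : ℕ → ℂ → ℂ}, NS m a b u → ∀ k ≤ m, Nice (u k) a b := by
  induction m with
  | zero =>
    intro a b u h k hk
    rw [Nat.le_zero.1 hk, h.zero_eq]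
    exact nice_one a b
  | succ m ih =>
    intro a b u h k hk
    rcases k with _ | k
    · rw [h.zero_eq]; exact nice_one a b
    · obtain ⟨-, μ, c, d, v, hμ, hd, hv, hu⟩ := h
      rw [hu k (by omega)]
      exact hμ.cT_nice (ih hv k (by omega)) hd.symm

/-- Exchange of the first generator of a Nikishin system for its inverse measure. -/
theorem swap {μ τ : Measure ℝ} {a b : ℝ} (hμ : Gen μ a b) (hτ : Gen τ a b) {c s e : ℝ}
    (hinv : ∀ z ∈ Off a b, (c + cT μ (fun _ => 1) z) * (s * z + e - cT τ (fun _ => 1) z) = 1)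
    {m : ℕ} {c' d' : ℝ} {v : ℕ → ℂ → ℂ} (hv : NS m c' d' v)
    (hd : Disjoint (Icc a b) (Icc c' d')) :
    ∃ (v' : ℕ → ℂ → ℂ) (ε : ℝ) (mass : ℕ → ℝ), (ε = 1 ∨ ε = -1) ∧ NS m c' d' v' ∧
      ∀ k, 1 ≤ k → k ≤ m → Tendsto (fun z => z * v' k z) (cobounded ℂ) (𝓝 (mass k : ℂ)) ∧
        ∀ z ∈ Off a b, cT μ (fun x => v k x) z =
          (c + cT μ (fun _ => 1) z) * (ε * (-s * mass k + cT τ (fun x => v' k x) z)) := by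
  rcases m with _ | m
  · exact ⟨v, 1, 0, Or.inl rfl, hv, fun k h1 h2 => by omega⟩
  have hone : ContinuousOn (fun _ : ℝ => (1 : ℂ)) (Icc a b) := continuousOn_const
  obtain ⟨hv0, σ, p, q, w, hσ, hdw, hw, hvw⟩ := hv
  have hφ : Nice (fun z => c + cT μ (fun _ => 1) z) a b :=
    ⟨(hμ.cT_differentiableOn hone).const_add _, fun z _ => by
      have := cT_conj μ (fun _ => 1) (by simp) z
      simp only [this]
      simp, fun z hz h0 => by
      have := hinv z hz
      rw [h0] at this
      simp at this⟩
  obtain ⟨ρ, ε, hε, hρ, hρC, hρI⟩ := hσ.exists_signed_dens hφ hd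
  have hε2 := sq_eq_one_of_sign hε
  refine ⟨fun k => if k = 0 then fun _ => 1 else cT ρ fun x => w (k - 1) x, ε,
    fun k => (∫ x, w (k - 1) (x : ℂ) ∂ρ).re, hε, ⟨by simp, ρ, p, q, w, hρ, hdw, hw, fun k _ => by
      simp⟩, ?_⟩
  rintro (_ | k) h1 hk
  · omega
  have hwk := hw.nice k (by omega)
  have hWc := hwk.continuousOn_Icc hdw.symm
  have hμc : ContinuousOn (fun t : ℝ => cT μ (fun _ => 1) (t : ℂ)) (Icc c' d') :=
    continuousOn_ofReal_comp hd (hμ.cT_continuousOn hone)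
  have hτc : ContinuousOn (fun t : ℝ => cT τ (fun _ => 1) (t : ℂ)) (Icc c' d') :=
    continuousOn_ofReal_comp hd (hτ.cT_continuousOn hone)
  have hmass : (((∫ x, w k (x : ℂ) ∂ρ).re : ℝ) : ℂ) = ∫ x, w k (x : ℂ) ∂ρ := by
    rw [hρ.integral_congr (g := fun x : ℝ => w k x) (g' := fun x : ℝ => (((w k x).re : ℝ) : ℂ))
      fun x hx => (hwk.re_eq (ofReal_mem_Off_of_disjoint hdw.symm hx)).symm]
    rw [integral_complex_ofReal]; simp
  simp only [Nat.add_sub_cancel, Nat.succ_ne_zero, if_false, hmass]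
  refine ⟨hρ.cT_tendsto_mass hWc, ?_⟩
  have hvk : Nice (v (k + 1)) c' d' := by
    rw [hvw k (by omega)]; exact hσ.cT_nice hwk hdw.symm
  have hρk : Nice (cT ρ fun x => w k x) c' d' := hρ.cT_nice hwk hdw.symm
  refine eqOn_Off_of_im (hμ.cT_continuousOn (hvk.continuousOn_Icc hd.symm))
    (hφ.diff.continuousOn.mul (continuousOn_const.mul (continuousOn_const.add
      (hτ.cT_continuousOn (hρk.continuousOn_Icc hd.symm))))) fun z hz => ?_
  have hzc : z ∈ Off c' d' := mem_Off_of_im hz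
  rw [hvw k (by omega), cT_cT hμ.toCar hσ.toCar hd hWc hz, cT_cT hτ.toCar hρ.toCar hd hWc hz,
    hρC, hρC, hρI]
  set S := cT σ (fun x => w k x) z with hS
  set X := cT σ (fun t => cT μ (fun _ => 1) t * w k t) z with hX
  have hφW : ContinuousOn (fun x : ℝ => (c + cT μ (fun _ => 1) x) * w k x) (Icc c' d') :=
    (continuousOn_const.add hμc).mul hWc
  have e1 : cT σ (fun x => (c + cT μ (fun _ => 1) x) * w k x) z = c * S + X := by
    have k1 : ContinuousOn (fun x : ℝ => (c : ℂ) * w k x) (Icc c' d') := continuousOn_const.mul hWc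
    have k2 : ContinuousOn (fun x : ℝ => cT μ (fun _ => 1) x * w k x) (Icc c' d') := hμc.mul hWc
    rw [hS, hX, ← cT_smul, ← hσ.cT_add k1 k2 hzc]
    congr 1; ext x; ring
  have e2 : cT σ (fun x => (c + cT μ (fun _ => 1) x) * (cT τ (fun _ => 1) x * w k x)) z =
      s * (z * (c * S + X) - ∫ x, (c + cT μ (fun _ => 1) x) * w k x ∂σ) + e * (c * S + X) - S := by
    have e3 : cT σ (fun x => (c + cT μ (fun _ => 1) x) * (cT τ (fun _ => 1) x * w k x)) z =
        cT σ (fun x => (s * (x * ((c + cT μ (fun _ => 1) x) * w k x)) +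
          e * ((c + cT μ (fun _ => 1) x) * w k x)) + (-1) * w k x) z := by
      refine hσ.cT_congr (fun x hx => ?_) z
      have := hinv x (ofReal_mem_Off_of_disjoint hd hx)
      linear_combination (- w k x) * this
    have hxc : ContinuousOn (fun x : ℝ => (x : ℂ)) (Icc c' d') := by fun_prop
    have k1 : ContinuousOn (fun x : ℝ => (s : ℂ) * (x * ((c + cT μ (fun _ => 1) x) * w k x)))
      (Icc c' d') := continuousOn_const.mul (hxc.mul hφW)
    have k2 : ContinuousOn (fun x : ℝ => (e : ℂ) * ((c + cT μ (fun _ => 1) x) * w k x))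
      (Icc c' d') := continuousOn_const.mul hφW
    have k3 : ContinuousOn (fun x : ℝ => (-1 : ℂ) * w k x) (Icc c' d') := continuousOn_const.mul hWc
    have k12 : ContinuousOn (fun x : ℝ => (s : ℂ) * (x * ((c + cT μ (fun _ => 1) x) * w k x)) +
      e * ((c + cT μ (fun _ => 1) x) * w k x)) (Icc c' d') := k1.add k2
    rw [e3, hσ.cT_add k12 k3 hzc, hσ.cT_add k1 k2 hzc, cT_smul, cT_smul, cT_smul, e1]
    have := hσ.mul_cT hφW hzc
    rw [e1] at this
    rw [this, ← hS]
    ring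
  rw [e1, e2]
  have h3 := hinv z (mem_Off_of_im hz)
  set I := ∫ x, (c + cT μ (fun _ => 1) x) * w k x ∂σ
  linear_combination (c * S + X) * h3 - (c + cT μ (fun _ => 1) z) * (-s * I +
    cT τ (fun _ => 1) z * (c * S + X) - (s * (z * (c * S + X) - I) + e * (c * S + X) - S)) * hε2

/-- `f` is a real linear combination, off `[a, b]`, of those `u l` with `N ≤ n l`. -/
def Comb (m : ℕ) (a b : ℝ) (n : ℕ → ℕ) (u : ℕ → ℂ → ℂ) (N : ℕ) (f : ℂ → ℂ) : Prop :=
  ∃ r : ℕ → ℝ, (∀ l ≤ m, r l ≠ 0 → N ≤ n l) ∧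
    ∀ z ∈ Off a b, f z = ∑ l ∈ Finset.range (m + 1), (r l : ℂ) * u l z

section
variable {m : ℕ} {a b : ℝ} {n : ℕ → ℕ} {u : ℕ → ℂ → ℂ} {N : ℕ}

theorem Comb.add {f g : ℂ → ℂ} (hf : Comb m a b n u N f) (hg : Comb m a b n u N g) :
    Comb m a b n u N fun z => f z + g z := by
  obtain ⟨r, hr, hr2⟩ := hf
  obtain ⟨s, hs, hs2⟩ := hg
  refine ⟨fun l => r l + s l, fun l hl h => ?_, fun z hz => ?_⟩
  · by_cases h1 : r l = 0
    · exact hs l hl fun h2 => h (by simp [h1, h2])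
    · exact hr l hl h1
  · simp only
    rw [hr2 z hz, hs2 z hz, ← Finset.sum_add_distrib]
    exact Finset.sum_congr rfl fun l _ => by push_cast; ring

theorem Comb.smul {f : ℂ → ℂ} (hf : Comb m a b n u N f) (c : ℝ) :
    Comb m a b n u N fun z => c * f z := by
  obtain ⟨r, hr, hr2⟩ := hf
  refine ⟨fun l => c * r l, fun l hl h => hr l hl (right_ne_zero_of_mul h), fun z hz => ?_⟩
  simp only
  rw [hr2 z hz, Finset.mul_sum]
  exact Finset.sum_congr rfl fun l _ => by push_cast; ring

theorem Comb.single {l : ℕ} (hl : l ≤ m) (hN : N ≤ n l) : Comb m a b n u N (u l) := by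
  classical
  refine ⟨fun i => if i = l then 1 else 0, fun i _ h => ?_, fun z _ => ?_⟩
  · by_cases hi : i = l
    · exact hi ▸ hN
    · simp [hi] at h
  · rw [Finset.sum_eq_single l]
    · simp
    · intro i _ hi; simp [hi]
    · intro h; exact absurd (Finset.mem_range.2 (by omega)) h

theorem Comb.const (hu : u 0 = fun _ => 1) (hN : N ≤ n 0) (c : ℝ) :
    Comb m a b n u N fun _ => c := by
  have := (Comb.single (m := m) (a := a) (b := b) (u := u) (Nat.zero_le m) hN).smul c
  simpa [hu] using this

theorem Comb.sum {ι : Type*} (s : Finset ι) {f : ι → ℂ → ℂ}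
    (hf : ∀ i ∈ s, Comb m a b n u N (f i)) : Comb m a b n u N fun z => ∑ i ∈ s, f i z := by
  classical
  induction s using Finset.induction_on with
  | empty => exact ⟨fun _ => 0, fun _ _ h => absurd rfl h, fun z _ => by simp⟩
  | insert i s hi ih =>
    have := (hf i (Finset.mem_insert_self _ _)).add
      (ih fun k hk => hf k (Finset.mem_insert_of_mem hk))
    simpa [Finset.sum_insert hi] using this

theorem Comb.continuousOn {c d : ℝ} (hd : Disjoint (Icc a b) (Icc c d)) (hu : NS m a b u)
    {f : ℂ → ℂ} (hf : Comb m a b n u N f) : ContinuousOn (fun x : ℝ => f x) (Icc c d) := by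
  obtain ⟨r, -, hr⟩ := hf
  have : ContinuousOn (fun x : ℝ => ∑ l ∈ Finset.range (m + 1), (r l : ℂ) * u l x)
      (Icc c d) := continuousOn_finsetSum _ fun l hl => continuousOn_const.mul
        ((hu.nice l (by rw [Finset.mem_range] at hl; omega)).continuousOn_Icc hd)
  exact this.congr fun x hx => hr x (ofReal_mem_Off_of_disjoint hd hx)

end

theorem Car.cT_affine {ρ : Measure ℝ} {a b : ℝ} (hρ : Car ρ a b) {g : ℝ → ℂ}
    (hg : ContinuousOn g (Icc a b)) {z : ℂ} (hz : z ∈ Off a b) (A : ℂ) :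
    cT ρ (fun x => A * x + g x) z =
      A * (z * cT ρ (fun _ => 1) z - ρ.real univ) + cT ρ g z := by
  have hone : ContinuousOn (fun _ : ℝ => (1 : ℂ)) (Icc a b) := continuousOn_const
  have hxc : ContinuousOn (fun x : ℝ => A * (x * 1)) (Icc a b) := by fun_prop
  have h1 := hρ.cT_add hxc hg hz
  rw [cT_smul] at h1
  have h2 := hρ.mul_cT hone hz
  have h3 : ∫ _, (1 : ℂ) ∂ρ = (ρ.real univ : ℂ) := by simp
  rw [h3] at h2
  simp only [mul_one] at h1 h2
  rw [h1, h2]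
  ring

theorem Car.cT_sum_nice {ρ : Measure ℝ} {a b c d : ℝ} (hρ : Car ρ a b)
    (hd : Disjoint (Icc a b) (Icc c d)) {m : ℕ} {v : ℕ → ℂ → ℂ} (hv : ∀ l ≤ m, Nice (v l) c d)
    (r : ℕ → ℝ) {z : ℂ} (hz : z ∈ Off a b) :
    cT ρ (fun x => ∑ l ∈ Finset.range (m + 1), (r l : ℂ) * v l x) z =
      ∑ l ∈ Finset.range (m + 1), (r l : ℂ) * cT ρ (fun x => v l x) z := by
  have hc : ∀ i ∈ Finset.range (m + 1), ContinuousOn (fun x : ℝ => (r i : ℂ) * v i x) (Icc a b) :=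
    fun i hi => continuousOn_const.mul
      ((hv i (by rw [Finset.mem_range] at hi; omega)).continuousOn_Icc hd.symm)
  rw [hρ.cT_sum _ hc hz]
  exact Finset.sum_congr rfl fun l _ => cT_smul _ _ _ _

/-- Push a linear combination of the tail through an exchanged first generator. -/
theorem comb_lift {ρ τ : Measure ℝ} {a b c d : ℝ} (hρ : Gen ρ a b)
    (hd : Disjoint (Icc a b) (Icc c d)) {m : ℕ} {v' v'' u'' : ℕ → ℂ → ℂ}
    (hv' : NS m c d v') {κ s ε : ℝ} {mass : ℕ → ℝ}
    (hsw : ∀ l, 1 ≤ l → l ≤ m → ∀ z ∈ Off a b, cT ρ (fun x => v' l x) z =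
      (κ + cT ρ (fun _ => 1) z) * (ε * (-s * mass l + cT τ (fun x => v'' l x) z)))
    (hu0 : u'' 0 = fun _ => 1) (hu : ∀ l ≤ m, u'' (l + 1) = cT τ fun x => v'' l x)
    {n' n'' : ℕ → ℕ} (hn : ∀ l, 1 ≤ l → l ≤ m → n'' (l + 1) = n' l) {N : ℕ} (hN : N ≤ n'' 0)
    {r : ℕ → ℝ} (hr : ∀ l ≤ m, r l ≠ 0 → N ≤ n' l) :
    ∃ G, Comb (m + 1) a b n'' u'' N G ∧ ∀ z ∈ Off a b,
      r 0 * κ + cT ρ (fun x => ∑ l ∈ Finset.range (m + 1), (r l : ℂ) * v' l x) z =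
        (κ + cT ρ (fun _ => 1) z) * G z := by
  refine ⟨fun z => (r 0 : ℂ) + ∑ l ∈ Finset.range m, ((r (l + 1) * ε : ℝ) : ℂ) *
    (((-s * mass (l + 1) : ℝ) : ℂ) + u'' (l + 1 + 1) z), ?_, fun z hz => ?_⟩
  · refine (Comb.const hu0 hN _).add (Comb.sum _ fun l hl => ?_)
    rw [Finset.mem_range] at hl
    by_cases h0 : r (l + 1) = 0
    · refine ⟨fun _ => 0, fun _ _ h => absurd rfl h, fun z _ => by simp [h0]⟩
    · refine Comb.smul ((Comb.const hu0 hN _).add (Comb.single (by omega) ?_)) _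
      rw [hn (l + 1) (by omega) (by omega)]
      exact hr (l + 1) (by omega) h0
  · rw [hρ.cT_sum_nice hd hv'.nice r hz, Finset.sum_range_succ', hv'.zero_eq, mul_add,
      Finset.mul_sum]
    have : ∀ l ∈ Finset.range m, (r (l + 1) : ℂ) * cT ρ (fun x => v' (l + 1) x) z =
        (κ + cT ρ (fun _ => 1) z) * (((r (l + 1) * ε : ℝ) : ℂ) *
          (((-s * mass (l + 1) : ℝ) : ℂ) + u'' (l + 1 + 1) z)) := by
      intro l hl
      rw [Finset.mem_range] at hl
      rw [hsw (l + 1) (by omega) (by omega) z hz, hu (l + 1) (by omega)]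
      push_cast; ring
    rw [Finset.sum_congr rfl this]
    ring

/-- The shape of the exchanged system: `f` is the old system, `j` the index moved to the front. -/
def Moves (m : ℕ) (a b : ℝ) (u : ℕ → ℂ → ℂ) (n : ℕ → ℕ) (j : ℕ) : Prop :=
  ∃ (u' : ℕ → ℂ → ℂ) (n' : ℕ → ℕ) (A : ℝ), NS m a b u' ∧ n' 0 = n j ∧
    ∑ k ∈ Finset.range (m + 1), n' k = ∑ k ∈ Finset.range (m + 1), n k ∧
    (∀ l ≤ m, n' l ≤ n j) ∧
    (∃ g, Comb m a b n' u' (n 0) g ∧ ∀ z ∈ Off a b, 1 = u j z * (A * z + g z)) ∧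
    ∀ k, 1 ≤ k → k ≤ m → ∃ g, Comb m a b n' u' (n k) g ∧ ∀ z ∈ Off a b, u k z = u j z * g z

theorem moves_zero {m : ℕ} {a b : ℝ} {u : ℕ → ℂ → ℂ} (hu : NS m a b u) {n : ℕ → ℕ}
    (hn : ∀ k ≤ m, n k ≤ n 0) : Moves m a b u n 0 :=
  ⟨u, n, 0, hu, rfl, rfl, hn, ⟨fun _ => (1 : ℝ), Comb.const hu.zero_eq le_rfl 1,
    fun z _ => by simp [hu.zero_eq]⟩, fun k _ hk => ⟨u k, Comb.single hk le_rfl, fun z _ => by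
      simp [hu.zero_eq]⟩⟩

theorem NS.cons {m : ℕ} {a b c d : ℝ} {τ : Measure ℝ} {v : ℕ → ℂ → ℂ} (hτ : Gen τ a b)
    (hd : Disjoint (Icc a b) (Icc c d)) (hv : NS m c d v) :
    ∃ u : ℕ → ℂ → ℂ, NS (m + 1) a b u ∧ ∀ k, u (k + 1) = cT τ fun x => v k x :=
  ⟨fun k => if k = 0 then fun _ => 1 else cT τ fun x => v (k - 1) x,
    ⟨rfl, τ, c, d, v, hτ, hd, hv, fun k _ => by simp⟩, fun k => by simp⟩

def consIndex (p q : ℕ) (n : ℕ → ℕ) : ℕ → ℕ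
  | 0 => p
  | 1 => q
  | l + 2 => n (l + 1)

theorem consIndex_of_pos (p q : ℕ) (n : ℕ → ℕ) {l : ℕ} (hl : 1 ≤ l) :
    consIndex p q n (l + 1) = n l := by
  obtain ⟨l, rfl⟩ := Nat.exists_eq_succ_of_ne_zero (by omega : l ≠ 0)
  rfl

theorem sum_consIndex (p q : ℕ) (n : ℕ → ℕ) (m : ℕ) (h : n 0 = p) :
    ∑ k ∈ Finset.range (m + 1 + 1), consIndex p q n k =
      (∑ k ∈ Finset.range (m + 1), n k) + q := by
  rw [Finset.sum_range_succ', Finset.sum_range_succ', Finset.sum_range_succ', h]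
  simp only [consIndex]
  ring

theorem consIndex_le {p q : ℕ} {n : ℕ → ℕ} {m N : ℕ} (hp : p ≤ N) (hq : q ≤ N)
    (hn : ∀ l ≤ m, n l ≤ N) : ∀ l ≤ m + 1, consIndex p q n l ≤ N
  | 0, _ => hp
  | 1, _ => hq
  | l + 2, h => hn (l + 1) (by omega)

/-- The step where the first tail exponent does not dominate. -/
theorem moves_direct {m : ℕ} {a b : ℝ} {u : ℕ → ℂ → ℂ} (hu : NS (m + 1) a b u)
    {n : ℕ → ℕ} {j : ℕ} (hj : j ≤ m) (hmax : ∀ k ≤ m + 1, n k ≤ n (j + 1))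
    (hn1 : n 1 ≤ n 0 ∨ j = 0)
    (ih : ∀ {a b : ℝ} {u : ℕ → ℂ → ℂ}, NS m a b u →
      ∀ {n : ℕ → ℕ} {j : ℕ}, j ≤ m → (∀ k ≤ m, n k ≤ n j) → Moves m a b u n j) :
    Moves (m + 1) a b u n (j + 1) := by
  obtain ⟨hu0, μ, c, d, v, hμ, hd, hv, huk⟩ := hu
  have hone : ContinuousOn (fun _ : ℝ => (1 : ℂ)) (Icc a b) := continuousOn_const
  obtain ⟨v', n', A, hv', hn'0, hsum, hle, ⟨g0, hg0, hg0'⟩, hrow⟩ :=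
    ih hv (n := fun k => n (k + 1)) hj fun k hk => hmax (k + 1) (by omega)
  obtain ⟨ρ, ε, hε, hρ, hρC, -⟩ := hμ.exists_signed_dens (hv.nice j hj) hd.symm
  have hε2 := sq_eq_one_of_sign hε
  obtain ⟨τ, e, hτ, hinv⟩ := exists_inverse_of_zero hρ
  have hinv' : ∀ z ∈ Off a b, ((0 : ℝ) + cT ρ (fun _ => 1) z) *
      (((ρ.real univ)⁻¹ : ℝ) * z + e - cT τ (fun _ => 1) z) = 1 := by simpa using hinv
  obtain ⟨v'', ε', mass, -, hv'', hsw⟩ := swap hρ hτ hinv' hv' hd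
  obtain ⟨u'', hu'', hu''k⟩ := NS.cons hτ hd hv''
  have hρμ : ∀ (g : ℝ → ℂ) z, cT μ (fun x => v j x * g x) z = ε * cT ρ g z := by
    intro g z
    rw [hρC, ← mul_assoc, hε2, one_mul]
  have huj : ∀ z, u (j + 1) z = ε * cT ρ (fun _ => 1) z := by
    intro z
    rw [huk j hj, ← hρμ]; simp
  have hmass : ((ρ.real univ : ℝ) : ℂ) ≠ 0 := by exact_mod_cast hρ.mass_pos.ne'
  have hτ1 : ∀ z, u'' 1 z = cT τ (fun _ => 1) z := by
    intro z; rw [hu''k 0, hv''.zero_eq]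
  have lift : ∀ {N : ℕ} {g : ℂ → ℂ}, N ≤ n (j + 1) → Comb m c d n' v' N g →
      ∃ G, Comb (m + 1) a b (consIndex (n (j + 1)) (n 0) n') u'' N G ∧ ∀ z ∈ Off a b,
        cT ρ (fun x => g x) z = cT ρ (fun _ => 1) z * G z := by
    rintro N g hN ⟨r, hr, hr'⟩
    obtain ⟨G, hG, hG'⟩ := comb_lift (n'' := consIndex (n (j + 1)) (n 0) n') hρ hd hv'
      (fun l h1 h2 => (hsw l h1 h2).2) hu''.zero_eq
      (fun l _ => hu''k l) (fun l h1 _ => consIndex_of_pos _ _ _ h1) hN hr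
    refine ⟨G, hG, fun z hz => ?_⟩
    have := hG' z hz
    rw [Complex.ofReal_zero, mul_zero, zero_add, zero_add] at this
    rw [← this]
    exact hρ.cT_congr (fun x hx => hr' x (ofReal_mem_Off_of_disjoint hd.symm hx)) z
  refine ⟨u'', consIndex (n (j + 1)) (n 0) n', ε * (ρ.real univ)⁻¹, hu'', rfl, ?_,
    consIndex_le le_rfl (hmax 0 (by omega)) hle, ⟨fun z => ε * ((e : ℝ) + (-1 : ℝ) * u'' 1 z),
      Comb.smul ((Comb.const hu''.zero_eq (hmax 0 (by omega)) e).add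
        ((Comb.single (l := 1) (by omega) le_rfl).smul (-1))) ε, fun z hz => ?_⟩, ?_⟩
  · rw [sum_consIndex _ _ _ _ hn'0, hsum, Finset.sum_range_succ' n (m + 1)]
  · have := hinv z hz
    beta_reduce
    rw [huj, hτ1]
    push_cast at this ⊢
    linear_combination (-1 : ℂ) * this - (cT ρ (fun _ => 1) z *
      ((ρ.real univ : ℂ)⁻¹ * z + e - cT τ (fun _ => 1) z)) * hε2
  · intro k hk1 hk
    by_cases hkj : k = j + 1
    · subst hkj
      exact ⟨_, Comb.const hu''.zero_eq le_rfl 1, fun z _ => by simp⟩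
    rcases k with _ | _ | k
    · omega
    · obtain ⟨G, hG, hG'⟩ := lift (hmax 1 (by omega)) hg0
      have hn10 : n 1 ≤ n 0 := hn1.resolve_right (by omega)
      refine ⟨fun z => G z + ((A * ρ.real univ : ℝ) : ℂ) * ((-e : ℝ) + u'' 1 z),
        hG.add (((Comb.const hu''.zero_eq (hmax 1 (by omega)) (-e)).add
          (Comb.single (l := 1) (by omega) hn10)).smul _), fun z hz => ?_⟩
      have h1 : u 1 z = cT μ (fun x => v j x * (A * x + g0 x)) z := by
        rw [huk 0 (by omega), hv.zero_eq]
        refine hμ.cT_congr (fun x hx => ?_) z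
        have := hg0' x (ofReal_mem_Off_of_disjoint hd.symm hx)
        simpa using this
      have h4 := hinv z hz
      push_cast at h4
      have h6 := mul_inv_cancel₀ hmass
      beta_reduce
      rw [h1, hρμ, hρ.cT_affine (hg0.continuousOn hd.symm hv') hz, hG' z hz, huj, hτ1]
      push_cast
      linear_combination (ε * A * ρ.real univ : ℂ) * h4 -
        ε * A * z * (cT ρ (fun _ => 1) z) * h6
    · obtain ⟨g, hg, hg'⟩ := hrow (k + 1) (by omega) (by omega)
      obtain ⟨G, hG, hG'⟩ := lift (hmax (k + 1 + 1) (by omega)) hg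
      refine ⟨G, hG, fun z hz => ?_⟩
      rw [huj, mul_assoc, ← hG' z hz, ← hρμ, huk (k + 1) (by omega)]
      exact hμ.cT_congr (fun x hx => hg' x (ofReal_mem_Off_of_disjoint hd.symm hx)) z

theorem NS.tendsto_zero {m : ℕ} {a b : ℝ} {u : ℕ → ℂ → ℂ} (hu : NS m a b u) {l : ℕ}
    (h1 : 1 ≤ l) (hl : l ≤ m) : Tendsto (u l) (cobounded ℂ) (𝓝 0) := by
  rcases m with _ | m
  · omega
  rcases l with _ | l
  · omega
  obtain ⟨-, μ, c, d, v, hμ, hd, hv, huk⟩ := hu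
  rw [huk l (by omega)]
  exact hμ.cT_tendsto_zero ((hv.nice l (by omega)).continuousOn_Icc hd.symm)

/-- The constant coefficient of a linear combination is its limit at infinity. -/
theorem tendsto_comb {m : ℕ} {a b : ℝ} {u : ℕ → ℂ → ℂ} (hu : NS m a b u) {f : ℂ → ℂ} {r : ℕ → ℝ}
    (hf : ∀ z ∈ Off a b, f z = ∑ l ∈ Finset.range (m + 1), (r l : ℂ) * u l z) :
    Tendsto f (cobounded ℂ) (𝓝 (r 0 : ℂ)) := by
  have h1 : Tendsto (fun z => ∑ l ∈ Finset.range (m + 1), (r l : ℂ) * u l z) (cobounded ℂ)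
      (𝓝 (∑ l ∈ Finset.range (m + 1), (r l : ℂ) * (if l = 0 then 1 else 0))) := by
    refine tendsto_finsetSum _ fun l hl => Tendsto.const_mul _ ?_
    rw [Finset.mem_range] at hl
    rcases l with _ | l
    · rw [hu.zero_eq]; simp
    · simpa using hu.tendsto_zero (l := l + 1) (by omega) (by omega)
  simp only [mul_ite, mul_one, mul_zero, Finset.sum_ite_eq', Finset.mem_range, Nat.succ_pos,
    if_true] at h1
  exact h1.congr' (by filter_upwards [eventually_Off a b] with z hz using (hf z hz).symm)

/-- The step where the first tail exponent dominates: invert the first generator, move the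
index inside the tail, and invert again. -/
theorem moves_exchange {m : ℕ} {a b : ℝ} {u : ℕ → ℂ → ℂ} (hu : NS (m + 1) a b u)
    {n : ℕ → ℕ} {j : ℕ} (hj1 : 1 ≤ j) (hj : j ≤ m) (hmax : ∀ k ≤ m + 1, n k ≤ n (j + 1))
    (hn1 : n 0 ≤ n 1)
    (ih : ∀ {a b : ℝ} {u : ℕ → ℂ → ℂ}, NS m a b u →
      ∀ {n : ℕ → ℕ} {j : ℕ}, j ≤ m → (∀ k ≤ m, n k ≤ n j) → Moves m a b u n j) :
    Moves (m + 1) a b u n (j + 1) := by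
  obtain ⟨hu0, μ, c, d, v, hμ, hd, hv, huk⟩ := hu
  obtain ⟨τ, e, hτ, hinv⟩ := exists_inverse_of_zero hμ
  have hinv' : ∀ z ∈ Off a b, ((0 : ℝ) + cT μ (fun _ => 1) z) *
      (((μ.real univ)⁻¹ : ℝ) * z + e - cT τ (fun _ => 1) z) = 1 := by simpa using hinv
  obtain ⟨v', ε, mass, hε, hv', hsw⟩ := swap hμ hτ hinv' hv hd
  have hε2 := sq_eq_one_of_sign hε
  set nt : ℕ → ℕ := fun k => if k = 0 then n 0 else n (k + 1) with hnt
  have hntj : nt j = n (j + 1) := by simp [hnt]; omega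
  have hnt0 : nt 0 = n 0 := by simp [hnt]
  have hntk : ∀ k, 1 ≤ k → nt k = n (k + 1) := fun k hk => by simp [hnt]; omega
  obtain ⟨v'', n', A, hv'', hn'0, hsum, hle, ⟨g0, hg0, hg0'⟩, hrow⟩ :=
    ih hv' (n := nt) hj fun k hk => by
      rw [hntj]
      by_cases h0 : k = 0
      · rw [h0, hnt0]; exact hmax 0 (by omega)
      · rw [hntk k (by omega)]; exact hmax (k + 1) (by omega)
  rw [hntj] at hn'0 hle
  rw [hnt0] at hg0
  obtain ⟨ρ, εv, hεv, hρ, hρC, -⟩ := hτ.exists_signed_dens (hv'.nice j hj) hd.symm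
  have hεv2 := sq_eq_one_of_sign hεv
  have hρτ : ∀ (g : ℝ → ℂ) z, cT τ (fun x => v' j x * g x) z = εv * cT ρ g z := by
    intro g z
    rw [hρC, ← mul_assoc, hεv2, one_mul]
  have hρτ1 : ∀ z, cT τ (fun x => v' j x) z = εv * cT ρ (fun _ => 1) z := by
    intro z
    rw [← hρτ]; simp
  have hAm : (A : ℂ) * mass j = 1 := by
    obtain ⟨r, -, hr⟩ := hg0
    have t1 := ((hsw j hj1 hj).1.const_mul (A : ℂ)).add
      ((hv'.tendsto_zero hj1 hj).mul (tendsto_comb hv'' hr))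
    rw [zero_mul, add_zero] at t1
    refine tendsto_nhds_unique t1 (tendsto_const_nhds.congr' ?_)
    filter_upwards [eventually_Off c d] with z hz
    rw [hg0' z hz]; ring
  have hmassj : mass j ≠ 0 := fun h0 => by rw [h0] at hAm; simp at hAm
  set s : ℝ := (μ.real univ)⁻¹ with hs
  have hs0 : s ≠ 0 := inv_ne_zero hμ.mass_pos.ne'
  set κ : ℝ := -(εv * s * mass j) with hκ
  have hκ0 : κ ≠ 0 := by
    refine neg_ne_zero.2 (mul_ne_zero (mul_ne_zero ?_ hs0) hmassj)
    rcases hεv with h | h <;> rw [h] <;> norm_num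
  have huj : ∀ z ∈ Off a b, u (j + 1) z =
      cT μ (fun _ => 1) z * (ε * εv) * (κ + cT ρ (fun _ => 1) z) := by
    intro z hz
    rw [huk j hj, (hsw j hj1 hj).2 z hz, hρτ1, hκ]
    push_cast
    linear_combination (cT μ (fun _ => 1) z * ε * s * mass j) * hεv2
  have hujne : ∀ z ∈ Off a b, (κ : ℂ) + cT ρ (fun _ => 1) z ≠ 0 := by
    intro z hz h0
    have hN : Nice (u (j + 1)) a b := by
      rw [huk j hj]; exact hμ.cT_nice (hv.nice j hj) hd.symm
    apply hN.ne z hz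
    rw [huj z hz, h0, mul_zero]
  obtain ⟨ω, e2, hω, hinv2⟩ := exists_inverse_of_ne_zero hρ hκ0
    fun x hx => hujne x (ofReal_mem_Off.2 hx)
  have hinv2' : ∀ z ∈ Off a b, (κ + cT ρ (fun _ => 1) z) *
      ((0 : ℝ) * z + e2 - cT ω (fun _ => 1) z) = 1 := by simpa using hinv2
  obtain ⟨w, ε', mass', -, hw, hsw'⟩ := swap hρ hω hinv2' hv'' hd
  obtain ⟨u'', hu'', hu''k⟩ := NS.cons hω hd hw
  have hω1 : ∀ z, u'' 1 z = cT ω (fun _ => 1) z := by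
    intro z; rw [hu''k 0, hw.zero_eq]
  have lift : ∀ {N : ℕ} {r : ℕ → ℝ}, N ≤ n (j + 1) → (∀ l ≤ m, r l ≠ 0 → N ≤ n' l) →
      ∃ G, Comb (m + 1) a b (consIndex (n (j + 1)) (n 1) n') u'' N G ∧ ∀ z ∈ Off a b,
        r 0 * κ + cT ρ (fun x => ∑ l ∈ Finset.range (m + 1), (r l : ℂ) * v'' l x) z =
          (κ + cT ρ (fun _ => 1) z) * G z := fun hN hr =>
    comb_lift (n'' := consIndex (n (j + 1)) (n 1) n') hρ hd hv''
      (fun l h1 h2 => (hsw' l h1 h2).2) hu''.zero_eq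
      (fun l _ => hu''k l) (fun l h1 _ => consIndex_of_pos _ _ _ h1) hN hr
  refine ⟨u'', consIndex (n (j + 1)) (n 1) n', -(ε * A), hu'', rfl, ?_,
    consIndex_le le_rfl (hmax 1 (by omega)) hle, ?_, ?_⟩
  · rw [sum_consIndex _ _ _ _ hn'0, hsum, Finset.sum_range_succ' n (m + 1),
      Finset.sum_range_succ' nt m, Finset.sum_range_succ' _ m, hnt0,
      Finset.sum_congr rfl fun k _ => hntk (k + 1) (by omega)]
    ring
  · have hgc := hg0.continuousOn hd.symm hv''
    obtain ⟨r, hr, hr'⟩ := hg0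
    obtain ⟨G, hG, hG'⟩ := lift (hmax 0 (by omega)) hr
    have hn1' : n 0 ≤ consIndex (n (j + 1)) (n 1) n' 1 := hn1
    set B : ℝ := e + εv * (A * ρ.real univ + κ * r 0) with hB
    refine ⟨fun z => ((ε * εv * B : ℝ) : ℂ) * ((e2 : ℝ) + (-1 : ℝ) * u'' 1 z) +
      ((-ε : ℝ) : ℂ) * G z, (((Comb.const hu''.zero_eq (hmax 0 (by omega)) e2).add
        ((Comb.single (l := 1) (by omega) hn1').smul (-1))).smul _).add (hG.smul _),
      fun z hz => ?_⟩
    have h1 : cT τ (fun _ => 1) z = cT τ (fun x => v' j x * (A * x + g0 x)) z :=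
      hτ.cT_congr (fun x hx => hg0' x (ofReal_mem_Off_of_disjoint hd.symm hx)) z
    have h2 : cT ρ (fun x => g0 x) z = (κ + cT ρ (fun _ => 1) z) * G z - r 0 * κ := by
      rw [← hG' z hz, add_sub_cancel_left]
      exact hρ.cT_congr (fun x hx => hr' x (ofReal_mem_Off_of_disjoint hd.symm hx)) z
    rw [hρτ, hρ.cT_affine hgc hz, h2] at h1
    have h3 := hinv z hz
    have h4 := hinv2 z hz
    have hκc : (κ : ℂ) = -(εv * s * mass j) := by rw [hκ]; push_cast; ring
    beta_reduce
    rw [huj z hz, hω1, hB]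
    push_cast
    set M := cT μ (fun _ => 1) z
    set R := cT ρ (fun _ => 1) z
    set Ω := cT ω (fun _ => 1) z
    rw [h1] at h3
    set P : ℂ := ((ρ.real univ : ℝ) : ℂ)
    have hsA : (s : ℂ) + εv * A * κ = 0 := by
      rw [hκc]
      linear_combination (-(s : ℂ) * A * mass j) * hεv2 - (s : ℂ) * hAm
    set B' : ℂ := e + εv * (A * P + κ * r 0)
    linear_combination -h3 + M * z * hsA - M * B' * ((κ + R) * (e2 - Ω)) * hεv2 - M * B' * h4 -
      (-M * εv * (κ + R) * (A * z + G z) + M * εv * εv * B' * ((κ + R) * (e2 - Ω))) * hε2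
  · intro k hk1 hk
    by_cases hkj : k = j + 1
    · subst hkj
      exact ⟨_, Comb.const hu''.zero_eq le_rfl 1, fun z _ => by simp⟩
    rcases k with _ | _ | k
    · omega
    · refine ⟨fun z => ((ε * εv : ℝ) : ℂ) * ((e2 : ℝ) + (-1 : ℝ) * u'' 1 z),
        ((Comb.const hu''.zero_eq (hmax 1 (by omega)) e2).add
        ((Comb.single (l := 1) (by omega) le_rfl).smul (-1))).smul _, fun z hz => ?_⟩
      have h4 := hinv2 z hz
      beta_reduce
      rw [huj z hz, hω1, huk 0 (by omega), hv.zero_eq]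
      push_cast
      set M := cT μ (fun _ => 1) z
      linear_combination (-M * (ε * ε) * (εv * εv)) * h4 - M * hε2 - M * (ε * ε) * hεv2
    · obtain ⟨g, ⟨r, hr, hr'⟩, hg'⟩ := hrow (k + 1) (by omega) (by omega)
      rw [hntk (k + 1) (by omega)] at hr
      obtain ⟨G, hG, hG'⟩ := lift (hmax (k + 1 + 1) (by omega)) hr
      refine ⟨G, hG, fun z hz => ?_⟩
      have hmk : (mass (k + 1) : ℂ) = mass j * r 0 := by
        refine tendsto_nhds_unique (hsw (k + 1) (by omega) (by omega)).1
          (((hsw j hj1 hj).1.mul (tendsto_comb hv'' hr')).congr' ?_)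
        filter_upwards [eventually_Off c d] with z hz
        rw [hg' z hz, mul_assoc]
      have h1 : cT τ (fun x => v' (k + 1) x) z = εv * cT ρ (fun x => g x) z := by
        rw [← hρτ]
        exact hτ.cT_congr (fun x hx => hg' x (ofReal_mem_Off_of_disjoint hd.symm hx)) z
      have h2 : cT ρ (fun x => g x) z = (κ + cT ρ (fun _ => 1) z) * G z - r 0 * κ := by
        rw [← hG' z hz, add_sub_cancel_left]
        exact hρ.cT_congr (fun x hx => hr' x (ofReal_mem_Off_of_disjoint hd.symm hx)) z
      have hκc : (κ : ℂ) = -(εv * s * mass j) := by rw [hκ]; push_cast; ring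
      rw [huj z hz, huk (k + 1) (by omega), (hsw (k + 1) (by omega) (by omega)).2 z hz, h1, h2, hmk]
      push_cast
      rw [zero_add]
      set M := cT μ (fun _ => 1) z
      linear_combination (-M * ε * εv * r 0) * hκc + (M * ε * s * mass j * r 0) * hεv2

theorem NS.moves {m : ℕ} : ∀ {a b : ℝ} {u : ℕ → ℂ → ℂ}, NS m a b u →
    ∀ {n : ℕ → ℕ} {j : ℕ}, j ≤ m → (∀ k ≤ m, n k ≤ n j) → Moves m a b u n j := by
  induction m with
  | zero =>
    intro a b u hu n j hj hmax
    rw [Nat.le_zero.1 hj] at hmax ⊢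
    exact moves_zero hu hmax
  | succ m ih =>
    intro a b u hu n j hj hmax
    rcases j with _ | j
    · exact moves_zero hu hmax
    · by_cases h : n 1 ≤ n 0 ∨ j = 0
      · exact moves_direct hu (by omega) hmax h ih
      · push Not at h
        exact moves_exchange hu (by omega) (by omega) hmax h.1.le ih

/-- The linear form `∑ p_k u_k`. -/
def lf (m : ℕ) (p : ℕ → ℝ[X]) (u : ℕ → ℂ → ℂ) (z : ℂ) : ℂ :=
  ∑ k ∈ Finset.range (m + 1), aeval z (p k) * u k z

theorem eval_map_ofReal (p : ℝ[X]) (z : ℂ) :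
    (p.map (algebraMap ℝ ℂ)).eval z = aeval z p := eval_map_algebraMap p z

theorem aeval_ofReal_eq (p : ℝ[X]) (x : ℝ) : aeval (x : ℂ) p = ((p.eval x : ℝ) : ℂ) :=
  aeval_algebraMap_apply_eq_algebraMap_eval x p

theorem eventually_aeval_ne_zero {W : ℝ[X]} (hW : W ≠ 0) :
    ∀ᶠ z in cobounded ℂ, aeval z W ≠ 0 := by
  have hf : {z : ℂ | aeval z W = 0}.Finite := by
    refine ((W.map (algebraMap ℝ ℂ)).roots.toFinset.finite_toSet).subset fun z hz => ?_
    have h0 : W.map (algebraMap ℝ ℂ) ≠ 0 := (Polynomial.map_ne_zero_iff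
      (algebraMap ℝ ℂ).injective).2 hW
    simpa [h0, eval_map_ofReal] using hz
  filter_upwards [Bornology.isBounded_def.1 hf.isBounded] with z hz h
  exact hz h

section
variable {m : ℕ} {a b c d : ℝ} {u : ℕ → ℂ → ℂ}

theorem NS.lf_differentiableOn (hu : NS m a b u) (p : ℕ → ℝ[X]) :
    DifferentiableOn ℂ (lf m p u) (Off a b) := by
  unfold lf
  refine DifferentiableOn.fun_sum fun k hk => ?_
  rw [Finset.mem_range] at hk
  refine DifferentiableOn.fun_mul ?_ (hu.nice k (by omega)).diff
  simp only [← eval_map_ofReal]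
  exact (Polynomial.differentiable _).differentiableOn

theorem NS.lf_conj (hu : NS m a b u) (p : ℕ → ℝ[X]) {z : ℂ} (hz : z ∈ Off a b) :
    lf m p u ((starRingEnd ℂ) z) = (starRingEnd ℂ) (lf m p u z) := by
  unfold lf
  rw [map_sum]
  refine Finset.sum_congr rfl fun k hk => ?_
  rw [Finset.mem_range] at hk
  rw [(hu.nice k (by omega)).conj z hz, map_mul, Polynomial.aeval_conj]

theorem NS.lf_re (hu : NS m a b u) (p : ℕ → ℝ[X]) {x : ℝ} (hx : (x : ℂ) ∈ Off a b) :
    (((lf m p u x).re : ℝ) : ℂ) = lf m p u x := by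
  have h1 := hu.lf_conj p hx
  rw [Complex.conj_ofReal] at h1
  exact exists_real_of_im (Complex.conj_eq_iff_im.1 h1.symm)

theorem NS.lf_continuousOn (hu : NS m c d u) (p : ℕ → ℝ[X])
    (hd : Disjoint (Icc a b) (Icc c d)) :
    ContinuousOn (fun x : ℝ => lf m p u x) (Icc a b) :=
  continuousOn_ofReal_comp hd.symm (hu.lf_differentiableOn p).continuousOn

/-- The linear form is a Cauchy transform plus a polynomial. -/
theorem lf_succ {μ : Measure ℝ} {v : ℕ → ℂ → ℂ} (hμ : Gen μ a b)
    (hd : Disjoint (Icc a b) (Icc c d)) (hv : NS m c d v) (hu0 : u 0 = fun _ => 1)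
    (hu : ∀ k ≤ m, u (k + 1) = cT μ fun x => v k x) (p : ℕ → ℝ[X]) :
    ∃ E : ℂ[X], ∀ z ∈ Off a b,
      lf (m + 1) p u z = cT μ (fun x => lf m (fun k => p (k + 1)) v x) z + E.eval z := by
  have hc : ∀ k ∈ Finset.range (m + 1), ContinuousOn (fun x : ℝ => v k x) (Icc a b) :=
    fun k hk => (hv.nice k (by rw [Finset.mem_range] at hk; omega)).continuousOn_Icc hd.symm
  have h1 : ∀ k, ∃ D : ℂ[X], k ∈ Finset.range (m + 1) → ∀ z ∈ Off a b,
      aeval z (p (k + 1)) * u (k + 1) z =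
        cT μ (fun x => aeval (x : ℂ) (p (k + 1)) * v k x) z + D.eval z := by
    intro k
    by_cases hk : k ∈ Finset.range (m + 1)
    · obtain ⟨D, hD⟩ := hμ.poly_mul_cT (hc k hk) ((p (k + 1)).map (algebraMap ℝ ℂ))
      refine ⟨D, fun _ z hz => ?_⟩
      have := hD z hz
      simp only [eval_map_ofReal] at this
      rwa [hu k (by rw [Finset.mem_range] at hk; omega)]
    · exact ⟨0, fun h => absurd h hk⟩
  choose D hD using h1
  refine ⟨(p 0).map (algebraMap ℝ ℂ) + ∑ k ∈ Finset.range (m + 1), D k, fun z hz => ?_⟩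
  have hc2 : ∀ k ∈ Finset.range (m + 1),
      ContinuousOn (fun x : ℝ => aeval (x : ℂ) (p (k + 1)) * v k x) (Icc a b) := by
    intro k hk
    have h2 := hc k hk
    have h3 : ContinuousOn (fun x : ℝ => aeval (x : ℂ) (p (k + 1))) (Icc a b) := by
      simp only [aeval_ofReal_eq]; fun_prop
    exact h3.mul h2
  unfold lf
  rw [Finset.sum_range_succ', hμ.cT_sum _ hc2 hz, Finset.sum_congr rfl fun k hk => hD k hk z hz,
    Finset.sum_add_distrib, hu0, eval_add, eval_map_ofReal, eval_finsetSum]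
  ring

end

/-- A linear form of total degree bound `N` divisible by a polynomial of degree at least `N`
vanishes. -/
def IsAT (m : ℕ) : Prop :=
  ∀ {a b : ℝ} {u : ℕ → ℂ → ℂ}, NS m a b u → ∀ {n : ℕ → ℕ} {p : ℕ → ℝ[X]},
    (∀ k ≤ m, (p k).degree < n k) → ∀ {W : ℝ[X]}, W ≠ 0 → (∀ x ∈ Icc a b, W.eval x ≠ 0) →
    ∑ k ∈ Finset.range (m + 1), n k ≤ W.natDegree → ∀ {G : ℂ → ℂ}, ContinuousOn G (Off a b) →
    (∀ z ∈ Off a b, lf m p u z = aeval z W * G z) → ∀ z ∈ Off a b, lf m p u z = 0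

theorem aeval_root_mem_Off {W : ℝ[X]} {a b : ℝ} (hW : ∀ x ∈ Icc a b, W.eval x ≠ 0) {z : ℂ}
    (hz : aeval z W = 0) : z ∈ Off a b := by
  by_cases hi : z.im = 0
  · rw [← exists_real_of_im hi] at hz ⊢
    refine ofReal_mem_Off.2 fun hx => hW _ hx ?_
    rw [aeval_ofReal_eq] at hz
    exact_mod_cast hz
  · exact mem_Off_of_im hi

theorem exists_quotient_real {W : ℝ[X]} (hW0 : W ≠ 0) {a b : ℝ}
    (hW : ∀ x ∈ Icc a b, W.eval x ≠ 0) {E : ℂ[X]} {H : ℂ → ℂ} (hH : ContinuousOn H (Off a b))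
    (hE : ∀ z ∈ Off a b, E.eval z = aeval z W * H z) :
    ∃ h : ℂ[X], ∀ z ∈ Off a b, aeval z W ≠ 0 → H z = h.eval z := by
  have h0 : W.map (algebraMap ℝ ℂ) ≠ 0 := (Polynomial.map_ne_zero_iff
    (algebraMap ℝ ℂ).injective).2 hW0
  obtain ⟨h, hh⟩ := exists_poly_quotient (isOpen_Off a b) _ (W.map (algebraMap ℝ ℂ)) E H rfl h0
    (fun z hz => aeval_root_mem_Off hW (by rwa [eval_map_ofReal] at hz)) hH
    (fun z hz => by rw [eval_map_ofReal]; exact hE z hz)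
  exact ⟨h, fun z hz hw => hh z hz (by rwa [eval_map_ofReal])⟩

theorem isAT_zero : IsAT 0 := by
  intro a b u hu n p hp W hW0 hW hn G hG hL z hz
  have hlf : ∀ z, lf 0 p u z = aeval z (p 0) := by intro z; simp [lf, hu.zero_eq]
  obtain ⟨h, hh⟩ := exists_quotient_real hW0 hW (E := (p 0).map (algebraMap ℝ ℂ)) hG
    fun z hz => by rw [eval_map_ofReal, ← hlf, hL z hz]
  have h1 : (p 0).map (algebraMap ℝ ℂ) - W.map (algebraMap ℝ ℂ) * h = 0 := by
    refine poly_tendsto_zero (tendsto_const_nhds.congr' ?_)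
    filter_upwards [eventually_Off a b, eventually_aeval_ne_zero hW0] with z hz hw
    rw [eval_sub, eval_mul, eval_map_ofReal, eval_map_ofReal, ← hh z hz hw, ← hL z hz, hlf, sub_self]
  have h2 : W.map (algebraMap ℝ ℂ) ∣ (p 0).map (algebraMap ℝ ℂ) := ⟨h, sub_eq_zero.1 h1⟩
  have h3 := (Polynomial.map_dvd_map' _).1 h2
  have h4 : p 0 = 0 := by
    refine Polynomial.eq_zero_of_dvd_of_degree_lt h3 ((hp 0 le_rfl).trans_le ?_)
    rw [degree_eq_natDegree hW0]
    exact_mod_cast by simpa using hn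
  rw [hlf, h4, map_zero]

/-- A form orthogonal to all polynomials of degree less than `N` has `N` zeros, so vanishes. -/
theorem IsAT.eq_zero_of_orth {m : ℕ} (hAT : IsAT m) {μ : Measure ℝ} {a b c d : ℝ}
    {v : ℕ → ℂ → ℂ} (hμ : Gen μ a b) (hd : Disjoint (Icc a b) (Icc c d)) (hv : NS m c d v)
    {n : ℕ → ℕ} {p : ℕ → ℝ[X]} (hp : ∀ k ≤ m, (p k).degree < n k) {N : ℕ}
    (hN : ∑ k ∈ Finset.range (m + 1), n k ≤ N) {W : ℝ[X]} (hW : ∀ x ∈ Icc a b, W.eval x ≠ 0)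
    (horth : ∀ q : ℂ[X], q.degree < N →
      ∫ x : ℝ, q.eval (x : ℂ) * (lf m p v x / aeval (x : ℂ) W) ∂μ = 0) :
    ∀ z ∈ Off c d, lf m p v z = 0 := by
  have hre : ∀ x ∈ Icc a b, (((lf m p v x).re : ℝ) : ℂ) = lf m p v x := fun x hx =>
    hv.lf_re p (ofReal_mem_Off_of_disjoint hd.symm hx)
  obtain ⟨Z, hZ, hZc, hZ0⟩ := exists_zeros hμ (q := fun x => (lf m p v x).re)
    (Complex.continuous_re.comp_continuousOn (hv.lf_continuousOn p hd)) N fun S hS hSN => by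
      refine ⟨fun x => (W.eval x)⁻¹, ContinuousOn.inv₀ (by fun_prop) hW,
        fun x hx => inv_ne_zero (hW x hx), ?_⟩
      have h1 := horth (∏ s ∈ S, (X - C (s : ℂ))) (by
        rw [degree_prod_of_monic _ _ fun s _ => monic_X_sub_C _]
        simpa using hSN)
      rw [← Complex.ofReal_eq_zero, ← integral_complex_ofReal, ← h1]
      refine hμ.integral_congr fun x hx => ?_
      push_cast
      rw [hre x hx, eval_prod, aeval_ofReal_eq]
      simp only [eval_sub, eval_X, eval_C]
      rw [div_eq_mul_inv]
      ring
  have hout : ∀ s ∈ Z, s ∉ Icc c d := fun s hs h =>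
    disjoint_left.1 hd (Ioo_subset_Icc_self (hZ hs)) h
  obtain ⟨G, hG, hGe⟩ := exists_factor (isOpen_Off c d)
    (Z.map ⟨fun x : ℝ => (x : ℂ), Complex.ofReal_injective⟩) (hv.lf_differentiableOn p) (by
      intro x hx
      simp only [Finset.mem_map, Function.Embedding.coeFn_mk] at hx
      obtain ⟨s, hs, rfl⟩ := hx
      refine ⟨ofReal_mem_Off.2 (hout s hs), ?_⟩
      rw [← hre s (Ioo_subset_Icc_self (hZ hs)), hZ0 s hs, Complex.ofReal_zero])
  refine hAT hv hp (W := ∏ s ∈ Z, (X - C s)) (Finset.prod_ne_zero_iff.2 fun s _ => X_sub_C_ne_zero s)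
    (fun x hx => ?_) ?_ hG.continuousOn fun z hz => ?_
  · rw [eval_prod, Finset.prod_ne_zero_iff]
    intro s hs
    rw [eval_sub, eval_X, eval_C, sub_ne_zero]
    rintro rfl
    exact hout x hs hx
  · rw [natDegree_prod_of_monic _ _ fun s _ => monic_X_sub_C _]
    simpa [hZc] using hN
  · rw [hGe, map_prod, Finset.prod_map]
    simp

theorem NS.tendsto_ite {m : ℕ} {a b : ℝ} {u : ℕ → ℂ → ℂ} (hu : NS m a b u) {l : ℕ}
    (hl : l ≤ m) : Tendsto (u l) (cobounded ℂ) (𝓝 (if l = 0 then 1 else 0)) := by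
  rcases l with _ | l
  · rw [hu.zero_eq]; simp
  · simpa using hu.tendsto_zero (l := l + 1) (by omega) hl

theorem IsAT.succ_of_dominant {m : ℕ} (hAT : IsAT m) {a b : ℝ} {u : ℕ → ℂ → ℂ}
    (hu : NS (m + 1) a b u) {n : ℕ → ℕ} (hmax : ∀ k ≤ m + 1, n k ≤ n 0) {p : ℕ → ℝ[X]}
    (hp : ∀ k ≤ m + 1, (p k).degree < n k) {W : ℝ[X]} (hW0 : W ≠ 0)
    (hW : ∀ x ∈ Icc a b, W.eval x ≠ 0)
    (hn : ∑ k ∈ Finset.range (m + 1 + 1), n k ≤ W.natDegree) {G : ℂ → ℂ}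
    (hG : ContinuousOn G (Off a b)) (hL : ∀ z ∈ Off a b, lf (m + 1) p u z = aeval z W * G z) :
    ∀ z ∈ Off a b, lf (m + 1) p u z = 0 := by
  have hu' := hu
  obtain ⟨hu0, μ, c, d, v, hμ, hd, hv, huk⟩ := hu
  rw [Finset.sum_range_succ'] at hn
  obtain ⟨N, hN⟩ := Nat.exists_eq_add_of_le (le_trans (Nat.le_add_left _ _) hn)
  obtain ⟨E, hE⟩ := lf_succ hμ hd hv hu0 huk p
  have hQ := hv.lf_continuousOn (a := a) (b := b) (fun k => p (k + 1)) hd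
  have hWc : ∀ x ∈ Icc a b, aeval (x : ℂ) W ≠ 0 := fun x hx => by
    rw [aeval_ofReal_eq]; exact_mod_cast hW x hx
  have hQW : ContinuousOn (fun x : ℝ => lf m (fun k => p (k + 1)) v x / aeval (x : ℂ) W)
      (Icc a b) := by
    have h3 : ContinuousOn (fun x : ℝ => aeval (x : ℂ) W) (Icc a b) := by
      simp only [aeval_ofReal_eq]; fun_prop
    exact hQ.div h3 hWc
  obtain ⟨D, hD⟩ := hμ.poly_mul_cT hQW (W.map (algebraMap ℝ ℂ))
  have hD' : ∀ z ∈ Off a b, (E - D).eval z = aeval z W * (G z -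
      cT μ (fun x => lf m (fun k => p (k + 1)) v x / aeval (x : ℂ) W) z) := by
    intro z hz
    have h1 := hD z hz
    have h2 : cT μ (fun x : ℝ => (W.map (algebraMap ℝ ℂ)).eval (x : ℂ) *
        (lf m (fun k => p (k + 1)) v x / aeval (x : ℂ) W)) z =
        cT μ (fun x => lf m (fun k => p (k + 1)) v x) z :=
      hμ.cT_congr (fun x hx => by
        rw [eval_map_ofReal, mul_div_cancel₀ _ (hWc x hx)]) z
    rw [h2, eval_map_ofReal] at h1
    rw [mul_sub, h1, ← hL z hz, hE z hz, eval_sub]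
    ring
  have hH : ContinuousOn (fun z => G z -
      cT μ (fun x => lf m (fun k => p (k + 1)) v x / aeval (x : ℂ) W) z) (Off a b) :=
    hG.sub (hμ.cT_continuousOn hQW)
  obtain ⟨h, hh⟩ := exists_quotient_real hW0 hW hH hD'
  have ht : Tendsto (fun z => z ^ N * (cT μ (fun x => lf m (fun k => p (k + 1)) v x /
      aeval (x : ℂ) W) z + h.eval z)) (cobounded ℂ) (𝓝 0) := by
    have h1 : Tendsto (fun z => ∑ k ∈ Finset.range (m + 1 + 1),
        (((X ^ N * p k).map (algebraMap ℝ ℂ)).eval z / (W.map (algebraMap ℝ ℂ)).eval z) * u k z)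
        (cobounded ℂ) (𝓝 (∑ k ∈ Finset.range (m + 1 + 1), 0 * (if k = 0 then 1 else 0))) := by
      refine tendsto_finsetSum _ fun k hk => ?_
      rw [Finset.mem_range] at hk
      refine (poly_div_tendsto_zero ?_).mul (hu'.tendsto_ite (by omega))
      rw [degree_map, degree_map, degree_mul, degree_pow, degree_X, degree_eq_natDegree hW0, hN]
      have h2 : (p k).degree < n 0 := (hp k (by omega)).trans_le (by
        exact_mod_cast hmax k (by omega))
      push_cast
      rw [add_comm (n 0 : WithBot ℕ), nsmul_one]
      exact WithBot.add_lt_add_left (WithBot.natCast_ne_bot N) h2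
    simp only [zero_mul, Finset.sum_const_zero] at h1
    refine h1.congr' ?_
    filter_upwards [eventually_Off a b, eventually_aeval_ne_zero hW0] with z hz hw
    rw [← hh z hz hw, add_sub_cancel, eq_div_of_mul_eq hw ((mul_comm _ _).trans (hL z hz).symm), lf,
      mul_div_assoc', Finset.mul_sum, Finset.sum_div]
    refine Finset.sum_congr rfl fun k _ => ?_
    rw [eval_map_ofReal, eval_map_ofReal, map_mul, map_pow, aeval_X]
    ring
  obtain ⟨rfl, horth⟩ := hμ.poly_part_zero N hQW h ht
  have hQ0 := hAT.eq_zero_of_orth hμ hd hv (n := fun k => n (k + 1)) (N := N)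
    (fun k hk => hp (k + 1) (by omega)) (by omega) hW horth
  have hz0 : ∀ (g : ℂ → ℂ) z, cT μ (fun x => lf m (fun k => p (k + 1)) v x * g x) z = 0 := by
    intro g z
    rw [hμ.cT_congr (g' := fun _ => 0) (fun x hx => by
      beta_reduce
      rw [hQ0 x (ofReal_mem_Off_of_disjoint hd.symm hx), zero_mul]) z]
    simp [cT]
  have hz1 : ∀ z, cT μ (fun x => lf m (fun k => p (k + 1)) v x) z = 0 := by
    intro z; simpa using hz0 (fun _ => 1) z
  have hE0 : E = 0 := by
    refine poly_tendsto_zero (tendsto_const_nhds.congr' ?_)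
    filter_upwards [eventually_Off a b, eventually_aeval_ne_zero hW0] with z hz hw
    have h1 := hh z hz hw
    have h2 := hz0 (fun z => (aeval z W)⁻¹) z
    simp only [← div_eq_mul_inv] at h2
    rw [eval_zero, h2, sub_zero] at h1
    have h3 := hE z hz
    rw [hL z hz, h1, hz1] at h3
    simpa using h3
  intro z hz
  rw [hE z hz, hz1, hE0]
  simp

theorem isAT (m : ℕ) : IsAT m := by
  induction m with
  | zero => exact isAT_zero
  | succ m ih =>
    intro a b u hu n p hp W hW0 hW hn G hG hL
    obtain ⟨j, hj, hmax⟩ := Finset.exists_max_image (Finset.range (m + 1 + 1)) n ⟨0, by simp⟩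
    simp only [Finset.mem_range, Nat.lt_succ_iff] at hj hmax
    by_cases hlt : n 0 < n j
    swap
    · exact ih.succ_of_dominant hu (fun k hk => (hmax k hk).trans (not_lt.1 hlt)) hp hW0 hW hn hG hL
    obtain ⟨u', n', A, hu', hn'0, hsum, hle, ⟨g0, ⟨r0, hr0, hg0⟩, hg0'⟩, hrow⟩ := hu.moves hj hmax
    have hr : ∀ k, ∃ r : ℕ → ℝ, k ≤ m + 1 → (∀ l ≤ m + 1, r l ≠ 0 → n k ≤ n' l) ∧
        ∀ z ∈ Off a b, u k z = u j z * ((if k = 0 then (A : ℂ) * z else 0) +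
          ∑ l ∈ Finset.range (m + 1 + 1), (r l : ℂ) * u' l z) := by
      intro k
      by_cases hk : k ≤ m + 1
      · by_cases hk0 : k = 0
        · subst hk0
          refine ⟨r0, fun _ => ⟨hr0, fun z hz => ?_⟩⟩
          rw [hu.zero_eq, if_pos rfl, ← hg0 z hz]
          exact hg0' z hz
        · obtain ⟨g, ⟨r, hr, hg⟩, hg'⟩ := hrow k (by omega) hk
          refine ⟨r, fun _ => ⟨hr, fun z hz => ?_⟩⟩
          rw [if_neg hk0, zero_add, ← hg z hz]
          exact hg' z hz
      · exact ⟨0, fun h => absurd h hk⟩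
    choose r hr using hr
    set p' : ℕ → ℝ[X] := fun l => ∑ k ∈ Finset.range (m + 1 + 1), r k l • p k +
      if l = 0 then A • (X * p 0) else 0 with hp'
    have hdeg : ∀ l ≤ m + 1, (p' l).degree < n' l := by
      intro l hl
      rw [← mem_degreeLT]
      refine Submodule.add_mem _ (Submodule.sum_mem _ fun k hk => ?_) ?_
      · rw [Finset.mem_range, Nat.lt_succ_iff] at hk
        by_cases h0 : r k l = 0
        · simp [h0]
        · refine Submodule.smul_mem _ _ (mem_degreeLT.2 ((hp k hk).trans_le ?_))
          exact_mod_cast (hr k hk).1 l hl h0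
      · split_ifs with h0
        · subst h0
          refine Submodule.smul_mem _ _ (mem_degreeLT.2 ?_)
          rw [hn'0, mul_comm, degree_mul, degree_X]
          have h1 : (p 0).degree + 1 < (n 0 : WithBot ℕ) + 1 :=
            WithBot.add_lt_add_right (by simp) (hp 0 (by omega))
          exact h1.trans_le (by exact_mod_cast hlt)
        · exact Submodule.zero_mem _
    have hfac : ∀ z ∈ Off a b, lf (m + 1) p u z = u j z * lf (m + 1) p' u' z := by
      intro z hz
      have e1 : lf (m + 1) p u z = ∑ k ∈ Finset.range (m + 1 + 1), (u j z * (aeval z (p k) *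
          (if k = 0 then (A : ℂ) * z else 0)) + u j z * ∑ l ∈ Finset.range (m + 1 + 1),
            (r k l : ℂ) * aeval z (p k) * u' l z) := by
        refine Finset.sum_congr rfl fun k hk => ?_
        rw [Finset.mem_range, Nat.lt_succ_iff] at hk
        rw [(hr k hk).2 z hz, mul_add, mul_add, Finset.mul_sum, Finset.mul_sum, Finset.mul_sum]
        congr 1
        · ring
        · exact Finset.sum_congr rfl fun l _ => by ring
      have e2 : lf (m + 1) p' u' z = ∑ l ∈ Finset.range (m + 1 + 1),
          (∑ k ∈ Finset.range (m + 1 + 1), (r k l : ℂ) * aeval z (p k) * u' l z +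
            (if l = 0 then (A : ℂ) * (z * aeval z (p 0)) else 0) * u' l z) := by
        refine Finset.sum_congr rfl fun l _ => ?_
        rw [hp']
        simp only [map_add, map_sum, map_smul, Complex.real_smul, add_mul, Finset.sum_mul]
        congr 2
        split_ifs <;> simp
      rw [e1, e2, Finset.sum_add_distrib, Finset.sum_add_distrib, ← Finset.mul_sum,
        ← Finset.mul_sum, Finset.sum_comm]
      simp only [mul_ite, mul_zero, ite_mul, zero_mul, Finset.sum_ite_eq', Finset.mem_range,
        Nat.succ_pos, if_true, hu'.zero_eq]
      ring
    have hN := hu.nice j hj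
    have h0 := ih.succ_of_dominant hu' (fun k hk => hn'0 ▸ hle k hk) hdeg hW0 hW (hsum ▸ hn)
      (G := fun z => G z / u j z) (hG.div hN.diff.continuousOn hN.ne) (fun z hz => by
        rw [mul_div_assoc', ← hL z hz, hfac z hz, mul_div_cancel_left₀ _ (hN.ne z hz)])
    intro z hz
    rw [hfac z hz, h0 z hz, mul_zero]

/-- The functions of the system are linearly independent over the polynomials. -/
theorem NS.independent {m : ℕ} : ∀ {a b : ℝ} {u : ℕ → ℂ → ℂ}, NS m a b u → ∀ {p : ℕ → ℝ[X]},
    (∀ z ∈ Off a b, lf m p u z = 0) → ∀ k ≤ m, p k = 0 := by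
  have poly : ∀ {q : ℝ[X]} {a b : ℝ}, (∀ z ∈ Off a b, aeval z q = 0) → q = 0 := by
    intro q a b h
    have h1 : q.map (algebraMap ℝ ℂ) = 0 := by
      refine poly_tendsto_zero (tendsto_const_nhds.congr' ?_)
      filter_upwards [eventually_Off a b] with z hz
      rw [eval_map_ofReal, h z hz]
    exact (Polynomial.map_eq_zero_iff (algebraMap ℝ ℂ).injective).1 h1
  induction m with
  | zero =>
    intro a b u hu p h k hk
    rw [Nat.le_zero.1 hk]
    refine poly (a := a) (b := b) fun z hz => ?_
    simpa [lf, hu.zero_eq] using h z hz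
  | succ m ih =>
    intro a b u ⟨hu0, μ, c, d, v, hμ, hd, hv, huk⟩ p h
    obtain ⟨E, hE⟩ := lf_succ hμ hd hv hu0 huk p
    have horth : ∀ N : ℕ, ∀ q : ℂ[X], q.degree < N →
        ∫ x : ℝ, q.eval (x : ℂ) * (lf m (fun k => p (k + 1)) v x / aeval (x : ℂ) (1 : ℝ[X])) ∂μ
          = 0 := by
      intro N q hq
      simp only [map_one, div_one]
      refine (hμ.poly_part_zero N (hv.lf_continuousOn _ hd) E
        (tendsto_const_nhds.congr' ?_)).2 q hq
      filter_upwards [eventually_Off a b] with z hz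
      rw [← hE z hz, h z hz, mul_zero]
    have hQ := ih hv (IsAT.eq_zero_of_orth (isAT m) hμ hd hv
      (n := fun k => (p (k + 1)).natDegree + 1)
      (fun k _ => degree_le_natDegree.trans_lt (by exact_mod_cast Nat.lt_succ_self _)) le_rfl
      (fun x _ => by simp) (horth _))
    intro k hk
    rcases k with _ | k
    · refine poly (a := a) (b := b) fun z hz => ?_
      have h1 := h z hz
      rw [lf, Finset.sum_range_succ', Finset.sum_eq_zero fun k hk => by
        rw [Finset.mem_range] at hk; rw [hQ k (by omega), map_zero, zero_mul]] at h1
      simpa [hu0] using h1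
    · exact hQ k (by omega)

theorem msupport_eq (μ : Measure ℝ) : SignedM.msupport μ = μ.support := by
  ext x
  rw [Measure.support_eq_forall_isOpen]
  simp only [SignedM.msupport, mem_ofPred_eq, pos_iff_ne_zero]
  exact ⟨fun h U hx hU => h U hU hx, fun h U hU hx => h U hx hU⟩

theorem gen_of_support {μ : Measure ℝ} (hfin : IsFiniteMeasure μ) (hc : IsCompact μ.support)
    (hinf : μ.support.Infinite) : Gen μ (sInf μ.support) (sSup μ.support) where
  fin := hfin
  null := measure_mono_null (compl_subset_compl.2 fun _ hx =>
    ⟨csInf_le hc.bddBelow hx, le_csSup hc.bddAbove hx⟩) Measure.measure_compl_support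
  inf F h := by
    refine hinf (F.finite_toSet.subset ?_)
    refine Measure.support_subset_of_isClosed F.finite_toSet.isClosed ?_
    rwa [mem_ae_iff]

/-- `s` is the positive measure `μ` times the sign `ε`. -/
def Signed (s : SignedM) (μ : Measure ℝ) (ε : ℝ) : Prop :=
  (ε = 1 ∧ s.pos = μ ∧ s.neg = 0) ∨ (ε = -1 ∧ s.pos = 0 ∧ s.neg = μ)

theorem Signed.sign {s : SignedM} {μ : Measure ℝ} {ε : ℝ} (h : Signed s μ ε) :
    ε = 1 ∨ ε = -1 := h.imp (fun h => h.1) fun h => h.1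

theorem Signed.cintegral_eq {s : SignedM} {μ : Measure ℝ} {ε : ℝ} (h : Signed s μ ε)
    (f : ℝ → ℂ) : s.cintegral f = ε * ∫ x, f x ∂μ := by
  unfold SignedM.cintegral
  rcases h with ⟨rfl, h1, h2⟩ | ⟨rfl, h1, h2⟩ <;> rw [h1, h2] <;> simp

theorem _root_.IsM.exists_gen {s : SignedM} {Δ : Set ℝ} (h : IsM s Δ) :
    ∃ (μ : Measure ℝ) (ε a b : ℝ), Signed s μ ε ∧ Gen μ a b ∧ Δ = Icc a b := by
  have hs : s.supp = s.pos.support ∪ s.neg.support := by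
    rw [SignedM.supp, msupport_eq, msupport_eq]
  have hc := h.compactSupp
  have hi := h.infiniteSupp
  have hD := h.hullEq
  rw [hs] at hc hi hD
  rcases h.constSign with h0 | h0 <;> rw [h0, Measure.support_zero] at hc hi hD
  · rw [empty_union] at hc hi hD
    exact ⟨s.neg, -1, _, _, Or.inr ⟨rfl, h0, rfl⟩, gen_of_support h.negFinite hc hi, hD⟩
  · rw [union_empty] at hc hi hD
    exact ⟨s.pos, 1, _, _, Or.inl ⟨rfl, rfl, h0⟩, gen_of_support h.posFinite hc hi, hD⟩

theorem ofReal_rintegral (s : SignedM) (f : ℝ → ℝ) :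
    ((s.rintegral f : ℝ) : ℂ) = s.cintegral fun x => (f x : ℂ) := by
  unfold SignedM.rintegral SignedM.cintegral
  rw [integral_complex_ofReal, integral_complex_ofReal, Complex.ofReal_sub]

theorem ofReal_cauchyR (s : SignedM) (x : ℝ) : ((s.cauchyR x : ℝ) : ℂ) = s.cauchy x := by
  unfold SignedM.cauchyR SignedM.cauchy
  rw [ofReal_rintegral]
  congr 1
  ext t
  push_cast
  rfl

theorem Car.integral_withDensity_sub {μ : Measure ℝ} {a b : ℝ} (h : Car μ a b) {g : ℝ → ℝ}
    (hg : ContinuousOn g (Icc a b)) {f : ℝ → ℂ} (hf : ContinuousOn f (Icc a b)) :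
    (∫ x, f x ∂(μ.withDensity fun x => ENNReal.ofReal (g x))) -
      (∫ x, f x ∂(μ.withDensity fun x => ENNReal.ofReal (-g x))) = ∫ x, (g x : ℂ) * f x ∂μ := by
  have key : ∀ {g : ℝ → ℝ}, ContinuousOn g (Icc a b) →
      ∫ x, f x ∂(μ.withDensity fun x => ENNReal.ofReal (g x)) = ∫ x, max (g x) 0 • f x ∂μ ∧
      Integrable (fun x => max (g x) 0 • f x) μ := by
    intro g hg
    have h1 : AEMeasurable g μ := (h.integrable hg).aestronglyMeasurable.aemeasurable
    refine ⟨?_, h.integrable ((hg.sup continuousOn_const).smul hf)⟩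
    rw [integral_withDensity_eq_integral_toReal_smul₀ h1.ennreal_ofReal (by simp)]
    simp only [ENNReal.toReal_ofReal']
  have hn := key (g := fun x => -g x) hg.neg
  rw [(key hg).1, hn.1, ← integral_sub (key hg).2 hn.2]
  refine MeasureTheory.integral_congr_ae (Eventually.of_forall fun x => ?_)
  beta_reduce
  rw [← sub_smul, Complex.real_smul]
  congr 2
  simp

theorem Signed.withDensityR_cintegral {s : SignedM} {μ : Measure ℝ} {ε a b : ℝ}
    (h : Signed s μ ε) (hμ : Car μ a b) {g : ℝ → ℝ} (hg : ContinuousOn g (Icc a b)) {f : ℝ → ℂ}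
    (hf : ContinuousOn f (Icc a b)) :
    (s.withDensityR g).cintegral f = ε * ∫ x, (g x : ℂ) * f x ∂μ := by
  rw [← hμ.integral_withDensity_sub hg hf]
  unfold SignedM.cintegral SignedM.withDensityR
  rcases h with ⟨rfl, h1, h2⟩ | ⟨rfl, h1, h2⟩ <;> simp [h1, h2]

theorem mem_Off_of_lt {a b : ℝ} (h : b < a) (z : ℂ) : z ∈ Off a b :=
  Or.inr ((lt_or_ge z.re a).imp id fun h1 => h.trans_le h1)

theorem nikSys_self (σ : ℕ → SignedM) (j : ℕ) : nikSys σ j j = σ j := by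
  rw [nikSys]; simp

theorem nikSys_of_lt (σ : ℕ → SignedM) {j k : ℕ} (h : j < k) :
    nikSys σ j k = (σ j).nik (nikSys σ (j + 1) k) := by
  rw [nikSys, dif_pos h]

/-- The Cauchy transforms of a chain form a normalized system, up to signs. -/
theorem exists_NS_chain {σ : ℕ → SignedM} {Δ : ℕ → Set ℝ} (m : ℕ) : ∀ j,
    (∀ i, i < m → IsM (σ (j + i)) (Δ (j + i))) →
    (∀ i, i + 1 < m → Disjoint (Δ (j + i)) (Δ (j + i + 1))) →
    ∃ (a b : ℝ) (u : ℕ → ℂ → ℂ) (δ : ℕ → ℝ), (1 ≤ m → Δ j = Icc a b) ∧ (m = 0 → b < a) ∧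
      NS m a b u ∧ (∀ k, δ k ≠ 0) ∧
      ∀ i < m, ∀ z ∈ Off a b, (nikSys σ j (j + i)).cauchy z = δ i * u (i + 1) z := by
  induction m with
  | zero =>
    intro j _ _
    exact ⟨1, 0, fun _ _ => 1, fun _ => 1, fun h => by omega, fun _ => one_pos, rfl,
      fun _ => one_ne_zero, fun i hi => by omega⟩
  | succ m ih =>
    intro j hM hdis
    obtain ⟨c, d, v, δ, hΔ', hcd, hv, hδ, hvσ⟩ := ih (j + 1)
      (fun i hi => by have := hM (i + 1) (by omega); rwa [← add_assoc, add_right_comm] at this)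
      (fun i hi => by have := hdis (i + 1) (by omega); rwa [← add_assoc, add_right_comm j] at this)
    obtain ⟨μ, ε, a, b, hs, hμ, hΔ⟩ := (hM 0 (by omega)).exists_gen
    rw [add_zero] at hs hΔ
    have hd : Disjoint (Icc a b) (Icc c d) := by
      rcases Nat.eq_zero_or_pos m with h0 | h0
      · rw [Icc_eq_empty (hcd h0).not_ge]; exact disjoint_empty _
      · have := hdis 0 (by omega)
        rwa [add_zero, hΔ, hΔ' h0] at this
    obtain ⟨u, hu, huk⟩ := NS.cons hμ hd hv
    have hε : ε ≠ 0 := by rcases hs.sign with h | h <;> rw [h] <;> norm_num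
    refine ⟨a, b, u, fun i => if i = 0 then ε else ε * δ (i - 1), fun _ => hΔ, fun h => by omega,
      hu, fun k => ?_, fun i hi z hz => ?_⟩
    · dsimp only
      split_ifs
      · exact hε
      · exact mul_ne_zero hε (hδ _)
    · rw [huk i]
      rcases i with _ | i
      · rw [add_zero, nikSys_self, SignedM.cauchy, hs.cintegral_eq, hv.zero_eq]
        simp [cT]
      · have hoff : ∀ x ∈ Icc a b, ((nikSys σ (j + 1) (j + (i + 1))).cauchyR x : ℂ) =
            δ i * v (i + 1) x := fun x hx => by
          rw [ofReal_cauchyR, ← add_assoc, add_right_comm]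
          exact hvσ i (by omega) x (ofReal_mem_Off_of_disjoint hd.symm hx)
        have hc : ContinuousOn (nikSys σ (j + 1) (j + (i + 1))).cauchyR (Icc a b) := by
          have h1 : ContinuousOn (fun x : ℝ => ((δ i : ℂ) * v (i + 1) x).re) (Icc a b) :=
            Complex.continuous_re.comp_continuousOn (continuousOn_const.mul
              ((hv.nice (i + 1) (by omega)).continuousOn_Icc hd.symm))
          exact h1.congr fun x hx => by beta_reduce; rw [← hoff x hx, Complex.ofReal_re]
        rw [nikSys_of_lt σ (by omega), SignedM.cauchy, SignedM.nik,
          hs.withDensityR_cintegral hμ.toCar hc (continuousOn_kernel hz)]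
        have h2 : ∫ x, ((nikSys σ (j + 1) (j + (i + 1))).cauchyR x : ℂ) * (z - x)⁻¹ ∂μ =
            δ i * cT μ (fun x => v (i + 1) x) z := by
          rw [← cT_smul]
          exact hμ.integral_congr fun x hx => by beta_reduce; rw [hoff x hx]
        rw [h2]
        simp [mul_assoc]

theorem exists_NS {σ : ℕ → SignedM} {Δ : ℕ → Set ℝ} {m : ℕ} (hσ : ∀ j ≤ m, IsM (σ j) (Δ j))
    (hdis : ∀ j, j + 1 ≤ m → Δ j ∩ Δ (j + 1) = ∅) :
    ∃ (a b : ℝ) (u : ℕ → ℂ → ℂ) (δ : ℕ → ℝ), Disjoint (Δ 0) (Icc a b) ∧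
      (∀ z, z ∉ cSet (Δ 1) → z ∈ Off a b) ∧ NS m a b u ∧ (∀ k, δ k ≠ 0) ∧
      ∀ k ≤ m, ∀ z ∈ Off a b, sh1C σ k z = δ k * u k z := by
  obtain ⟨a, b, u, δ, hΔ, hlt, hu, hδ, hs⟩ := exists_NS_chain (σ := σ) (Δ := Δ) m 1
    (fun i hi => hσ _ (by omega))
    (fun i hi => disjoint_iff_inter_eq_empty.2 (hdis _ (by omega)))
  refine ⟨a, b, u, fun k => if k = 0 then 1 else δ (k - 1), ?_, fun z hz => ?_, hu, fun k => ?_,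
    fun k hk z hz => ?_⟩
  · rcases Nat.eq_zero_or_pos m with h0 | h0
    · rw [Icc_eq_empty (hlt h0).not_ge]; exact disjoint_empty _
    · rw [← hΔ h0]
      exact disjoint_iff_inter_eq_empty.2 (hdis 0 h0)
  · rcases Nat.eq_zero_or_pos m with h0 | h0
    · exact mem_Off_of_lt (hlt h0) z
    · rw [hΔ h0] at hz
      by_cases hi : z.im = 0
      · rw [← exists_real_of_im hi] at hz ⊢
        exact ofReal_mem_Off.2 fun h => hz ⟨_, h, rfl⟩
      · exact mem_Off_of_im hi
  · dsimp only
    split_ifs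
    · exact one_ne_zero
    · exact hδ _
  · rcases k with _ | k
    · simp [sh1C, hu.zero_eq]
    · have := hs k (by omega) z hz
      rw [add_comm] at this
      simpa [sh1C] using this

theorem ofReal_sh1R (σ : ℕ → SignedM) (k : ℕ) (x : ℝ) : ((sh1R σ k x : ℝ) : ℂ) = sh1C σ k x := by
  unfold sh1R sh1C
  split_ifs
  · simp
  · exact ofReal_cauchyR _ _

theorem ofReal_emb_mem {Z : Finset ℝ} {z : ℂ} :
    z ∈ Z.map ⟨fun x : ℝ => (x : ℂ), Complex.ofReal_injective⟩ ↔ ∃ x ∈ Z, (x : ℂ) = z := by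
  simp

/-- A nonzero linear form of total degree bound `N` does not have `N` zeros. -/
theorem NS.not_factor {m : ℕ} {a b : ℝ} {u : ℕ → ℂ → ℂ} (hu : NS m a b u) {n : ℕ → ℕ}
    {p : ℕ → ℝ[X]} (hp : ∀ k ≤ m, (p k).degree < n k) (hp0 : ¬ ∀ k ≤ m, p k = 0) {V : ℝ[X]}
    (hV0 : V ≠ 0) (hV : ∀ x ∈ Icc a b, V.eval x ≠ 0) {Z : Finset ℝ} (hZ : ∀ x ∈ Z, x ∉ Icc a b)
    (hn : ∑ k ∈ Finset.range (m + 1), n k ≤ V.natDegree + Z.card) {G : ℂ → ℂ}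
    (hG : ContinuousOn G (Off a b)) :
    ¬ ∀ z ∈ Off a b, lf m p u z = aeval z V * (∏ x ∈ Z, (z - x)) * G z := by
  intro h
  refine hp0 (hu.independent (isAT m hu hp (W := V * ∏ s ∈ Z, (X - C s)) (mul_ne_zero hV0
    (Finset.prod_ne_zero_iff.2 fun s _ => X_sub_C_ne_zero s)) (fun x hx => ?_) ?_ hG
    fun z hz => ?_))
  · rw [eval_mul, eval_prod]
    refine mul_ne_zero (hV x hx) (Finset.prod_ne_zero_iff.2 fun s hs => ?_)
    rw [eval_sub, eval_X, eval_C, sub_ne_zero]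
    rintro rfl
    exact hZ x hs hx
  · rw [natDegree_mul hV0 (Finset.prod_ne_zero_iff.2 fun s _ => X_sub_C_ne_zero s),
      natDegree_prod_of_monic _ _ fun s _ => monic_X_sub_C _]
    simpa using hn
  · rw [h z hz, map_mul, map_prod]
    simp

theorem exists_le_sum_eq (n : ℕ → ℕ) (m : ℕ) : ∀ N, N ≤ ∑ k ∈ Finset.range m, n k →
    ∃ n' : ℕ → ℕ, (∀ k, n' k ≤ n k) ∧ ∑ k ∈ Finset.range m, n' k = N := by
  induction m with
  | zero => intro N hN; exact ⟨n, fun _ => le_rfl, by simpa using (Nat.le_zero.1 hN).symm⟩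
  | succ m ih =>
    intro N hN
    rw [Finset.sum_range_succ] at hN
    obtain ⟨n', hn', hs⟩ := ih (N - n m) (by omega)
    refine ⟨fun k => if k = m then min N (n m) else n' k, fun k => ?_, ?_⟩
    · dsimp only
      split_ifs with h
      · rw [h]; exact min_le_right _ _
      · exact hn' k
    · rw [Finset.sum_range_succ, if_pos rfl, Finset.sum_congr rfl fun k hk =>
        if_neg (Finset.mem_range.1 hk).ne, hs]
      omega

/-- Interpolation: a linear form of total degree exceeding `S.card` can vanish on `S`. -/
theorem NS.exists_interpolation {m : ℕ} {a b : ℝ} {u : ℕ → ℂ → ℂ} (hu : NS m a b u) (n : ℕ → ℕ)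
    {S : Finset ℝ} (hS : ∀ x ∈ S, x ∉ Icc a b)
    (hn : S.card < ∑ k ∈ Finset.range (m + 1), n k) :
    ∃ p : ℕ → ℝ[X], (∀ k ≤ m, (p k).degree < n k) ∧ (¬ ∀ k ≤ m, p k = 0) ∧
      ∀ x ∈ S, lf m p u (x : ℂ) = 0 := by
  let T : (∀ k : Fin (m + 1), degreeLT ℝ (n k)) →ₗ[ℝ] (S → ℝ) :=
    LinearMap.pi fun s => ∑ k : Fin (m + 1), (u k (s : ℝ)).re •
      (Polynomial.leval (s : ℝ) ∘ₗ (degreeLT ℝ (n k)).subtype ∘ₗ LinearMap.proj k)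
  have hdim : ∀ k, Module.finrank ℝ (degreeLT ℝ k) = k := fun k => by
    rw [(degreeLTEquiv ℝ k).finrank_eq, Module.finrank_fin_fun]
  have hfin : ∀ k, Module.Finite ℝ (degreeLT ℝ k) := fun k =>
    Module.Finite.equiv (degreeLTEquiv ℝ k).symm
  have hker : LinearMap.ker T ≠ ⊥ := by
    refine LinearMap.ker_ne_bot_of_finrank_lt ?_
    rw [Module.finrank_fintype_fun_eq_card, Fintype.card_coe, Module.finrank_pi_fintype]
    simpa [hdim, Finset.sum_range] using hn
  obtain ⟨q, hq, hq0⟩ := Submodule.exists_mem_ne_zero_of_ne_bot hker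
  refine ⟨fun k => if h : k < m + 1 then (q ⟨k, h⟩ : ℝ[X]) else 0, fun k hk => ?_, fun h => ?_,
    fun x hx => ?_⟩
  · beta_reduce
    rw [dif_pos (by omega)]
    exact mem_degreeLT.1 (q ⟨k, by omega⟩).2
  · refine hq0 (funext fun k => ?_)
    have := h k (by omega)
    beta_reduce at this
    rw [dif_pos k.2] at this
    exact Subtype.ext this
  · rw [← hu.lf_re _ (ofReal_mem_Off.2 (hS x hx)), Complex.ofReal_eq_zero]
    have h1 := congrFun (LinearMap.mem_ker.1 hq) ⟨x, hx⟩
    simp only [T, LinearMap.pi_apply, LinearMap.sum_apply, LinearMap.smul_apply,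
      LinearMap.comp_apply, LinearMap.proj_apply, Submodule.subtype_apply, leval_apply,
      Pi.zero_apply, smul_eq_mul] at h1
    rw [← h1, lf, Complex.re_sum, Finset.sum_range]
    refine Finset.sum_congr rfl fun k _ => ?_
    rw [aeval_ofReal_eq, Complex.re_ofReal_mul, dif_pos k.2, mul_comm]

/-- A linear form of prescribed simple zeros and no other zeros on `[a, b]`. -/
theorem NS.exists_sign_form {m : ℕ} {c d : ℝ} {u : ℕ → ℂ → ℂ} (hu : NS m c d u) {n : ℕ → ℕ}
    {a b : ℝ} (hd : Disjoint (Icc a b) (Icc c d)) {S : Finset ℝ} (hS : ∀ x ∈ S, x ∈ Icc a b)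
    (hn : S.card < ∑ k ∈ Finset.range (m + 1), n k) :
    ∃ (p : ℕ → ℝ[X]) (w : ℝ → ℝ), (∀ k ≤ m, (p k).degree < n k) ∧ ContinuousOn w (Icc a b) ∧
      (∀ x ∈ Icc a b, w x ≠ 0) ∧
      ∀ x ∈ Icc a b, (((∏ s ∈ S, (x - s)) * w x : ℝ) : ℂ) = lf m p u x := by
  classical
  obtain ⟨n', hn', hsum⟩ := exists_le_sum_eq n (m + 1) (S.card + 1) hn
  have hout : ∀ x ∈ Icc a b, x ∉ Icc c d := fun x hx h => disjoint_left.1 hd hx h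
  have hoff : ∀ x ∈ Icc a b, (x : ℂ) ∈ Off c d := fun x hx => ofReal_mem_Off.2 (hout x hx)
  obtain ⟨p, hp, hp0, hpS⟩ := hu.exists_interpolation n' (fun x hx => hout x (hS x hx))
    (by omega)
  obtain ⟨G, hG, hGe⟩ := exists_factor (isOpen_Off c d)
    (S.map ⟨fun x : ℝ => (x : ℂ), Complex.ofReal_injective⟩) (hu.lf_differentiableOn p)
    (fun z hz => by
      obtain ⟨x, hx, rfl⟩ := ofReal_emb_mem.1 hz
      exact ⟨hoff x (hS x hx), hpS x hx⟩)
  simp only [Finset.prod_map, Function.Embedding.coeFn_mk] at hGe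
  have hGc : ContinuousOn (fun z => (starRingEnd ℂ) (G ((starRingEnd ℂ) z))) (Off c d) :=
    Complex.continuous_conj.comp_continuousOn (hG.continuousOn.comp
      Complex.continuous_conj.continuousOn fun z hz => conj_mem_Off hz)
  have hconj := eqOn_Off_of_im hG.continuousOn hGc fun z hz => by
    have h1 := hu.lf_conj p (mem_Off_of_im (a := c) (b := d) hz)
    rw [hGe, hGe z, map_mul, map_prod] at h1
    simp only [map_sub, Complex.conj_ofReal] at h1
    have h2 := mul_left_cancel₀ (Finset.prod_ne_zero_iff.2 fun s _ => ?_) h1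
    · rw [h2, Complex.conj_conj]
    · intro h0
      have h3 := congrArg Complex.im h0
      simp [hz] at h3
  have hreal : ∀ x ∈ Icc a b, (((G x).re : ℝ) : ℂ) = G x := fun x hx => by
    have h1 := hconj (hoff x hx)
    simp only [Complex.conj_ofReal] at h1
    exact exists_real_of_im (Complex.conj_eq_iff_im.1 h1.symm)
  refine ⟨p, fun x => (G x).re, fun k hk => (hp k hk).trans_le (by exact_mod_cast hn' k),
    Complex.continuous_re.comp_continuousOn (continuousOn_ofReal_comp hd.symm hG.continuousOn),
    fun x hx h0 => ?_, fun x hx => ?_⟩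
  · beta_reduce at h0
    have hGx : G x = 0 := by rw [← hreal x hx, h0, Complex.ofReal_zero]
    obtain ⟨H, hH, hHe⟩ := exists_factor (isOpen_Off c d) {(x : ℂ)} hG (fun z hz => by
      rw [Finset.mem_singleton.1 hz]
      exact ⟨hoff x hx, hGx⟩)
    refine hu.not_factor hp hp0 (X_sub_C_ne_zero x) (fun y hy => ?_)
      (fun y hy => hout y (hS y hy)) ?_ hH.continuousOn fun z _ => ?_
    · rw [eval_sub, eval_X, eval_C, sub_ne_zero]
      rintro rfl
      exact hout y hx hy
    · rw [natDegree_X_sub_C]; omega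
    · rw [hGe, hHe]
      simp
      ring
  · rw [hGe, ← hreal x hx]
    push_cast
    rfl

/-- The zeros of the linear form of a mixed type vector polynomial. -/
theorem exists_zero_set {μ : Measure ℝ} {a b c d c' d' : ℝ} {m m' : ℕ} {u u' : ℕ → ℂ → ℂ}
    (hμ : Gen μ a b) (hu : NS m c d u) (hu' : NS m' c' d' u') (hd : Disjoint (Icc a b) (Icc c d))
    (hd' : Disjoint (Icc a b) (Icc c' d')) {n n' : ℕ → ℕ} {p : ℕ → ℝ[X]}
    (hp : ∀ k ≤ m, (p k).degree < n k) (hp0 : ¬ ∀ k ≤ m, p k = 0)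
    (hn : ∑ k ∈ Finset.range (m + 1), n k = (∑ k ∈ Finset.range (m' + 1), n' k) + 1)
    (horth : ∀ i ≤ m', ∀ q : ℂ[X], q.degree < n' i →
      ∫ x : ℝ, q.eval (x : ℂ) * (u' i x * lf m p u x) ∂μ = 0) :
    ∃ t : Finset ℂ, t.card = ∑ k ∈ Finset.range (m' + 1), n' k ∧
      (∀ z ∈ t, lf m p u z = 0 ∧ deriv (lf m p u) z ≠ 0 ∧ ∃ x ∈ Ioo a b, (x : ℂ) = z) ∧
      ∀ z ∈ Off c d, lf m p u z = 0 → z ∈ t := by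
  classical
  have hout : ∀ x ∈ Icc a b, x ∉ Icc c d := fun x hx h => disjoint_left.1 hd hx h
  have hoff : ∀ x ∈ Icc a b, (x : ℂ) ∈ Off c d := fun x hx => ofReal_mem_Off.2 (hout x hx)
  have hlfc := hu.lf_continuousOn p hd
  obtain ⟨Z, hZ, hZc, hZ0⟩ := exists_zeros hμ (q := fun x => (lf m p u x).re)
    (Complex.continuous_re.comp_continuousOn hlfc) (∑ k ∈ Finset.range (m' + 1), n' k)
    fun S hS hSN => by
      obtain ⟨p', w, hp', hwc, hw0, hw⟩ := hu'.exists_sign_form hd'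
        (fun x hx => Ioo_subset_Icc_self (hS hx)) hSN
      refine ⟨w, hwc, hw0, ?_⟩
      rw [← Complex.ofReal_eq_zero, ← integral_complex_ofReal]
      have h1 : ∫ x : ℝ, (((∏ s ∈ S, (x - s)) * w x * (lf m p u x).re : ℝ) : ℂ) ∂μ =
          ∫ x : ℝ, ∑ k ∈ Finset.range (m' + 1),
            ((p' k).map (algebraMap ℝ ℂ)).eval (x : ℂ) * (u' k x * lf m p u x) ∂μ := by
        refine hμ.integral_congr fun x hx => ?_
        rw [Complex.ofReal_mul, hw x hx, hu.lf_re p (hoff x hx), lf, Finset.sum_mul]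
        simp only [eval_map_ofReal, mul_assoc]
      rw [h1, integral_finsetSum _ fun k hk => ?_]
      · refine Finset.sum_eq_zero fun k hk => ?_
        rw [Finset.mem_range, Nat.lt_succ_iff] at hk
        refine horth k hk _ ?_
        rw [degree_map]
        exact hp' k hk
      · rw [Finset.mem_range, Nat.lt_succ_iff] at hk
        refine hμ.integrable ?_
        have h2 := (hu'.nice k hk).continuousOn_Icc hd'.symm
        have h3 : ContinuousOn (fun x : ℝ => ((p' k).map (algebraMap ℝ ℂ)).eval (x : ℂ))
            (Icc a b) := by fun_prop
        exact h3.mul (h2.mul hlfc)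
  have hZI : ∀ x ∈ Z, x ∈ Icc a b := fun x hx => Ioo_subset_Icc_self (hZ hx)
  have hzero : ∀ x ∈ Z, lf m p u x = 0 := fun x hx => by
    rw [← hu.lf_re p (hoff x (hZI x hx)), hZ0 x hx, Complex.ofReal_zero]
  have hmem : ∀ z ∈ Z.map ⟨fun x : ℝ => (x : ℂ), Complex.ofReal_injective⟩,
      z ∈ Off c d ∧ lf m p u z = 0 := fun z hz => by
    obtain ⟨x, hx, rfl⟩ := ofReal_emb_mem.1 hz
    exact ⟨hoff x (hZI x hx), hzero x hx⟩
  refine ⟨Z.map ⟨fun x : ℝ => (x : ℂ), Complex.ofReal_injective⟩, by rw [Finset.card_map, hZc],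
    fun z hz => ⟨(hmem z hz).2, fun hder => ?_, ?_⟩, fun z hz h0 => ?_⟩
  · obtain ⟨G, hG, hGe⟩ := exists_factor_double (isOpen_Off c d) _ (hu.lf_differentiableOn p) hmem
      hz hder
    obtain ⟨x, hx, rfl⟩ := ofReal_emb_mem.1 hz
    refine hu.not_factor hp hp0 (X_sub_C_ne_zero x) (fun y hy => ?_)
      (fun y hy => hout y (hZI y hy)) ?_ hG.continuousOn fun z _ => ?_
    · rw [eval_sub, eval_X, eval_C, sub_ne_zero]
      rintro rfl
      exact hout y (hZI y hx) hy
    · rw [natDegree_X_sub_C]; omega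
    · rw [hGe, Finset.prod_map]
      simp
  · obtain ⟨x, hx, rfl⟩ := ofReal_emb_mem.1 hz
    exact ⟨x, hZ hx, rfl⟩
  · by_contra hzt
    by_cases hi : z.im = 0
    · obtain ⟨G, hG, hGe⟩ := exists_factor (isOpen_Off c d) (insert z _)
        (hu.lf_differentiableOn p) (Finset.forall_mem_insert _ _ _ |>.2 ⟨⟨hz, h0⟩, hmem⟩)
      have hx := exists_real_of_im hi
      refine hu.not_factor hp hp0 (X_sub_C_ne_zero z.re) (fun y hy => ?_)
        (fun y hy => hout y (hZI y hy)) ?_ hG.continuousOn fun y _ => ?_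
      · rw [eval_sub, eval_X, eval_C, sub_ne_zero]
        rintro rfl
        rw [← hx] at hz
        exact ofReal_mem_Off.1 hz hy
      · rw [natDegree_X_sub_C]; omega
      · rw [hGe, Finset.prod_insert hzt, Finset.prod_map]
        simp [hx]
    · have hzc : z ≠ (starRingEnd ℂ) z := fun h => hi (Complex.conj_eq_iff_im.1 h.symm)
      have hzt' : (starRingEnd ℂ) z ∉
          Z.map ⟨fun x : ℝ => (x : ℂ), Complex.ofReal_injective⟩ := fun h => by
        obtain ⟨x, -, hx⟩ := ofReal_emb_mem.1 h
        have := congrArg Complex.im hx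
        simp at this
        exact hi (by linarith)
      obtain ⟨G, hG, hGe⟩ := exists_factor (isOpen_Off c d) (insert z (insert _ _))
        (hu.lf_differentiableOn p) (Finset.forall_mem_insert _ _ _ |>.2 ⟨⟨hz, h0⟩,
          Finset.forall_mem_insert _ _ _ |>.2 ⟨⟨conj_mem_Off hz, by
            rw [hu.lf_conj p hz, h0, map_zero]⟩, hmem⟩⟩)
      have hdeg : (X ^ 2 + C (-2 * z.re) * X + C (z.re ^ 2 + z.im ^ 2) : ℝ[X]).natDegree = 2 := by
        compute_degree!
      have hev : ∀ y : ℝ, (X ^ 2 + C (-2 * z.re) * X + C (z.re ^ 2 + z.im ^ 2) : ℝ[X]).eval y =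
          (y - z.re) ^ 2 + z.im ^ 2 := fun y => by
        simp
        ring
      refine hu.not_factor hp hp0 (V := X ^ 2 + C (-2 * z.re) * X + C (z.re ^ 2 + z.im ^ 2))
        (fun h => by rw [h] at hdeg; simp at hdeg) (fun y hy => ?_)
        (fun y hy => hout y (hZI y hy)) ?_ hG.continuousOn fun y _ => ?_
      · rw [hev]
        positivity
      · rw [hdeg]; omega
      · have hq : aeval y (X ^ 2 + C (-2 * z.re) * X + C (z.re ^ 2 + z.im ^ 2) : ℝ[X]) =
            (y - z) * (y - (starRingEnd ℂ) z) := by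
          have h1 := Complex.add_conj z
          have h2 := Complex.mul_conj z
          rw [Complex.normSq_apply] at h2
          simp only [map_add, map_mul, map_pow, aeval_X, aeval_C, Complex.coe_algebraMap]
          push_cast at h1 h2 ⊢
          linear_combination y * h1 - h2
        rw [hGe, Finset.prod_insert (by simpa [hzc] using hzt),
          Finset.prod_insert hzt', Finset.prod_map, hq]
        simp only [Function.Embedding.coeFn_mk]
        ring

/-- Decay at infinity of a combination of Cauchy transforms gives orthogonality relations. -/
theorem Car.orth_of_decay {μ : Measure ℝ} {a b : ℝ} (h : Car μ a b) {s : Finset ℕ} {p : ℕ → ℝ[X]}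
    {g : ℕ → ℝ → ℂ} (hg : ∀ k ∈ s, ContinuousOn (g k) (Icc a b)) {D : ℝ[X]} {K R : ℝ} {N : ℕ}
    (hb : ∀ z : ℂ, R ≤ ‖z‖ →
      ‖∑ k ∈ s, aeval z (p k) * cT μ (g k) z - aeval z D‖ ≤ K / ‖z‖ ^ (N + 1))
    {q : ℂ[X]} (hq : q.degree < N) :
    ∫ x : ℝ, q.eval (x : ℂ) * ∑ k ∈ s, aeval (x : ℂ) (p k) * g k x ∂μ = 0 := by
  have hc : ∀ k ∈ s, ContinuousOn (fun x : ℝ => aeval (x : ℂ) (p k) * g k x) (Icc a b) := by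
    intro k hk
    have h3 : ContinuousOn (fun x : ℝ => aeval (x : ℂ) (p k)) (Icc a b) := by
      simp only [aeval_ofReal_eq]; fun_prop
    exact h3.mul (hg k hk)
  have h1 : ∀ k, ∃ E : ℂ[X], k ∈ s → ∀ z ∈ Off a b, aeval z (p k) * cT μ (g k) z =
      cT μ (fun x => aeval (x : ℂ) (p k) * g k x) z + E.eval z := by
    intro k
    by_cases hk : k ∈ s
    · obtain ⟨E, hE⟩ := h.poly_mul_cT (hg k hk) ((p k).map (algebraMap ℝ ℂ))
      simp only [eval_map_ofReal] at hE
      exact ⟨E, fun _ => hE⟩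
    · exact ⟨0, fun h => absurd h hk⟩
  choose E hE using h1
  refine (h.poly_part_zero N (continuousOn_finsetSum s hc)
    (∑ k ∈ s, E k - D.map (algebraMap ℝ ℂ)) ?_).2 q hq
  have ht : Tendsto (fun z : ℂ => |K| * ‖z‖⁻¹) (cobounded ℂ) (𝓝 0) := by
    simpa using (tendsto_norm_cobounded_atTop (E := ℂ)).inv_tendsto_atTop.const_mul |K|
  refine squeeze_zero_norm' ?_ ht
  filter_upwards [eventually_Off a b, tendsto_norm_cobounded_atTop.eventually_ge_atTop (max R 1)]
    with z hz hR
  have hz1 : 0 < ‖z‖ := one_pos.trans_le ((le_max_right _ _).trans hR)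
  have h2 : cT μ (fun x => ∑ k ∈ s, aeval (x : ℂ) (p k) * g k x) z +
      (∑ k ∈ s, E k - D.map (algebraMap ℝ ℂ)).eval z =
      ∑ k ∈ s, aeval z (p k) * cT μ (g k) z - aeval z D := by
    rw [h.cT_sum _ hc hz, Finset.sum_congr rfl fun k hk => hE k hk z hz, Finset.sum_add_distrib,
      eval_sub, eval_finsetSum, eval_map_ofReal]
    ring
  rw [h2, norm_mul, norm_pow]
  calc ‖z‖ ^ N * ‖∑ k ∈ s, aeval z (p k) * cT μ (g k) z - aeval z D‖
      ≤ ‖z‖ ^ N * (|K| / ‖z‖ ^ (N + 1)) := by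
        gcongr
        exact (hb z ((le_max_left _ _).trans hR)).trans (by gcongr; exact le_abs_self K)
    _ = |K| * ‖z‖⁻¹ := by
        field_simp
        ring

theorem sum_Icc_eq_sum_range {R : Type*} [CommSemiring R] (f s : ℕ → R) (m : ℕ) :
    f 0 + ∑ k ∈ Finset.Icc 1 m, f k * s k =
      ∑ k ∈ Finset.range (m + 1), f k * (if k = 0 then 1 else s k) := by
  have h1 : Finset.Icc 1 m = Finset.Ico (0 + 1) (m + 1) := by rw [zero_add]; rfl
  rw [Finset.range_eq_Ico, Finset.sum_eq_sum_Ico_succ_bot (by omega), if_pos rfl, mul_one, h1]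
  congr 1
  refine Finset.sum_congr rfl fun k hk => ?_
  rw [if_neg (by have := (Finset.mem_Ico.1 hk).1; omega)]

end NikAux

open NikAux Topology

/-- Lemma 2.3 (orthogonality and zeros of the mixed type linear form): the linear form
`𝒜 = a₀ + Σ a_k ŝ¹_{1,k}` of a mixed type vector polynomial satisfies
`∫ (p₀ + Σ p_j ŝ²_{1,j}) 𝒜 dσ₀² = 0` for all `deg p_j ≤ n_{2,j} − 1`, and `𝒜` has exactly
`|n₂|` zeros in `ℂ ∖ Co(supp σ₁¹)`, all simple and lying in the interior of `Co(supp σ₀¹)`. -/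
theorem stmt9
    (m1 m2 : ℕ)
    (σ1 σ2 : ℕ → SignedM) (Δ1 Δ2 : ℕ → Set ℝ)
    (hσ1 : ∀ j ≤ m1, IsM (σ1 j) (Δ1 j))
    (hdisj1 : ∀ j, j + 1 ≤ m1 → Δ1 j ∩ Δ1 (j + 1) = ∅)
    (hσ2 : ∀ j ≤ m2, IsM (σ2 j) (Δ2 j))
    (hdisj2 : ∀ j, j + 1 ≤ m2 → Δ2 j ∩ Δ2 (j + 1) = ∅)
    (hbase : σ1 0 = σ2 0)
    (n1 n2 : ℕ → ℕ)
    (hn : ∑ j ∈ Finset.range (m1 + 1), n1 j = (∑ j ∈ Finset.range (m2 + 1), n2 j) + 1)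
    (a : ℕ → Polynomial ℝ) (ha : IsMixedVP σ1 σ2 m1 m2 n1 n2 a)
    (A : ℂ → ℂ)
    (hA : ∀ z, A z = aeval z (a 0) +
      ∑ k ∈ Finset.Icc 1 m1, aeval z (a k) * (nikSys σ1 1 k).cauchy z)
    (Ar : ℝ → ℝ)
    (hAr : ∀ x, Ar x = eval x (a 0) +
      ∑ k ∈ Finset.Icc 1 m1, eval x (a k) * (nikSys σ1 1 k).cauchyR x) :
    (∀ p : ℕ → Polynomial ℝ, (∀ j ≤ m2, (p j).degree < (n2 j : WithBot ℕ)) →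
      (σ2 0).rintegral (fun x =>
        (eval x (p 0) +
          ∑ j ∈ Finset.Icc 1 m2, eval x (p j) * (nikSys σ2 1 j).cauchyR x) * Ar x) = 0) ∧
    (∃ t : Finset ℂ, t.card = ∑ j ∈ Finset.range (m2 + 1), n2 j ∧
      (∀ z ∈ t, A z = 0 ∧ deriv A z ≠ 0 ∧
        ∃ x : ℝ, x ∈ interior (Δ1 0) ∧ (x : ℂ) = z) ∧
      (∀ z : ℂ, z ∉ cSet (Δ1 1) → A z = 0 → z ∈ t)) := by
  obtain ⟨ha0, hadeg, hdec⟩ := ha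
  obtain ⟨μ, ε, b, e, hμσ, hμ, hΔ2⟩ := (hσ2 0 (by omega)).exists_gen
  have hΔ1 : Δ1 0 = Icc b e := by
    rw [← hΔ2, (hσ1 0 (by omega)).hullEq, (hσ2 0 (by omega)).hullEq, hbase]
  obtain ⟨c1, d1, u1, δ1, hd1, hout1, hu1, hδ1, hs1⟩ := exists_NS hσ1 hdisj1
  obtain ⟨c2, d2, u2, δ2, hd2, -, hu2, hδ2, hs2⟩ := exists_NS hσ2 hdisj2
  rw [hΔ1] at hd1
  rw [hΔ2] at hd2
  have hε : (ε : ℂ) ≠ 0 := by rcases hμσ.sign with h | h <;> rw [h] <;> norm_num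
  set P : ℕ → ℝ[X] := fun k => C (δ1 k) * a k with hP
  have hAs : ∀ z, A z = ∑ k ∈ Finset.range (m1 + 1), aeval z (a k) * sh1C σ1 k z := fun z =>
    (hA z).trans (sum_Icc_eq_sum_range (fun k => aeval z (a k))
      (fun k => (nikSys σ1 1 k).cauchy z) m1)
  have hArA : ∀ x : ℝ, ((Ar x : ℝ) : ℂ) = A x := fun x => by
    rw [hAs, hAr, sum_Icc_eq_sum_range (fun k => eval x (a k)) fun k => (nikSys σ1 1 k).cauchyR x]
    push_cast
    refine Finset.sum_congr rfl fun k _ => ?_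
    rw [← ofReal_sh1R, aeval_ofReal_eq]
    simp [sh1R]
  have hAlf : ∀ z ∈ Off c1 d1, A z = lf m1 P u1 z := fun z hz => by
    rw [hAs, lf]
    refine Finset.sum_congr rfl fun k hk => ?_
    rw [hs1 k (Nat.lt_succ_iff.1 (Finset.mem_range.1 hk)) z hz, hP]
    simp
    ring
  have hoff1 : ∀ x ∈ Icc b e, (x : ℂ) ∈ Off c1 d1 := fun x hx =>
    ofReal_mem_Off_of_disjoint hd1.symm hx
  have hoff2 : ∀ x ∈ Icc b e, (x : ℂ) ∈ Off c2 d2 := fun x hx =>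
    ofReal_mem_Off_of_disjoint hd2.symm hx
  have hPdeg : ∀ k ≤ m1, (P k).degree < n1 k := fun k hk => by
    rw [hP, degree_C_mul (hδ1 k)]
    exact hadeg k hk
  have hP0 : ¬ ∀ k ≤ m1, P k = 0 := fun h => ha0 fun k hk =>
    (mul_eq_zero.1 (h k hk)).resolve_left (C_ne_zero.2 (hδ1 k))
  have horth : ∀ i ≤ m2, ∀ q : ℂ[X], q.degree < n2 i →
      ∫ x : ℝ, q.eval (x : ℂ) * (u2 i x * lf m1 P u1 x) ∂μ = 0 := by
    intro i hi q hq
    obtain ⟨D, K, R, hb⟩ := hdec i hi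
    have hg : ∀ k ∈ Finset.range (m1 + 1), ∀ x ∈ Icc b e,
        (ε : ℂ) * ((sh1R σ2 i x * sh1R σ1 k x : ℝ) : ℂ) =
          ε * (δ2 i * u2 i x * (δ1 k * u1 k x)) := fun k hk x hx => by
      rw [Complex.ofReal_mul, ofReal_sh1R, ofReal_sh1R, hs2 i hi x (hoff2 x hx),
        hs1 k (Nat.lt_succ_iff.1 (Finset.mem_range.1 hk)) x (hoff1 x hx)]
    have h1 := hμ.orth_of_decay (s := Finset.range (m1 + 1)) (p := a)
      (g := fun k x => (ε : ℂ) * ((sh1R σ2 i x * sh1R σ1 k x : ℝ) : ℂ)) (D := D) (K := K) (R := R)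
      (fun k hk => by
        have k1 := (hu1.nice k (Nat.lt_succ_iff.1 (Finset.mem_range.1 hk))).continuousOn_Icc hd1.symm
        have k2 := (hu2.nice i hi).continuousOn_Icc hd2.symm
        have k3 : ContinuousOn (fun x : ℝ => (ε : ℂ) * (δ2 i * u2 i x * (δ1 k * u1 k x)))
            (Icc b e) := continuousOn_const.mul
          ((continuousOn_const.mul k2).mul (continuousOn_const.mul k1))
        exact k3.congr fun x hx => hg k hk x hx)
      (fun z hz => by
        have := hb z hz
        simp only [hμσ.cintegral_eq] at this
        simp only [cT_smul]
        exact this) hq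
    have h2 : ∫ x : ℝ, q.eval (x : ℂ) * ∑ k ∈ Finset.range (m1 + 1), aeval (x : ℂ) (a k) *
        ((ε : ℂ) * ((sh1R σ2 i x * sh1R σ1 k x : ℝ) : ℂ)) ∂μ =
        ∫ x : ℝ, (ε * δ2 i) * (q.eval (x : ℂ) * (u2 i x * lf m1 P u1 x)) ∂μ := by
      refine hμ.integral_congr fun x hx => ?_
      rw [Finset.sum_congr rfl fun k hk => by rw [hg k hk x hx], lf, Finset.mul_sum,
        Finset.mul_sum, Finset.mul_sum, Finset.mul_sum]
      refine Finset.sum_congr rfl fun k _ => ?_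
      rw [hP]
      simp
      ring
    rw [h2, integral_const_mul] at h1
    exact (mul_eq_zero.1 h1).resolve_left
      (mul_ne_zero hε (Complex.ofReal_ne_zero.2 (hδ2 i)))
  refine ⟨fun p hp => ?_, ?_⟩
  · rw [← Complex.ofReal_eq_zero, ofReal_rintegral, hμσ.cintegral_eq, mul_eq_zero]
    right
    have h1 : ∫ x : ℝ, (((eval x (p 0) + ∑ j ∈ Finset.Icc 1 m2,
        eval x (p j) * (nikSys σ2 1 j).cauchyR x) * Ar x : ℝ) : ℂ) ∂μ =
        ∫ x : ℝ, ∑ j ∈ Finset.range (m2 + 1), δ2 j *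
          (((p j).map (algebraMap ℝ ℂ)).eval (x : ℂ) * (u2 j x * lf m1 P u1 x)) ∂μ := by
      refine hμ.integral_congr fun x hx => ?_
      rw [sum_Icc_eq_sum_range (fun j => eval x (p j)) fun j => (nikSys σ2 1 j).cauchyR x,
        Complex.ofReal_mul, hArA, hAlf x (hoff1 x hx), Complex.ofReal_sum, Finset.sum_mul]
      refine Finset.sum_congr rfl fun j hj => ?_
      have h2 := hs2 j (Nat.lt_succ_iff.1 (Finset.mem_range.1 hj)) x (hoff2 x hx)
      rw [← ofReal_sh1R, sh1R] at h2
      rw [Complex.ofReal_mul, h2, eval_map_ofReal, aeval_ofReal_eq]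
      ring
    rw [h1, integral_finsetSum _ fun j hj => ?_]
    · refine Finset.sum_eq_zero fun j hj => ?_
      have hj' := Nat.lt_succ_iff.1 (Finset.mem_range.1 hj)
      rw [integral_const_mul, horth j hj' _ (by rw [degree_map]; exact hp j hj'), mul_zero]
    · have h2 := (hu2.nice j (Nat.lt_succ_iff.1 (Finset.mem_range.1 hj))).continuousOn_Icc hd2.symm
      have h3 : ContinuousOn (fun x : ℝ => ((p j).map (algebraMap ℝ ℂ)).eval (x : ℂ))
          (Icc b e) := by fun_prop
      exact (hμ.integrable (h3.mul (h2.mul (hu1.lf_continuousOn P hd1)))).const_mul _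
  · obtain ⟨t, ht, htz, hall⟩ := exists_zero_set hμ hu1 hu2 hd1 hd2 hPdeg hP0 hn horth
    refine ⟨t, ht, fun z hz => ?_, fun z hz h0 => ?_⟩
    · obtain ⟨h0, hder, x, hx, rfl⟩ := htz z hz
      have hxo := hoff1 x (Ioo_subset_Icc_self hx)
      have hev : A =ᶠ[𝓝 (x : ℂ)] lf m1 P u1 := by
        filter_upwards [(isOpen_Off c1 d1).mem_nhds hxo] with y hy using hAlf y hy
      refine ⟨(hAlf x hxo).trans h0, by rwa [hev.deriv_eq], x, ?_, rfl⟩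
      rwa [hΔ1, interior_Icc]
    · have hzo := hout1 z hz
      exact hall z hzo ((hAlf z hzo).symm.trans h0)
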